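/- Let δ > −1 and define β(δ) = min{d+1, δ + d − σ_κ}. There exists a constant c > 0, depending only on d, κ and δ, such that for all integers n ≥ 1 and all x, y ∈ S^d: |K_n^δ(h_κ²;x,y)| · h_κ²(y) ≤ c n^d (1 + n‖x̄ − ȳ‖)^{−β(δ)}. -/

import Mathlib

open MeasureTheory Finset Real

/-- Generalized binomial coefficient `C(x, k) = x (x-1) ⋯ (x-k+1) / k!`. -/
noncomputable def genBinom (x : ℝ) (k : ℕ) : ℝ :=
  (∏ i ∈ Finset.range k, (x - i)) / (Nat.factorial k)

/-- Jacobi polynomial `P_n^{(a,b)}(t)`. -/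
noncomputable def jacobiP (n : ℕ) (a b t : ℝ) : ℝ :=
  ∑ m ∈ Finset.range (n + 1),
    genBinom (n + a) (n - m) * genBinom (n + b) m * ((t - 1) / 2) ^ m * ((t + 1) / 2) ^ (n - m)

/-- Pochhammer symbol `(a)_n`. -/
noncomputable def poch (a : ℝ) (n : ℕ) : ℝ := ∏ i ∈ Finset.range n, (a + i)

/-- Gegenbauer polynomial `C_n^λ(t)`. -/
noncomputable def gegenC (n : ℕ) (l t : ℝ) : ℝ :=
  (poch (2 * l) n / poch (l + 1 / 2) n) * jacobiP n (l - 1 / 2) (l - 1 / 2) t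

/-- Cesàro coefficient `A_m^δ = C(m+δ, m)`. -/
noncomputable def cesA (δ : ℝ) (m : ℕ) : ℝ := genBinom (m + δ) m

/-- The cube `[-1,1]^m`. -/
def cube (m : ℕ) : Set (Fin m → ℝ) := Set.univ.pi fun _ => Set.Icc (-1) 1

/-- The weight `∏ (1+t_i)(1-t_i²)^{κ_i-1}` on the cube. -/
noncomputable def wprod {m : ℕ} (κ : Fin m → ℝ) (t : Fin m → ℝ) : ℝ :=
  ∏ i, (1 + t i) * (1 - t i ^ 2) ^ (κ i - 1)

/-- `λ_κ = |κ| + (d-1)/2`. -/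
noncomputable def lamK (d : ℕ) (κ : Fin (d + 1) → ℝ) : ℝ := (∑ i, κ i) + ((d : ℝ) - 1) / 2

/-- The reproducing kernel `P_n(h_κ²; x, y)` on the sphere. -/
noncomputable def hP (d : ℕ) (κ : Fin (d + 1) → ℝ) (n : ℕ)
    (x y : EuclideanSpace ℝ (Fin (d + 1))) : ℝ :=
  (∫ t in cube (d + 1), wprod κ t)⁻¹ * ((n + lamK d κ) / lamK d κ) *
    ∫ t in cube (d + 1), gegenC n (lamK d κ) (∑ i, x i * y i * t i) * wprod κ t

/-- The Cesàro `(C,δ)` kernel `K_n^δ(h_κ²; x, y)` on the sphere. -/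
noncomputable def hK (d : ℕ) (κ : Fin (d + 1) → ℝ) (δ : ℝ) (n : ℕ)
    (x y : EuclideanSpace ℝ (Fin (d + 1))) : ℝ :=
  (cesA δ n)⁻¹ * ∑ k ∈ Finset.range (n + 1), cesA δ (n - k) * hP d κ k x y

/-- `z̄ = (|z_1|, …, |z_{d+1}|)`. -/
noncomputable def ebar {m : ℕ} (z : EuclideanSpace ℝ (Fin m)) : EuclideanSpace ℝ (Fin m) :=
  (EuclideanSpace.equiv (Fin m) ℝ).symm fun i => |z i|

/-- `h_κ²(y) = ∏ |y_i|^{2κ_i}`. -/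
noncomputable def hsq {m : ℕ} (κ : Fin m → ℝ) (y : EuclideanSpace ℝ (Fin m)) : ℝ :=
  ∏ i, |y i| ^ (2 * κ i)

/-- `σ_κ = (d-1)/2 + |κ| - min_i κ_i`. -/
noncomputable def sigmaK (d : ℕ) (κ : Fin (d + 1) → ℝ) : ℝ :=
  ((d : ℝ) - 1) / 2 + (∑ i, κ i) - Finset.univ.inf' (Finset.univ_nonempty) κ

/-- The surface measure `dω` on the unit sphere `S^d`. -/
noncomputable def sphereMeas (d : ℕ) :
    Measure (Metric.sphere (0 : EuclideanSpace ℝ (Fin (d + 1))) 1) :=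
  (volume : Measure (EuclideanSpace ℝ (Fin (d + 1)))).toSphere

/-- The `n`-th Taylor coefficient of `f` at `0`. -/
noncomputable def taylorCoeff (f : ℂ → ℂ) (n : ℕ) : ℂ := iteratedDeriv n f 0 / n.factorial

theorem taylorCoeff_zero (f : ℂ → ℂ) : taylorCoeff f 0 = f 0 := by
  simp [taylorCoeff]

theorem taylorCoeff_congr {f g : ℂ → ℂ} (h : f =ᶠ[nhds 0] g) (n : ℕ) :
    taylorCoeff f n = taylorCoeff g n := by
  rw [taylorCoeff, taylorCoeff, h.iteratedDeriv_eq]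

theorem taylorCoeff_mul {f g : ℂ → ℂ} (hf : AnalyticAt ℂ f 0) (hg : AnalyticAt ℂ g 0) (n : ℕ) :
    taylorCoeff (fun z => f z * g z) n =
      ∑ i ∈ Finset.range (n + 1), taylorCoeff f i * taylorCoeff g (n - i) := by
  rw [taylorCoeff, iteratedDeriv_fun_mul hf.contDiffAt hg.contDiffAt, Finset.sum_div]
  refine Finset.sum_congr rfl fun i hi => ?_
  have hi' : i ≤ n := by simpa [Nat.lt_succ_iff] using hi
  rw [taylorCoeff, taylorCoeff, Nat.cast_choose ℂ hi']
  have h1 : (n.factorial : ℂ) ≠ 0 := by exact_mod_cast n.factorial_ne_zero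
  have h2 : (i.factorial : ℂ) ≠ 0 := by exact_mod_cast i.factorial_ne_zero
  have h3 : ((n - i).factorial : ℂ) ≠ 0 := by exact_mod_cast (n - i).factorial_ne_zero
  field_simp

theorem taylorCoeff_deriv (f : ℂ → ℂ) (n : ℕ) :
    taylorCoeff (deriv f) n = (n + 1) * taylorCoeff f (n + 1) := by
  have h1 : (n.factorial : ℂ) ≠ 0 := by exact_mod_cast n.factorial_ne_zero
  have h2 : (n : ℂ) + 1 ≠ 0 := by exact_mod_cast n.succ_ne_zero
  rw [taylorCoeff, taylorCoeff, ← iteratedDeriv_succ', Nat.factorial_succ]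
  push_cast
  field_simp

theorem taylorCoeff_add {f g : ℂ → ℂ} (hf : AnalyticAt ℂ f 0) (hg : AnalyticAt ℂ g 0) (n : ℕ) :
    taylorCoeff (fun z => f z + g z) n = taylorCoeff f n + taylorCoeff g n := by
  rw [taylorCoeff, iteratedDeriv_fun_add hf.contDiffAt hg.contDiffAt, add_div]
  rfl

theorem taylorCoeff_const_mul {f : ℂ → ℂ} (hf : AnalyticAt ℂ f 0) (c : ℂ) (n : ℕ) :
    taylorCoeff (fun z => c * f z) n = c * taylorCoeff f n := by
  rw [taylorCoeff, iteratedDeriv_const_mul c hf.contDiffAt, mul_div_assoc]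
  rfl

theorem taylorCoeff_id_mul_zero (f : ℂ → ℂ) : taylorCoeff (fun z => z * f z) 0 = 0 := by
  simp [taylorCoeff]

theorem taylorCoeff_id_mul_succ {f : ℂ → ℂ} (hf : AnalyticAt ℂ f 0) (n : ℕ) :
    taylorCoeff (fun z => z * f z) (n + 1) = taylorCoeff f n := by
  rw [taylorCoeff_mul (f := fun z => z) analyticAt_id hf, Finset.sum_eq_single 1]
  · simp [taylorCoeff, iteratedDeriv_fun_id_zero]
  · intro b _ hb
    simp [taylorCoeff, iteratedDeriv_fun_id_zero, hb]
  · simp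

/-- Cauchy's formula for Taylor coefficients. -/
theorem taylorCoeff_eq_circleIntegral {f : ℂ → ℂ} {r : ℝ} (hr : 0 < r)
    (hf : DifferentiableOn ℂ f (Metric.closedBall 0 r)) (n : ℕ) :
    taylorCoeff f n =
      (2 * π : ℂ)⁻¹ * ∫ θ in (0 : ℝ)..2 * π, f (circleMap 0 r θ) * (circleMap 0 r θ ^ n)⁻¹ := by
  lift r to NNReal using hr.le
  have h1 := hf.hasFPowerSeriesOnBall (by exact_mod_cast hr)
  have h2 := h1.analyticAt.hasFPowerSeriesAt
  have h3 := h1.hasFPowerSeriesAt.eq_formalMultilinearSeries h2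
  have h4 := congrArg (fun p => p.coeff n) h3
  have h5 : taylorCoeff f n = (cauchyPowerSeries f 0 r).coeff n := by
    rw [h4]; simp [taylorCoeff]
  rw [h5]
  change (cauchyPowerSeries f 0 r n) (fun _ => 1) = _
  rw [cauchyPowerSeries_apply]
  have hI := Complex.I_ne_zero
  simp only [circleIntegral, smul_eq_mul, sub_zero, deriv_circleMap]
  rw [show ((2 : ℂ) * π * Complex.I)⁻¹ = (2 * π : ℂ)⁻¹ * Complex.I⁻¹ from mul_inv _ _, mul_assoc,
    ← intervalIntegral.integral_const_mul]
  congr 1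
  refine intervalIntegral.integral_congr fun θ _ => ?_
  have h0 : circleMap 0 r θ ≠ 0 := circleMap_ne_center hr.ne'
  simp only [one_div, inv_pow]
  field_simp

/-! ### Gegenbauer polynomials -/

theorem poch_succ (a : ℝ) (n : ℕ) : poch a (n + 1) = poch a n * (a + n) := by
  simp [poch, Finset.prod_range_succ]

theorem poch_pos {a : ℝ} (ha : 0 < a) (n : ℕ) : 0 < poch a n :=
  Finset.prod_pos fun i _ => by positivity

theorem poch_add (a : ℝ) (m n : ℕ) : poch a (m + n) = poch a m * poch (a + m) n := by
  induction n with
  | zero => simp [poch]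
  | succ k ih => rw [← add_assoc, poch_succ, ih, poch_succ]; push_cast; ring

theorem genBinom_eq_poch (x : ℝ) (k : ℕ) : genBinom (x + k) k = poch (x + 1) k / k.factorial := by
  rw [genBinom, poch, ← Finset.prod_range_reflect]
  congr 1
  refine Finset.prod_congr rfl fun i hi => ?_
  have : i + 1 ≤ k := by simpa using hi
  rw [show k - 1 - i = k - (i + 1) by omega, Nat.cast_sub this]
  push_cast; ring

/-- The coefficients of `₀F₁(; a; ·)`. -/
noncomputable def confluentCoeff (a : ℝ) (m : ℕ) : ℝ := (poch a m * m.factorial)⁻¹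

/-- The homogeneous form of the Gegenbauer polynomial. -/
theorem gegenC_eq_sum {l : ℝ} (hl : 0 < l) (n : ℕ) (t : ℝ) :
    gegenC n l t = poch (2 * l) n * poch (l + 1 / 2) n *
      ∑ m ∈ Finset.range (n + 1), confluentCoeff (l + 1 / 2) m * confluentCoeff (l + 1 / 2) (n - m) *
        ((t - 1) / 2) ^ m * ((t + 1) / 2) ^ (n - m) := by
  have hp : ∀ k, poch (l + 1 / 2) k ≠ 0 := fun k => (poch_pos (by positivity) k).ne'
  rw [gegenC, jacobiP, Finset.mul_sum, Finset.mul_sum]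
  refine Finset.sum_congr rfl fun m hm => ?_
  have hm' : m ≤ n := by simpa [Nat.lt_succ_iff] using hm
  obtain ⟨k, rfl⟩ := Nat.exists_eq_add_of_le hm'
  have e1 : genBinom (((m + k : ℕ) : ℝ) + (l - 1 / 2)) (m + k - m) =
      poch (l + 1 / 2) (m + k) / (poch (l + 1 / 2) m * k.factorial) := by
    rw [Nat.add_sub_cancel_left,
      show (((m + k : ℕ) : ℝ) + (l - 1 / 2)) = (m + (l - 1 / 2)) + k by push_cast; ring,
      genBinom_eq_poch, poch_add]
    rw [show (m : ℝ) + (l - 1 / 2) + 1 = l + 1 / 2 + m by ring]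
    rw [mul_div_mul_left _ _ (hp m)]
  have e2 : genBinom (((m + k : ℕ) : ℝ) + (l - 1 / 2)) m =
      poch (l + 1 / 2) (m + k) / (poch (l + 1 / 2) k * m.factorial) := by
    rw [show (((m + k : ℕ) : ℝ) + (l - 1 / 2)) = (k + (l - 1 / 2)) + m by push_cast; ring,
      genBinom_eq_poch, add_comm m k, poch_add]
    rw [show (k : ℝ) + (l - 1 / 2) + 1 = l + 1 / 2 + k by ring]
    rw [mul_div_mul_left _ _ (hp k)]
  rw [e1, e2, Nat.add_sub_cancel_left, confluentCoeff, confluentCoeff]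
  have h1 := hp m
  have h2 := hp k
  have h3 := hp (m + k)
  have h4 : (m.factorial : ℝ) ≠ 0 := by exact_mod_cast m.factorial_ne_zero
  have h5 : (k.factorial : ℝ) ≠ 0 := by exact_mod_cast k.factorial_ne_zero
  field_simp

theorem confluentCoeff_succ {a : ℝ} (ha : 0 < a) (m : ℕ) :
    confluentCoeff a m = (m + 1) * (a + m) * confluentCoeff a (m + 1) := by
  have h1 := (poch_pos ha m).ne'
  have h2 : (m.factorial : ℝ) ≠ 0 := by exact_mod_cast m.factorial_ne_zero
  have h3 : a + m ≠ 0 := by positivity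
  rw [confluentCoeff, confluentCoeff, poch_succ, Nat.factorial_succ]
  push_cast
  field_simp

/-- The weighted convolution sums `∑_{i+j=n} φ(i,j) e_i e_j q^i p^j`, with `e = confluentCoeff a`. -/
noncomputable def convSum (a p q : ℝ) (φ : ℝ → ℝ → ℝ) (n : ℕ) : ℝ :=
  ∑ x ∈ Finset.HasAntidiagonal.antidiagonal n,
    φ x.1 x.2 * (confluentCoeff a x.1 * confluentCoeff a x.2 * q ^ x.1 * p ^ x.2)

theorem mul_convSum_right {a : ℝ} (ha : 0 < a) (p q : ℝ) (φ : ℝ → ℝ → ℝ) (n : ℕ) :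
    p * convSum a p q φ n =
      convSum a p q (fun i j => j * (a + j - 1) * φ i (j - 1)) (n + 1) := by
  rw [convSum, convSum, Finset.Nat.sum_antidiagonal_succ', Finset.mul_sum]
  simp only [Nat.cast_zero, zero_mul, zero_add]
  refine Finset.sum_congr rfl fun x _ => ?_
  rw [confluentCoeff_succ ha x.2]
  push_cast
  rw [show (x.2 : ℝ) + 1 - 1 = x.2 by ring]
  ring

theorem mul_convSum_left {a : ℝ} (ha : 0 < a) (p q : ℝ) (φ : ℝ → ℝ → ℝ) (n : ℕ) :
    q * convSum a p q φ n =
      convSum a p q (fun i j => i * (a + i - 1) * φ (i - 1) j) (n + 1) := by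
  rw [convSum, convSum, Finset.Nat.sum_antidiagonal_succ, Finset.mul_sum]
  simp only [Nat.cast_zero, zero_mul, zero_add]
  refine Finset.sum_congr rfl fun x _ => ?_
  rw [confluentCoeff_succ ha x.1]
  push_cast
  rw [show (x.1 : ℝ) + 1 - 1 = x.1 by ring]
  ring

theorem convSum_recurrence {a : ℝ} (ha : 0 < a) (p q : ℝ) (n : ℕ) :
    (n + 2) * (2 * a + n) * (a + n + 1) * (a + n) * convSum a p q (fun _ _ => 1) (n + 2) =
      (2 * n + 2 * a + 1) * (a + n) * ((p + q) * convSum a p q (fun _ _ => 1) (n + 1)) -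
        (p - q) ^ 2 * convSum a p q (fun _ _ => 1) n := by
  have h2 : (p - q) ^ 2 * convSum a p q (fun _ _ => 1) n =
      p * (p * convSum a p q (fun _ _ => 1) n) - 2 * (p * (q * convSum a p q (fun _ _ => 1) n)) +
        q * (q * convSum a p q (fun _ _ => 1) n) := by ring
  rw [h2, add_mul p q, mul_convSum_right ha p q _ (n + 1), mul_convSum_left ha p q _ (n + 1),
    mul_convSum_right ha p q _ n, mul_convSum_left ha p q _ n, mul_convSum_right ha,
    mul_convSum_right ha, mul_convSum_left ha]
  simp only [convSum, Finset.mul_sum, ← Finset.sum_add_distrib, ← Finset.sum_sub_distrib]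
  refine Finset.sum_congr rfl fun x hx => ?_
  have hn : (n : ℝ) = x.1 + x.2 - 2 := by
    have := Finset.HasAntidiagonal.mem_antidiagonal.mp hx
    have h : ((x.1 + x.2 : ℕ) : ℝ) = (n + 2 : ℕ) := by rw [this]
    push_cast at h
    linarith
  rw [hn]
  ring

theorem gegenC_eq_convSum {l : ℝ} (hl : 0 < l) (n : ℕ) (t : ℝ) :
    gegenC n l t = poch (2 * l) n * poch (l + 1 / 2) n *
      convSum (l + 1 / 2) ((t + 1) / 2) ((t - 1) / 2) (fun _ _ => 1) n := by
  rw [gegenC_eq_sum hl, convSum, Finset.Nat.sum_antidiagonal_eq_sum_range_succ_mk]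
  simp only [one_mul]

theorem gegenC_zero (l t : ℝ) : gegenC 0 l t = 1 := by
  simp [gegenC, jacobiP, genBinom, poch]

theorem gegenC_one {l : ℝ} (hl : 0 < l) (t : ℝ) : gegenC 1 l t = 2 * l * t := by
  rw [gegenC_eq_convSum hl]
  have h : l + 1 / 2 ≠ 0 := by positivity
  simp only [convSum, Finset.Nat.antidiagonal_succ, confluentCoeff, poch]
  simp
  field_simp
  ring

theorem gegenC_recurrence {l : ℝ} (hl : 0 < l) (n : ℕ) (t : ℝ) :
    (n + 2) * gegenC (n + 2) l t =
      2 * t * (n + 1 + l) * gegenC (n + 1) l t - (n + 2 * l) * gegenC n l t := by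
  have h := convSum_recurrence (a := l + 1 / 2) (by positivity) ((t + 1) / 2) ((t - 1) / 2) n
  rw [show ((t + 1) / 2 + (t - 1) / 2) = t by ring,
    show ((t + 1) / 2 - (t - 1) / 2) = 1 by ring] at h
  rw [gegenC_eq_convSum hl, gegenC_eq_convSum hl, gegenC_eq_convSum hl, poch_succ, poch_succ,
    poch_succ, poch_succ]
  push_cast
  linear_combination (poch (2 * l) n * poch (l + 1 / 2) n * (2 * l + n)) * h

/-! ### Generating functions -/

theorem cesA_eq (δ : ℝ) (n : ℕ) : cesA δ n = poch (δ + 1) n / n.factorial := by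
  rw [cesA, add_comm, genBinom_eq_poch]

theorem cpow_eq_cpow_sub_one_mul {z : ℂ} (hz : z ≠ 0) (c : ℂ) : z ^ c = z ^ (c - 1) * z := by
  rw [Complex.cpow_sub _ _ hz, Complex.cpow_one, div_mul_cancel₀ _ hz]

theorem one_sub_mem_slitPlane {z : ℂ} (hz : ‖z‖ < 1) : 1 - z ∈ Complex.slitPlane := by
  left
  have := (Complex.abs_re_le_norm z).trans_lt hz
  simp only [Complex.sub_re, Complex.one_re]
  linarith [(abs_lt.mp this).2]

theorem gegen_quad_mem_slitPlane {t : ℝ} (ht : t ∈ Set.Icc (-1 : ℝ) 1) {z : ℂ} (hz : ‖z‖ < 1) :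
    1 - 2 * t * z + z ^ 2 ∈ Complex.slitPlane := by
  have h1 : z.re ^ 2 + z.im ^ 2 < 1 := by
    have := Complex.sq_norm z
    rw [Complex.normSq_apply] at this
    nlinarith [norm_nonneg z]
  have hre : (1 - 2 * t * z + z ^ 2).re = 1 - 2 * t * z.re + (z.re ^ 2 - z.im ^ 2) := by
    simp [sq]
  have him : (1 - 2 * t * z + z ^ 2).im = 2 * z.im * (z.re - t) := by
    simp [sq]; ring
  rw [Complex.mem_slitPlane_iff, hre, him]
  by_cases h : 2 * z.im * (z.re - t) = 0
  · left
    rcases mul_eq_zero.mp h with h | h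
    · have hy : z.im = 0 := by linarith
      rw [hy] at h1 ⊢
      nlinarith [ht.1, ht.2, sq_nonneg (z.re - t), mul_nonneg (sub_nonneg.mpr ht.2)
        (by linarith [ht.1] : (0 : ℝ) ≤ 1 + t), sq_nonneg (z.re + t)]
    · have hx : z.re = t := by linarith
      rw [hx] at h1 ⊢
      nlinarith
  · exact Or.inr h

theorem hasDerivAt_one_sub_cpow {z : ℂ} (hz : ‖z‖ < 1) (c : ℂ) :
    HasDerivAt (fun z : ℂ => (1 - z) ^ c) (-c * (1 - z) ^ (c - 1)) z := by
  have := ((hasDerivAt_id' z).const_sub 1).cpow_const (c := c) (one_sub_mem_slitPlane hz)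
  convert this using 1
  ring

theorem hasDerivAt_gegen_quad_cpow {t : ℝ} (ht : t ∈ Set.Icc (-1 : ℝ) 1) {z : ℂ} (hz : ‖z‖ < 1)
    (c : ℂ) :
    HasDerivAt (fun z : ℂ => (1 - 2 * t * z + z ^ 2) ^ c)
      (c * (2 * z - 2 * t) * (1 - 2 * t * z + z ^ 2) ^ (c - 1)) z := by
  have h1 : HasDerivAt (fun z : ℂ => 1 - 2 * t * z + z ^ 2) (2 * z - 2 * t) z := by
    have := ((((hasDerivAt_id' z).const_mul (2 * (t : ℂ))).const_sub 1).add (hasDerivAt_pow 2 z))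
    refine this.congr_deriv ?_
    norm_num
    ring
  have := h1.cpow_const (c := c) (gegen_quad_mem_slitPlane ht hz)
  convert this using 1
  ring

theorem analyticAt_one_sub_cpow (c : ℂ) : AnalyticAt ℂ (fun z : ℂ => (1 - z) ^ c) 0 :=
  DifferentiableOn.analyticAt (s := Metric.ball 0 1)
    (fun z hz => (hasDerivAt_one_sub_cpow (by simpa using hz) c).differentiableAt.differentiableWithinAt)
    (Metric.ball_mem_nhds _ one_pos)

theorem analyticAt_gegen_quad_cpow {t : ℝ} (ht : t ∈ Set.Icc (-1 : ℝ) 1) (c : ℂ) :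
    AnalyticAt ℂ (fun z : ℂ => (1 - 2 * t * z + z ^ 2) ^ c) 0 :=
  DifferentiableOn.analyticAt (s := Metric.ball 0 1)
    (fun z hz =>
      (hasDerivAt_gegen_quad_cpow ht (by simpa using hz) c).differentiableAt.differentiableWithinAt)
    (Metric.ball_mem_nhds _ one_pos)

theorem eventually_norm_lt_one : ∀ᶠ z : ℂ in nhds 0, ‖z‖ < 1 := by
  filter_upwards [Metric.ball_mem_nhds (0 : ℂ) one_pos] with z hz using by simpa using hz

theorem taylorCoeff_one_sub_cpow (δ : ℝ) (n : ℕ) :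
    taylorCoeff (fun z : ℂ => (1 - z) ^ (-(δ + 1) : ℂ)) n = cesA δ n := by
  set f : ℂ → ℂ := fun z => (1 - z) ^ (-(δ + 1) : ℂ) with hf
  have hfa : AnalyticAt ℂ f 0 := analyticAt_one_sub_cpow _
  have ode : (fun z => deriv f z + (-1) * (z * deriv f z)) =ᶠ[nhds 0] fun z => (δ + 1 : ℂ) * f z := by
    filter_upwards [eventually_norm_lt_one] with z hz
    rw [(hasDerivAt_one_sub_cpow hz _).deriv, hf]
    have h0 : 1 - z ≠ 0 := Complex.slitPlane_ne_zero (one_sub_mem_slitPlane hz)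
    simp only
    rw [cpow_eq_cpow_sub_one_mul h0 (-(δ + 1))]
    ring
  have key : ∀ n : ℕ, ((n : ℂ) + 1) * taylorCoeff f (n + 1) - n * taylorCoeff f n =
      (δ + 1) * taylorCoeff f n := by
    intro n
    have h := taylorCoeff_congr ode n
    have ha : AnalyticAt ℂ (fun z => z * deriv f z) 0 := analyticAt_id.mul hfa.deriv
    have hb : AnalyticAt ℂ (fun z => (-1) * (z * deriv f z)) 0 := analyticAt_const.mul ha
    rw [taylorCoeff_const_mul hfa, taylorCoeff_add hfa.deriv hb,
      taylorCoeff_const_mul ha, taylorCoeff_deriv] at h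
    rw [← h]
    cases n with
    | zero => rw [taylorCoeff_id_mul_zero]; simp
    | succ m => rw [taylorCoeff_id_mul_succ hfa.deriv, taylorCoeff_deriv]; push_cast; ring
  induction n with
  | zero => simp [taylorCoeff_zero, hf, cesA, genBinom]
  | succ m ih =>
    have h := key m
    rw [ih] at h
    have h1 : (m : ℂ) + 1 ≠ 0 := by exact_mod_cast m.succ_ne_zero
    have h2 : (cesA δ (m + 1) : ℂ) = cesA δ m * (δ + 1 + m) / (m + 1) := by
      rw [cesA_eq, cesA_eq, poch_succ, Nat.factorial_succ]
      have : (m.factorial : ℂ) ≠ 0 := by exact_mod_cast m.factorial_ne_zero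
      push_cast
      field_simp
    rw [h2, eq_div_iff h1]
    linear_combination h

theorem taylorCoeff_gegen {l : ℝ} (hl : 0 < l) {t : ℝ} (ht : t ∈ Set.Icc (-1 : ℝ) 1) (n : ℕ) :
    taylorCoeff (fun z : ℂ => (1 - 2 * t * z + z ^ 2) ^ (-l : ℂ)) n = gegenC n l t := by
  set f : ℂ → ℂ := fun z => (1 - 2 * t * z + z ^ 2) ^ (-l : ℂ) with hf
  have hfa : AnalyticAt ℂ f 0 := analyticAt_gegen_quad_cpow ht _
  have hfd := hfa.deriv
  have hzfd : AnalyticAt ℂ (fun z => z * deriv f z) 0 := analyticAt_id.mul hfd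
  have hzzfd : AnalyticAt ℂ (fun z => z * (z * deriv f z)) 0 := analyticAt_id.mul hzfd
  have hzf : AnalyticAt ℂ (fun z => z * f z) 0 := analyticAt_id.mul hfa
  have ode : (fun z => deriv f z + ((-2 * t) * (z * deriv f z) + z * (z * deriv f z))) =ᶠ[nhds 0]
      fun z => (2 * l * t : ℂ) * f z + (-2 * l : ℂ) * (z * f z) := by
    filter_upwards [eventually_norm_lt_one] with z hz
    rw [(hasDerivAt_gegen_quad_cpow ht hz _).deriv, hf]
    have h0 := Complex.slitPlane_ne_zero (gegen_quad_mem_slitPlane ht hz)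
    simp only
    rw [cpow_eq_cpow_sub_one_mul h0 (-l)]
    ring
  have f0 : taylorCoeff f 0 = 1 := by simp [taylorCoeff_zero, hf]
  have expand : ∀ n, (n + 1) * taylorCoeff f (n + 1) +
      (-2 * t * taylorCoeff (fun z => z * deriv f z) n + taylorCoeff (fun z => z * (z * deriv f z)) n) =
      2 * l * t * taylorCoeff f n + (-2 * l) * taylorCoeff (fun z => z * f z) n := by
    intro n
    have h := taylorCoeff_congr ode n
    have h1 : AnalyticAt ℂ (fun z => (-2 * t) * (z * deriv f z)) 0 := analyticAt_const.mul hzfd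
    have h2 : AnalyticAt ℂ (fun z => (-2 * t) * (z * deriv f z) + z * (z * deriv f z)) 0 :=
      h1.add hzzfd
    have h3 : AnalyticAt ℂ (fun z => (2 * l * t : ℂ) * f z) 0 := analyticAt_const.mul hfa
    have h4 : AnalyticAt ℂ (fun z => (-2 * l : ℂ) * (z * f z)) 0 := analyticAt_const.mul hzf
    rwa [taylorCoeff_add hfd h2,
      taylorCoeff_add h1 hzzfd, taylorCoeff_const_mul hzfd,
      taylorCoeff_add h3 h4,
      taylorCoeff_const_mul hfa, taylorCoeff_const_mul hzf, taylorCoeff_deriv] at h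
  have f1 : taylorCoeff f 1 = 2 * l * t := by
    have h := expand 0
    rw [taylorCoeff_id_mul_zero, taylorCoeff_id_mul_zero, taylorCoeff_id_mul_zero, f0] at h
    simpa using h
  have key : ∀ n : ℕ, ((n : ℂ) + 2) * taylorCoeff f (n + 2) =
      2 * t * (n + 1 + l) * taylorCoeff f (n + 1) - (n + 2 * l) * taylorCoeff f n := by
    intro n
    have h := expand (n + 1)
    rw [taylorCoeff_id_mul_succ hfd, taylorCoeff_id_mul_succ hzfd, taylorCoeff_id_mul_succ hfa,
      taylorCoeff_deriv] at h
    have h2 : taylorCoeff (fun z => z * deriv f z) n = n * taylorCoeff f n := by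
      cases n with
      | zero => rw [taylorCoeff_id_mul_zero]; simp
      | succ m => rw [taylorCoeff_id_mul_succ hfd, taylorCoeff_deriv]; push_cast; ring
    rw [h2] at h
    push_cast at h
    linear_combination h
  induction n using Nat.twoStepInduction with
  | zero => simp [f0, gegenC_zero]
  | one => simp [f1, gegenC_one hl]
  | more m ih1 ih2 =>
    have h1 : (m : ℂ) + 2 ≠ 0 := by exact_mod_cast (m + 1).succ_ne_zero
    refine mul_left_cancel₀ h1 ?_
    rw [key, ih1, ih2]
    have := gegenC_recurrence hl m t
    rw [show ((m : ℂ) + 2) * (gegenC (m + 2) l t : ℂ) = (((m + 2) * gegenC (m + 2) l t : ℝ) : ℂ) by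
      push_cast; ring, this]
    push_cast
    ring

/-- The generating function of the Cesàro kernels of Gegenbauer expansions. -/
noncomputable def cesaroGen (δ l t : ℝ) (z : ℂ) : ℂ :=
  (1 - z) ^ (-δ : ℂ) * (1 + z) * (1 - 2 * t * z + z ^ 2) ^ (-(l + 1) : ℂ)

theorem taylorCoeff_cesaroGen (δ : ℝ) {l : ℝ} (hl : 0 < l) {t : ℝ}
    (ht : t ∈ Set.Icc (-1 : ℝ) 1) (n : ℕ) :
    taylorCoeff (cesaroGen δ l t) n =
      ((∑ k ∈ Finset.range (n + 1), cesA δ (n - k) * ((k + l) / l) * gegenC k l t : ℝ) : ℂ) := by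
  have hl' : (l : ℂ) ≠ 0 := by exact_mod_cast hl.ne'
  set f : ℂ → ℂ := fun z => (1 - 2 * t * z + z ^ 2) ^ (-l : ℂ) with hf
  have hfa : AnalyticAt ℂ f 0 := analyticAt_gegen_quad_cpow ht _
  have hzfd : AnalyticAt ℂ (fun z => z * deriv f z) 0 := analyticAt_id.mul hfa.deriv
  set P : ℂ → ℂ := fun z => (l : ℂ)⁻¹ * (z * deriv f z) + f z with hP
  have hPa : AnalyticAt ℂ P 0 := (analyticAt_const.mul hzfd).add hfa
  have hPc : ∀ k : ℕ, taylorCoeff P k = ((k + l) / l : ℝ) * gegenC k l t := by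
    intro k
    have h1 : AnalyticAt ℂ (fun z => (l : ℂ)⁻¹ * (z * deriv f z)) 0 := analyticAt_const.mul hzfd
    rw [hP, taylorCoeff_add h1 hfa, taylorCoeff_const_mul hzfd,
      ← taylorCoeff_gegen hl ht]
    have h2 : taylorCoeff (fun z => z * deriv f z) k = k * taylorCoeff f k := by
      cases k with
      | zero => rw [taylorCoeff_id_mul_zero]; simp
      | succ m => rw [taylorCoeff_id_mul_succ hfa.deriv, taylorCoeff_deriv]; push_cast; ring
    rw [h2]
    push_cast
    field_simp
    exact mul_comm _ _
  have heq : cesaroGen δ l t =ᶠ[nhds 0] fun z => P z * (1 - z) ^ (-(δ + 1) : ℂ) := by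
    filter_upwards [eventually_norm_lt_one] with z hz
    have h0 := Complex.slitPlane_ne_zero (gegen_quad_mem_slitPlane ht hz)
    have h1 : 1 - z ≠ 0 := Complex.slitPlane_ne_zero (one_sub_mem_slitPlane hz)
    simp only [hP, cesaroGen]
    rw [(hasDerivAt_gegen_quad_cpow ht hz _).deriv, hf]
    simp only
    rw [show (-(l + 1) : ℂ) = -l - 1 by ring, show (-(δ + 1) : ℂ) = -δ - 1 by ring,
      cpow_eq_cpow_sub_one_mul h0 (-l), cpow_eq_cpow_sub_one_mul h1 (-δ)]
    field_simp
    ring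
  rw [taylorCoeff_congr heq, taylorCoeff_mul hPa (analyticAt_one_sub_cpow _)]
  push_cast
  refine Finset.sum_congr rfl fun k _ => ?_
  rw [hPc, taylorCoeff_one_sub_cpow]
  push_cast
  ring

/-- The coefficient of `(1 - 2 t z + z ^ 2) ^ (-(l + 1))` in the derivative of `cesaroGen`. -/
noncomputable def genCoeffFst (δ l : ℝ) (z : ℂ) : ℂ :=
  δ * (1 - z) ^ (-δ - 1 : ℂ) * (1 + z) + (1 - z) ^ (-δ : ℂ) -
    (l + 1) * (1 - z) ^ (-δ : ℂ) * (1 + z) / z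

/-- The coefficient of `(1 - 2 t z + z ^ 2) ^ (-(l + 2))` in the derivative of `cesaroGen`. -/
noncomputable def genCoeffSnd (δ l : ℝ) (z : ℂ) : ℂ :=
  (l + 1) * (1 - z) ^ (-δ : ℂ) * (1 + z) * (1 - z ^ 2) / z

theorem hasDerivAt_cesaroGen (δ l : ℝ) {t : ℝ} (ht : t ∈ Set.Icc (-1 : ℝ) 1) {z : ℂ}
    (hz : ‖z‖ < 1) :
    HasDerivAt (cesaroGen δ l t)
      ((δ * (1 - z) ^ (-δ - 1 : ℂ) * (1 + z) + (1 - z) ^ (-δ : ℂ)) *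
          (1 - 2 * t * z + z ^ 2) ^ (-(l + 1) : ℂ) -
        (l + 1) * (1 - z) ^ (-δ : ℂ) * (1 + z) * (2 * z - 2 * t) *
          (1 - 2 * t * z + z ^ 2) ^ (-(l + 2) : ℂ)) z := by
  have h := ((hasDerivAt_one_sub_cpow hz (-δ)).mul ((hasDerivAt_id' z).const_add 1)).mul
    (hasDerivAt_gegen_quad_cpow ht hz (-(l + 1)))
  refine h.congr_deriv ?_
  rw [show (-(l + 1) - 1 : ℂ) = -(l + 2) by ring]
  simp only [Pi.mul_apply]
  ring

theorem deriv_cesaroGen (δ l : ℝ) {t : ℝ} (ht : t ∈ Set.Icc (-1 : ℝ) 1) {z : ℂ}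
    (hz : ‖z‖ < 1) (hz0 : z ≠ 0) :
    deriv (cesaroGen δ l t) z =
      genCoeffFst δ l z * (1 - 2 * t * z + z ^ 2) ^ (-(l + 1) : ℂ) +
        genCoeffSnd δ l z * (1 - 2 * t * z + z ^ 2) ^ (-(l + 2) : ℂ) := by
  rw [(hasDerivAt_cesaroGen δ l ht hz).deriv, genCoeffFst, genCoeffSnd,
    cpow_eq_cpow_sub_one_mul (Complex.slitPlane_ne_zero (gegen_quad_mem_slitPlane ht hz)) (-(l + 1)),
    show (-(l + 1) - 1 : ℂ) = -(l + 2) by ring]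
  field_simp
  ring

theorem norm_genCoeff_le (δ l : ℝ) (hl : 0 < l) {z : ℂ} (hz : ‖z‖ < 1) (hz' : 1 / 3 ≤ ‖z‖) :
    ‖genCoeffFst δ l z‖ ≤ (2 * |δ| + 2 + 12 * (l + 1)) * ‖1 - z‖ ^ (-δ - 1) ∧
      ‖genCoeffSnd δ l z‖ ≤ 3 * (l + 1) * (‖1 - z‖ ^ (-δ - 1) * ‖1 - z ^ 2‖ ^ 2) := by
  have h0 : 1 - z ≠ 0 := Complex.slitPlane_ne_zero (one_sub_mem_slitPlane hz)
  have hz0 : 0 < ‖z‖ := by linarith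
  have e1 : ‖(1 - z) ^ (-δ - 1 : ℂ)‖ = ‖1 - z‖ ^ (-δ - 1) := by
    exact_mod_cast Complex.norm_cpow_real (1 - z) (-δ - 1)
  have e2 : ‖(1 - z) ^ (-δ : ℂ)‖ = ‖1 - z‖ ^ (-δ - 1) * ‖1 - z‖ := by
    rw [cpow_eq_cpow_sub_one_mul h0, norm_mul, e1]
  set P := ‖1 - z‖ ^ (-δ - 1) with hP
  have hP0 : 0 ≤ P := by positivity
  have b1 : ‖1 + z‖ ≤ 2 := (norm_add_le _ _).trans (by rw [norm_one]; linarith)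
  have b2 : ‖1 - z‖ ≤ 2 := (norm_sub_le _ _).trans (by rw [norm_one]; linarith)
  have b3 : ‖(z : ℂ)‖⁻¹ ≤ 3 := by
    rw [inv_le_comm₀ hz0 (by norm_num)]; linarith
  have nl : ‖(l + 1 : ℂ)‖ = l + 1 := by
    rw [show (l + 1 : ℂ) = ((l + 1 : ℝ) : ℂ) by push_cast; rfl, Complex.norm_real,
      Real.norm_of_nonneg (by linarith)]
  constructor
  · rw [genCoeffFst]
    refine (norm_sub_le _ _).trans ((add_le_add (norm_add_le _ _) le_rfl).trans ?_)
    rw [norm_mul, norm_mul, norm_div, norm_mul, norm_mul, e1, e2, nl, Complex.norm_real,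
      Real.norm_eq_abs, div_eq_mul_inv]
    have c1 : |δ| * P * ‖1 + z‖ ≤ |δ| * P * 2 := by gcongr
    have c2 : P * ‖1 - z‖ ≤ P * 2 := by gcongr
    have c3 : (l + 1) * (P * ‖1 - z‖) * ‖1 + z‖ * ‖z‖⁻¹ ≤ (l + 1) * (P * 2) * 2 * 3 := by gcongr
    linarith
  · rw [genCoeffSnd, norm_div, norm_mul, norm_mul, norm_mul, e2, nl, div_eq_mul_inv]
    have : ‖1 - z ^ 2‖ = ‖1 - z‖ * ‖1 + z‖ := by rw [← norm_mul]; congr 1; ring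
    calc (l + 1) * (P * ‖1 - z‖) * ‖1 + z‖ * ‖1 - z ^ 2‖ * ‖z‖⁻¹
        = (l + 1) * (P * ‖1 - z ^ 2‖ ^ 2) * ‖z‖⁻¹ := by rw [this]; ring
      _ ≤ (l + 1) * (P * ‖1 - z ^ 2‖ ^ 2) * 3 := by gcongr
      _ = _ := by ring

/-! ### The weight on the cube -/

theorem one_add_mul_rpow_eq (k : ℝ) {t : ℝ} (ht : t ∈ Set.Ioo (-1 : ℝ) 1) :
    (1 + t) * (1 - t ^ 2) ^ (k - 1) = (1 + t) ^ k * (1 - t) ^ (k - 1) := by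
  have h1 : 0 < 1 + t := by linarith [ht.1]
  have h2 : 0 < 1 - t := by linarith [ht.2]
  rw [show 1 - t ^ 2 = (1 + t) * (1 - t) by ring, Real.mul_rpow h1.le h2.le, ← mul_assoc,
    Real.rpow_sub_one h1.ne']
  field_simp

theorem integrableOn_weight {k : ℝ} (hk : 0 < k) :
    IntegrableOn (fun t : ℝ => (1 + t) * (1 - t ^ 2) ^ (k - 1)) (Set.Icc (-1) 1) := by
  have h1 : IntervalIntegrable (fun t : ℝ => t ^ (k - 1)) volume 0 2 :=
    intervalIntegral.intervalIntegrable_rpow' (by linarith)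
  have h2 := (h1.comp_sub_left 1).symm
  norm_num at h2
  have h3 : IntervalIntegrable (fun t : ℝ => (1 + t) ^ k * (1 - t) ^ (k - 1)) volume (-1) 1 :=
    h2.continuousOn_mul (by
      apply ContinuousOn.rpow_const (by fun_prop)
      intro x _; exact Or.inr hk.le)
  rw [intervalIntegrable_iff_integrableOn_Ioo_of_le (by norm_num)] at h3
  rw [integrableOn_Icc_iff_integrableOn_Ioo]
  exact h3.congr_fun (fun t ht => (one_add_mul_rpow_eq k ht).symm) measurableSet_Ioo

theorem measurableSet_cube (m : ℕ) : MeasurableSet (cube m) :=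
  MeasurableSet.univ_pi fun _ => measurableSet_Icc

theorem isCompact_cube (m : ℕ) : IsCompact (cube m) :=
  isCompact_univ_pi fun _ => isCompact_Icc

theorem volume_restrict_cube (m : ℕ) :
    (volume : Measure (Fin m → ℝ)).restrict (cube m) =
      Measure.pi fun _ => (volume : Measure ℝ).restrict (Set.Icc (-1) 1) :=
  Measure.restrict_pi_pi _ _

theorem integrableOn_wprod {m : ℕ} {κ : Fin m → ℝ} (hκ : ∀ i, 0 < κ i) :
    IntegrableOn (wprod κ) (cube m) := by
  rw [IntegrableOn, volume_restrict_cube]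
  exact Integrable.fintype_prod (f := fun i t => (1 + t) * (1 - t ^ 2) ^ (κ i - 1))
    fun i => integrableOn_weight (hκ i)

theorem wprod_nonneg {m : ℕ} (κ : Fin m → ℝ) {t : Fin m → ℝ} (ht : t ∈ cube m) : 0 ≤ wprod κ t := by
  refine Finset.prod_nonneg fun i _ => ?_
  have h := ht i trivial
  exact mul_nonneg (by linarith [h.1]) (Real.rpow_nonneg (by nlinarith [h.1, h.2]) _)

theorem sum_mul_mem_Icc {m : ℕ} {a : Fin m → ℝ} (ha : ∑ i, |a i| ≤ 1) {t : Fin m → ℝ}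
    (ht : t ∈ cube m) : ∑ i, a i * t i ∈ Set.Icc (-1 : ℝ) 1 := by
  rw [Set.mem_Icc, ← abs_le]
  refine (Finset.abs_sum_le_sum_abs _ _).trans ((Finset.sum_le_sum fun i _ => ?_).trans ha)
  have h := ht i trivial
  rw [abs_mul]
  exact mul_le_of_le_one_right (abs_nonneg _) (abs_le.mpr h)

/-- The weighted integral over the cube of a power of the Gegenbauer quadratic. -/
noncomputable def cubeInt {m : ℕ} (κ a : Fin m → ℝ) (μ : ℝ) (z : ℂ) : ℂ :=
  ∫ t in cube m, (1 - 2 * ((∑ i, a i * t i : ℝ) : ℂ) * z + z ^ 2) ^ (-μ : ℂ) * (wprod κ t : ℂ)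

theorem norm_cubeInt_conj {m : ℕ} (κ : Fin m → ℝ) {a : Fin m → ℝ} (ha : ∑ i, |a i| ≤ 1) (μ : ℝ)
    {z : ℂ} (hz : ‖z‖ < 1) : ‖cubeInt κ a μ (starRingEnd ℂ z)‖ = ‖cubeInt κ a μ z‖ := by
  rw [← Complex.norm_conj (cubeInt κ a μ z), cubeInt, cubeInt, ← integral_conj]
  congr 1
  refine setIntegral_congr_fun (measurableSet_cube m) fun t ht => ?_
  have hs := Complex.slitPlane_arg_ne_pi (gegen_quad_mem_slitPlane (sum_mul_mem_Icc ha ht) hz)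
  simp only [map_mul, Complex.conj_ofReal]
  congr 1
  have hc := Complex.conj_cpow (1 - 2 * ((∑ i, a i * t i : ℝ) : ℂ) * z + z ^ 2) (-μ : ℂ) hs
  rw [show (starRingEnd ℂ) (-μ : ℂ) = -μ by simp] at hc
  rw [← hc]
  congr 1
  simp [Complex.conj_ofNat]

theorem continuous_gegenC (n : ℕ) (l : ℝ) : Continuous (gegenC n l) := by
  unfold gegenC jacobiP
  fun_prop

/-- A continuous function times the weight is integrable on the cube. -/
theorem integrableOn_mul_wprod {m : ℕ} {κ : Fin m → ℝ} (hκ : ∀ i, 0 < κ i)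
    {f : (Fin m → ℝ) → ℝ} (hf : ContinuousOn f (cube m)) :
    IntegrableOn (fun t => f t * wprod κ t) (cube m) :=
  (integrableOn_wprod hκ).continuousOn_mul hf (isCompact_cube m)

theorem hK_eq (d : ℕ) {κ : Fin (d + 1) → ℝ} (hκ : ∀ i, 0 < κ i) (δ : ℝ) (n : ℕ)
    (x y : EuclideanSpace ℝ (Fin (d + 1))) :
    hK d κ δ n x y = (cesA δ n)⁻¹ * (∫ t in cube (d + 1), wprod κ t)⁻¹ *
      ∫ t in cube (d + 1), (∑ k ∈ Finset.range (n + 1), cesA δ (n - k) *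
        ((k + lamK d κ) / lamK d κ) * gegenC k (lamK d κ) (∑ i, x i * y i * t i)) * wprod κ t := by
  have h : ∀ t, (∑ k ∈ Finset.range (n + 1), cesA δ (n - k) *
        ((k + lamK d κ) / lamK d κ) * gegenC k (lamK d κ) (∑ i, x i * y i * t i)) * wprod κ t =
      ∑ k ∈ Finset.range (n + 1), cesA δ (n - k) * ((k + lamK d κ) / lamK d κ) *
        (gegenC k (lamK d κ) (∑ i, x i * y i * t i) * wprod κ t) := by
    intro t
    rw [Finset.sum_mul]
    exact Finset.sum_congr rfl fun k _ => by ring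
  simp_rw [h]
  rw [integral_finsetSum, hK, mul_assoc]
  · congr 1
    rw [Finset.mul_sum]
    refine Finset.sum_congr rfl fun k _ => ?_
    rw [hP, integral_const_mul]
    ring
  · intro k _
    refine (integrableOn_mul_wprod hκ ?_).const_mul _
    exact ((continuous_gegenC k _).comp (by fun_prop)).continuousOn

theorem continuousOn_gegen_quad_cpow {X : Type*} [TopologicalSpace X] {s : Set X} {u : X → ℝ}
    {z : X → ℂ} (hu : ContinuousOn u s) (hz : ContinuousOn z s)
    (hu1 : ∀ x ∈ s, u x ∈ Set.Icc (-1 : ℝ) 1) (hz1 : ∀ x ∈ s, ‖z x‖ < 1) (c : ℂ) :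
    ContinuousOn (fun x => (1 - 2 * (u x : ℂ) * z x + z x ^ 2) ^ c) s := by
  refine ContinuousOn.cpow_const ?_ fun x hx => gegen_quad_mem_slitPlane (hu1 x hx) (hz1 x hx)
  have := Complex.continuous_ofReal.comp_continuousOn hu
  exact (continuousOn_const.sub ((continuousOn_const.mul this).mul hz)).add (hz.pow 2)

theorem continuousOn_genCoeff {X : Type*} [TopologicalSpace X] {s : Set X} {z : X → ℂ}
    (hz : ContinuousOn z s) (hz1 : ∀ x ∈ s, ‖z x‖ < 1) (hz0 : ∀ x ∈ s, z x ≠ 0) (δ l : ℝ) :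
    ContinuousOn (fun x => genCoeffFst δ l (z x)) s ∧
      ContinuousOn (fun x => genCoeffSnd δ l (z x)) s := by
  have h1 : ∀ c : ℂ, ContinuousOn (fun x => (1 - z x) ^ c) s := fun c =>
    (continuousOn_const.sub hz).cpow_const fun x hx => one_sub_mem_slitPlane (hz1 x hx)
  have a1 := h1 (-δ - 1)
  have a2 := h1 (-δ)
  constructor
  · unfold genCoeffFst
    fun_prop (disch := exact hz0)
  · unfold genCoeffSnd
    fun_prop (disch := exact hz0)

theorem differentiableOn_deriv_cesaroGen (δ l : ℝ) {t : ℝ} (ht : t ∈ Set.Icc (-1 : ℝ) 1) {r : ℝ}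
    (hr : r < 1) : DifferentiableOn ℂ (deriv (cesaroGen δ l t)) (Metric.closedBall 0 r) := by
  have h : DifferentiableOn ℂ (cesaroGen δ l t) (Metric.ball 0 1) := fun z hz =>
    (hasDerivAt_cesaroGen δ l ht (by simpa using hz)).differentiableAt.differentiableWithinAt
  exact (h.deriv Metric.isOpen_ball).mono (Metric.closedBall_subset_ball hr)

theorem nat_mul_integral_eq (δ : ℝ) {l : ℝ} (hl : 0 < l) {m : ℕ} {κ a : Fin m → ℝ}
    (hκ : ∀ i, 0 < κ i) (ha : ∑ i, |a i| ≤ 1) {r : ℝ} (hr : 0 < r) (hr1 : r < 1) (n : ℕ) :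
    ((n + 1 : ℝ) * ∫ t in cube m, (∑ k ∈ Finset.range (n + 1 + 1), cesA δ (n + 1 - k) *
        ((k + l) / l) * gegenC k l (∑ i, a i * t i)) * wprod κ t : ℂ) =
      (2 * π : ℂ)⁻¹ * ∫ θ in (0 : ℝ)..2 * π, (circleMap 0 r θ ^ n)⁻¹ *
        (genCoeffFst δ l (circleMap 0 r θ) * cubeInt κ a (l + 1) (circleMap 0 r θ) +
          genCoeffSnd δ l (circleMap 0 r θ) * cubeInt κ a (l + 2) (circleMap 0 r θ)) := by
  have hc1 : ∀ θ, ‖circleMap 0 r θ‖ < 1 := fun θ => by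
    rw [norm_circleMap_zero, abs_of_pos hr]; exact hr1
  have hc0 : ∀ θ, circleMap 0 r θ ≠ 0 := fun θ => circleMap_ne_center hr.ne'
  set Φ : ℝ → (Fin m → ℝ) → ℂ := fun θ t => (circleMap 0 r θ ^ n)⁻¹ *
    (genCoeffFst δ l (circleMap 0 r θ) *
        (1 - 2 * ((∑ i, a i * t i : ℝ) : ℂ) * circleMap 0 r θ + circleMap 0 r θ ^ 2) ^
          (-(l + 1) : ℂ) +
      genCoeffSnd δ l (circleMap 0 r θ) *
        (1 - 2 * ((∑ i, a i * t i : ℝ) : ℂ) * circleMap 0 r θ + circleMap 0 r θ ^ 2) ^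
          (-(l + 2) : ℂ)) with hΦ
  have hquad : ∀ c : ℂ, ContinuousOn (fun p : ℝ × (Fin m → ℝ) =>
      (1 - 2 * ((∑ i, a i * p.2 i : ℝ) : ℂ) * circleMap 0 r p.1 + circleMap 0 r p.1 ^ 2) ^ c)
      (Set.Icc 0 (2 * π) ×ˢ cube m) := fun c =>
    continuousOn_gegen_quad_cpow (u := fun p : ℝ × (Fin m → ℝ) => ∑ i, a i * p.2 i)
      (by fun_prop) ((continuous_circleMap 0 r).comp continuous_fst).continuousOn
      (fun p hp => sum_mul_mem_Icc ha hp.2) (fun p _ => hc1 _) c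
  have hcoef := continuousOn_genCoeff (s := Set.Icc 0 (2 * π) ×ˢ cube m)
    (z := fun p : ℝ × (Fin m → ℝ) => circleMap 0 r p.1)
    ((continuous_circleMap 0 r).comp continuous_fst).continuousOn (fun p _ => hc1 _)
    (fun p _ => hc0 _) δ l
  have hΦc : ContinuousOn (fun p : ℝ × (Fin m → ℝ) => Φ p.1 p.2)
      (Set.Icc 0 (2 * π) ×ˢ cube m) := by
    refine ContinuousOn.mul ?_ ((hcoef.1.mul (hquad _)).add (hcoef.2.mul (hquad _)))
    refine ContinuousOn.inv₀ ?_ fun p _ => pow_ne_zero _ (hc0 _)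
    exact (((continuous_circleMap 0 r).comp continuous_fst).pow n).continuousOn
  have h_int : Integrable (Function.uncurry fun θ t => Φ θ t * (wprod κ t : ℂ))
      ((volume.restrict (Set.uIoc 0 (2 * π))).prod (volume.restrict (cube m))) := by
    have hw : Integrable (fun p : ℝ × (Fin m → ℝ) => (wprod κ p.2 : ℂ))
        ((volume.restrict (Set.Icc 0 (2 * π))).prod (volume.restrict (cube m))) := by
      have h0 : Integrable (fun t => (wprod κ t : ℂ)) (volume.restrict (cube m)) :=
        (integrableOn_wprod hκ).ofReal
      have := (integrable_const (1 : ℂ) (μ := volume.restrict (Set.Icc 0 (2 * π)))).mul_prod h0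
      simpa using this
    rw [Measure.prod_restrict] at hw
    have := (show IntegrableOn _ _ _ from hw).continuousOn_mul hΦc
      (isCompact_Icc.prod (isCompact_cube m))
    rw [Measure.prod_restrict]
    refine this.mono_set (Set.prod_mono ?_ le_rfl)
    rw [Set.uIoc_of_le (by positivity)]
    exact Set.Ioc_subset_Icc_self
  have hQ : ∀ t ∈ cube m, ((n + 1 : ℝ) : ℂ) * (((∑ k ∈ Finset.range (n + 1 + 1),
      cesA δ (n + 1 - k) * ((k + l) / l) * gegenC k l (∑ i, a i * t i)) * wprod κ t : ℝ) : ℂ) =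
      (2 * π : ℂ)⁻¹ * ∫ θ in (0 : ℝ)..2 * π, Φ θ t * (wprod κ t : ℂ) := by
    intro t ht
    have hu := sum_mul_mem_Icc ha ht
    have h1 := taylorCoeff_cesaroGen δ hl hu (n + 1)
    have h2 := taylorCoeff_deriv (cesaroGen δ l (∑ i, a i * t i)) n
    have h3 := taylorCoeff_eq_circleIntegral hr (differentiableOn_deriv_cesaroGen δ l hu hr1) n
    rw [h2, h1] at h3
    rw [intervalIntegral.integral_mul_const, ← mul_assoc]
    rw [Complex.ofReal_mul, ← mul_assoc, Complex.ofReal_add, Complex.ofReal_natCast,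
      Complex.ofReal_one, h3]
    congr 2
    refine intervalIntegral.integral_congr fun θ _ => ?_
    simp only [hΦ]
    rw [deriv_cesaroGen δ l hu (hc1 θ) (hc0 θ), mul_comm]
  rw [← integral_complex_ofReal, ← integral_const_mul,
    setIntegral_congr_fun (measurableSet_cube m) hQ, integral_const_mul]
  congr 1
  rw [← intervalIntegral_integral_swap h_int]
  refine intervalIntegral.integral_congr fun θ _ => ?_
  simp only [hΦ]
  have hcI : ∀ μ : ℝ, IntegrableOn (fun t : Fin m → ℝ =>
      (1 - 2 * ((∑ i, a i * t i : ℝ) : ℂ) * circleMap 0 r θ + circleMap 0 r θ ^ 2) ^ (-μ : ℂ) *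
        (wprod κ t : ℂ)) (cube m) := by
    intro μ
    refine IntegrableOn.continuousOn_mul ?_ (integrableOn_wprod hκ).ofReal (isCompact_cube m)
    exact continuousOn_gegen_quad_cpow (u := fun t : Fin m → ℝ => ∑ i, a i * t i)
      (by fun_prop) continuousOn_const (fun p hp => sum_mul_mem_Icc ha hp) (fun p _ => hc1 _) _
  have i1 := hcI (l + 1)
  have i2 := hcI (l + 2)
  push_cast at i1 i2 ⊢
  simp only [cubeInt]
  push_cast
  rw [← integral_const_mul, ← integral_const_mul, ← integral_add (i1.const_mul _) (i2.const_mul _),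
    ← integral_const_mul]
  congr 1
  ext t
  ring

/-! ### Reduction to integrals over the upper half circle -/

theorem exists_le_cesA {δ : ℝ} (hδ : -1 < δ) :
    ∃ c : ℝ, 0 < c ∧ ∀ n : ℕ, 1 ≤ n → c * (n : ℝ) ^ δ ≤ cesA δ n := by
  have hs : 0 < δ + 1 := by linarith
  have hs2 : 0 < δ + 2 := by linarith
  obtain ⟨G, hG⟩ := (Real.GammaSeq_tendsto_Gamma (δ + 1)).bddAbove_range
  have hG' : ∀ n, Real.GammaSeq (δ + 1) n ≤ |G| + 1 := fun n =>
    (hG ⟨n, rfl⟩).trans (by linarith [le_abs_self G])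
  have hGp : 0 < |G| + 1 := by positivity
  refine ⟨((|G| + 1) * (δ + 2))⁻¹, by positivity, fun n hn => ?_⟩
  have hn0 : (0 : ℝ) < n := by exact_mod_cast hn
  have hn1 : (1 : ℝ) ≤ n := by exact_mod_cast hn
  have h := hG' n
  have hp := poch_pos hs n
  have hf : (0 : ℝ) < n.factorial := by exact_mod_cast n.factorial_pos
  have hP : ∏ j ∈ Finset.range (n + 1), (δ + 1 + (j : ℝ)) = poch (δ + 1) n * (δ + 1 + n) := by
    rw [← poch_succ]; rfl
  rw [Real.GammaSeq, hP, Real.rpow_add_one hn0.ne',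
    div_le_iff₀ (mul_pos hp (add_pos hs hn0))] at h
  rw [cesA_eq, inv_mul_le_iff₀ (by positivity), ← mul_div_assoc, le_div_iff₀ hf]
  have h2 : (|G| + 1) * (poch (δ + 1) n * (δ + 1 + n)) ≤
      (|G| + 1) * (poch (δ + 1) n * ((δ + 2) * n)) := by
    have : δ + 1 + n ≤ (δ + 2) * n := by nlinarith
    gcongr
  have h3 := h.trans h2
  refine le_of_mul_le_mul_right ?_ hn0
  linarith

theorem circleMap_two_pi_sub (r θ : ℝ) :
    circleMap 0 r (2 * π - θ) = starRingEnd ℂ (circleMap 0 r θ) := by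
  simp only [circleMap, zero_add, map_mul, Complex.conj_ofReal, ← Complex.exp_conj, Complex.conj_I]
  congr 1
  rw [Complex.exp_eq_exp_iff_exists_int]
  exact ⟨1, by push_cast; ring⟩

/-- The quantity that controls the integrand of the contour integral. -/
noncomputable def contourBound (δ l : ℝ) {m : ℕ} (κ a : Fin m → ℝ) (z : ℂ) : ℝ :=
  ‖1 - z‖ ^ (-δ - 1) * (‖cubeInt κ a (l + 1) z‖ + ‖1 - z ^ 2‖ ^ 2 * ‖cubeInt κ a (l + 2) z‖)

theorem contourBound_conj (δ l : ℝ) {m : ℕ} (κ : Fin m → ℝ) {a : Fin m → ℝ}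
    (ha : ∑ i, |a i| ≤ 1) {z : ℂ} (hz : ‖z‖ < 1) :
    contourBound δ l κ a (starRingEnd ℂ z) = contourBound δ l κ a z := by
  rw [contourBound, contourBound, norm_cubeInt_conj κ ha _ hz, norm_cubeInt_conj κ ha _ hz,
    ← Complex.norm_conj (1 - z), ← Complex.norm_conj (1 - z ^ 2)]
  simp

theorem abs_integral_le_of_contourBound_le (δ : ℝ) {l : ℝ} (hl : 0 < l) {m : ℕ}
    {κ a : Fin m → ℝ} (hκ : ∀ i, 0 < κ i) (ha : ∑ i, |a i| ≤ 1) {n : ℕ} (hn : 1 ≤ n) {g : ℝ → ℝ}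
    (hg : Continuous g) (hg0 : ∀ θ, 0 ≤ g θ)
    (hgb : ∀ θ ∈ Set.Ioo 0 π,
      contourBound δ l κ a (circleMap 0 (Real.exp (-(1 / n))) θ) ≤ g θ) :
    |∫ t in cube m, (∑ k ∈ Finset.range (n + 1), cesA δ (n - k) *
        ((k + l) / l) * gegenC k l (∑ i, a i * t i)) * wprod κ t| ≤
      6 * (2 * |δ| + 2 + 12 * (l + 1)) / n * ∫ θ in (0 : ℝ)..2 * π, g θ := by
  obtain ⟨n, rfl⟩ : ∃ k, n = k + 1 := ⟨n - 1, by omega⟩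
  set r := Real.exp (-(1 / (n + 1 : ℕ))) with hr
  have hn0 : (0 : ℝ) < (n + 1 : ℕ) := by positivity
  have hr0 : 0 < r := Real.exp_pos _
  have hr1 : r < 1 := by
    rw [hr, Real.exp_lt_one_iff]
    have : (0 : ℝ) < 1 / (n + 1 : ℕ) := by positivity
    linarith
  have hr3 : Real.exp (-1) ≤ r := by
    rw [hr, Real.exp_le_exp]
    have : (1 : ℝ) / (n + 1 : ℕ) ≤ 1 := by
      rw [div_le_one hn0]; push_cast; linarith [(Nat.cast_nonneg n : (0 : ℝ) ≤ n)]
    linarith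
  have he : Real.exp 1 ≤ 3 := (Real.exp_one_lt_d9.trans (by norm_num)).le
  have hr4 : 1 / 3 ≤ r := by
    refine le_trans ?_ hr3
    rw [Real.exp_neg, one_div]
    exact inv_anti₀ (Real.exp_pos 1) he
  have hrn : (r ^ n)⁻¹ ≤ 3 := by
    have : r ^ (n + 1) = Real.exp (-1) := by
      rw [hr, ← Real.exp_nat_mul]
      congr 1
      field_simp
    refine le_trans ?_ he
    rw [← inv_inv (Real.exp 1), ← Real.exp_neg, ← this]
    exact inv_anti₀ (by positivity) (pow_le_pow_of_le_one hr0.le hr1.le (Nat.le_succ n))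
  have hc : ∀ θ, ‖circleMap 0 r θ‖ = r := fun θ => by
    rw [norm_circleMap_zero, abs_of_pos hr0]
  set C := 2 * |δ| + 2 + 12 * (l + 1) with hC
  have hCpos : 0 < C := by positivity
  have hbound : ∀ θ, ‖(circleMap 0 r θ ^ n)⁻¹ *
      (genCoeffFst δ l (circleMap 0 r θ) * cubeInt κ a (l + 1) (circleMap 0 r θ) +
        genCoeffSnd δ l (circleMap 0 r θ) * cubeInt κ a (l + 2) (circleMap 0 r θ))‖ ≤
      3 * (C * contourBound δ l κ a (circleMap 0 r θ)) := by
    intro θ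
    obtain ⟨b1, b2⟩ := norm_genCoeff_le δ l hl (z := circleMap 0 r θ) (by rw [hc]; exact hr1)
      (by rw [hc]; exact hr4)
    rw [norm_mul, norm_inv, norm_pow, hc]
    refine mul_le_mul hrn ?_ (norm_nonneg _) (by norm_num)
    refine (norm_add_le _ _).trans ?_
    rw [norm_mul, norm_mul, contourBound]
    set P := ‖1 - circleMap 0 r θ‖ ^ (-δ - 1)
    have hP : 0 ≤ P := by positivity
    have hC2 : 3 * (l + 1) ≤ C := by rw [hC]; linarith [abs_nonneg δ]
    calc _ ≤ C * P * ‖cubeInt κ a (l + 1) (circleMap 0 r θ)‖ +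
          3 * (l + 1) * (P * ‖1 - circleMap 0 r θ ^ 2‖ ^ 2) *
            ‖cubeInt κ a (l + 2) (circleMap 0 r θ)‖ := by gcongr
      _ ≤ C * P * ‖cubeInt κ a (l + 1) (circleMap 0 r θ)‖ +
          C * (P * ‖1 - circleMap 0 r θ ^ 2‖ ^ 2) *
            ‖cubeInt κ a (l + 2) (circleMap 0 r θ)‖ := by gcongr
      _ = _ := by ring
  have hboth : ∀ᵐ θ, θ ∈ Set.Ioc 0 (2 * π) →
      contourBound δ l κ a (circleMap 0 r θ) ≤ g θ + g (2 * π - θ) := by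
    have h1 : ∀ᵐ θ : ℝ, θ ≠ π := by simp [ae_iff]
    have h2 : ∀ᵐ θ : ℝ, θ ≠ 2 * π := by simp [ae_iff]
    filter_upwards [h1, h2] with θ h1 h2 hθ
    rcases lt_or_gt_of_ne h1 with h | h
    · exact (hgb θ ⟨hθ.1, h⟩).trans (by linarith [hg0 (2 * π - θ)])
    · have h3 : θ < 2 * π := lt_of_le_of_ne hθ.2 h2
      have := hgb (2 * π - θ) ⟨by linarith, by linarith⟩
      rw [circleMap_two_pi_sub, contourBound_conj δ l κ ha (by rw [hc]; exact hr1)] at this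
      exact this.trans (by linarith [hg0 θ])
  have hcont : Continuous fun θ => g θ + g (2 * π - θ) := by fun_prop
  have hmain := intervalIntegral.norm_integral_le_of_norm_le (μ := volume)
    (f := fun θ => (circleMap 0 r θ ^ n)⁻¹ *
      (genCoeffFst δ l (circleMap 0 r θ) * cubeInt κ a (l + 1) (circleMap 0 r θ) +
        genCoeffSnd δ l (circleMap 0 r θ) * cubeInt κ a (l + 2) (circleMap 0 r θ)))
    (g := fun θ => 3 * (C * (g θ + g (2 * π - θ)))) (a := 0) (b := 2 * π)
    (by positivity)
    (by
      filter_upwards [hboth] with θ h hθ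
      exact (hbound θ).trans (by have := h hθ; gcongr))
    ((hcont.const_mul C).const_mul 3 |>.intervalIntegrable _ _)
  have hsum : ∫ θ in (0 : ℝ)..2 * π, 3 * (C * (g θ + g (2 * π - θ))) =
      6 * C * ∫ θ in (0 : ℝ)..2 * π, g θ := by
    rw [intervalIntegral.integral_const_mul, intervalIntegral.integral_const_mul,
      intervalIntegral.integral_add (hg.intervalIntegrable _ _)
        (by apply Continuous.intervalIntegrable; fun_prop),
      intervalIntegral.integral_comp_sub_left (fun θ => g θ)]
    simp only [sub_self, sub_zero]
    ring
  rw [hsum] at hmain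
  have heq := congrArg norm (nat_mul_integral_eq δ hl hκ ha hr0 hr1 n)
  rw [norm_mul, norm_mul, Complex.norm_real, Complex.norm_real, norm_inv] at heq
  have e1 : ‖(n : ℝ) + 1‖ = n + 1 := Real.norm_of_nonneg (by positivity)
  have e2 : ‖(2 * π : ℂ)‖⁻¹ ≤ 1 := by
    rw [norm_mul, Complex.norm_real, Real.norm_of_nonneg Real.pi_pos.le, Complex.norm_ofNat]
    exact inv_le_one_of_one_le₀ (by linarith [Real.pi_gt_three])
  have hI0 := (norm_nonneg _).trans hmain
  rw [div_mul_eq_mul_div, le_div_iff₀ hn0, mul_comm, ← Real.norm_eq_abs]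
  push_cast
  rw [e1] at heq
  rw [heq]
  calc _ ≤ 1 * (6 * C * ∫ θ in (0 : ℝ)..2 * π, g θ) := by gcongr
    _ = _ := by ring

/-! ### Deforming the contour in one variable -/

/-- The path `s ↦ s + i τ (1 - s ^ 2)` from `-1` to `1`. -/
noncomputable def arc (τ s : ℝ) : ℂ := s + Complex.I * τ * (1 - s ^ 2)

/-- The quotient `(1 - (arc τ s) ^ 2) / (1 - s ^ 2)`. -/
noncomputable def arcQuot (τ s : ℝ) : ℂ := 1 - 2 * Complex.I * τ * s + τ ^ 2 * (1 - s ^ 2)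

/-- The factor by which the weight changes under the substitution `arc τ`. -/
noncomputable def arcFactor (τ k s : ℝ) : ℂ :=
  (1 + Complex.I * τ * (1 - s)) * arcQuot τ s ^ ((k : ℂ) - 1) * (1 - 2 * Complex.I * τ * s)

theorem one_add_arc (τ s : ℝ) : 1 + arc τ s = (1 + s) * (1 + Complex.I * τ * (1 - s)) := by
  rw [arc]; ring

theorem one_sub_arc_sq (τ s : ℝ) : 1 - arc τ s ^ 2 = (1 - s ^ 2 : ℝ) * arcQuot τ s := by
  rw [arc, arcQuot]; push_cast
  linear_combination (-(τ : ℂ) ^ 2 * (1 - s ^ 2) ^ 2) * Complex.I_sq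

theorem arc_re (τ s : ℝ) : (arc τ s).re = s := by simp [arc, ← Complex.ofReal_pow]

theorem arc_im (τ s : ℝ) : (arc τ s).im = τ * (1 - s ^ 2) := by simp [arc, ← Complex.ofReal_pow]

theorem arcQuot_re (τ s : ℝ) : (arcQuot τ s).re = 1 + τ ^ 2 * (1 - s ^ 2) := by
  simp [arcQuot, ← Complex.ofReal_pow]

theorem one_le_arcQuot_re (τ : ℝ) {s : ℝ} (hs : s ∈ Set.Icc (-1 : ℝ) 1) : 1 ≤ (arcQuot τ s).re := by
  rw [arcQuot_re]
  have : 0 ≤ 1 - s ^ 2 := by nlinarith [hs.1, hs.2]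
  nlinarith [mul_nonneg (sq_nonneg τ) this]

theorem continuous_arc (τ : ℝ) : Continuous (arc τ) := by unfold arc; fun_prop

theorem continuousOn_arcFactor (τ k : ℝ) : ContinuousOn (arcFactor τ k) (Set.Icc (-1) 1) := by
  have h : ContinuousOn (fun s => arcQuot τ s ^ ((k : ℂ) - 1)) (Set.Icc (-1) 1) := by
    refine ContinuousOn.cpow_const (by unfold arcQuot; fun_prop) fun s hs => ?_
    left
    linarith [one_le_arcQuot_re τ hs]
  unfold arcFactor
  fun_prop

theorem norm_one_sub_arc_le {τ s : ℝ} (hτ : |τ| ≤ 1) (hs : s ∈ Set.Icc (-1 : ℝ) 1) :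
    ‖1 + Complex.I * τ * (1 - s)‖ ≤ 3 ∧ ‖1 - 2 * Complex.I * τ * s‖ ≤ 3 ∧ ‖arcQuot τ s‖ ≤ 4 := by
  have h1 : ‖(1 - s : ℂ)‖ ≤ 2 := by
    rw [show (1 - s : ℂ) = ((1 - s : ℝ) : ℂ) by push_cast; rfl, Complex.norm_real, Real.norm_eq_abs,
      abs_le]
    constructor <;> linarith [hs.1, hs.2]
  have h2 : ‖(1 - s ^ 2 : ℂ)‖ ≤ 1 := by
    rw [show (1 - s ^ 2 : ℂ) = ((1 - s ^ 2 : ℝ) : ℂ) by push_cast; rfl, Complex.norm_real,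
      Real.norm_eq_abs, abs_le]
    constructor <;> nlinarith [hs.1, hs.2]
  have h3 : ‖(s : ℂ)‖ ≤ 1 := by
    rw [Complex.norm_real, Real.norm_eq_abs, abs_le]; exact hs
  have h4 : ‖(τ : ℂ)‖ ≤ 1 := by rwa [Complex.norm_real, Real.norm_eq_abs]
  have h5 : ‖1 - 2 * Complex.I * τ * s‖ ≤ 3 := by
    refine (norm_sub_le _ _).trans ?_
    rw [norm_mul, norm_mul, norm_mul, norm_one, Complex.norm_I, Complex.norm_ofNat]
    calc (1 : ℝ) + 2 * 1 * ‖(τ : ℂ)‖ * ‖(s : ℂ)‖ ≤ 1 + 2 * 1 * 1 * 1 := by gcongr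
      _ = 3 := by norm_num
  refine ⟨?_, h5, ?_⟩
  · refine (norm_add_le _ _).trans ?_
    rw [norm_mul, norm_mul, norm_one, Complex.norm_I]
    calc (1 : ℝ) + 1 * ‖(τ : ℂ)‖ * ‖(1 - s : ℂ)‖ ≤ 1 + 1 * 1 * 2 := by gcongr
      _ = 3 := by norm_num
  · refine (norm_add_le _ _).trans ?_
    rw [norm_mul, norm_pow]
    calc ‖1 - 2 * Complex.I * τ * s‖ + ‖(τ : ℂ)‖ ^ 2 * ‖(1 - s ^ 2 : ℂ)‖ ≤ 3 + 1 ^ 2 * 1 := by gcongr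
      _ = 4 := by norm_num

theorem norm_arcQuot_cpow_le {τ s : ℝ} (hτ : |τ| ≤ 1) (hs : s ∈ Set.Icc (-1 : ℝ) 1) (k : ℝ) :
    ‖arcQuot τ s ^ ((k : ℂ) - 1)‖ ≤ 4 ^ |k - 1| := by
  have h1 : 1 ≤ ‖arcQuot τ s‖ := (one_le_arcQuot_re τ hs).trans (Complex.re_le_norm _)
  rw [show (k : ℂ) - 1 = ((k - 1 : ℝ) : ℂ) by push_cast; rfl, Complex.norm_cpow_real]
  exact (Real.rpow_le_rpow_of_exponent_le h1 (le_abs_self _)).trans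
    (Real.rpow_le_rpow (by positivity) (norm_one_sub_arc_le hτ hs).2.2 (abs_nonneg _))

theorem norm_arcFactor_le {τ s : ℝ} (hτ : |τ| ≤ 1) (hs : s ∈ Set.Icc (-1 : ℝ) 1) (k : ℝ) :
    ‖arcFactor τ k s‖ ≤ 9 * 4 ^ |k - 1| := by
  obtain ⟨h1, h2, -⟩ := norm_one_sub_arc_le hτ hs
  have h3 := norm_arcQuot_cpow_le hτ hs k
  rw [arcFactor, norm_mul, norm_mul]
  calc _ ≤ 3 * (4 : ℝ) ^ |k - 1| * 3 := by gcongr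
    _ = _ := by ring

/-- The weight `(1 + t) (1 - t ^ 2) ^ (k - 1)` as a function of a complex variable. -/
noncomputable def weightC (k : ℝ) (t : ℂ) : ℂ := (1 + t) * (1 - t ^ 2) ^ ((k : ℂ) - 1)

theorem cpow_ofReal_mul {r : ℝ} (hr : 0 < r) {q : ℂ} (hq : q ≠ 0) (c : ℂ) :
    ((r : ℂ) * q) ^ c = (r : ℂ) ^ c * q ^ c := by
  have hr' : (r : ℂ) ≠ 0 := by exact_mod_cast hr.ne'
  rw [Complex.cpow_def_of_ne_zero (mul_ne_zero hr' hq), Complex.cpow_def_of_ne_zero hr',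
    Complex.cpow_def_of_ne_zero hq, Complex.log_ofReal_mul hr hq, ← Complex.exp_add,
    Complex.ofReal_log hr.le, add_mul]

theorem weightC_arc {τ s : ℝ} (hs : s ∈ Set.Ioo (-1 : ℝ) 1) (k : ℝ) :
    weightC k (arc τ s) = ((1 + s) * (1 - s ^ 2) ^ (k - 1) : ℝ) *
      ((1 + Complex.I * τ * (1 - s)) * arcQuot τ s ^ ((k : ℂ) - 1)) := by
  have h1 : 0 < 1 - s ^ 2 := by nlinarith [hs.1, hs.2]
  have hq : arcQuot τ s ≠ 0 := by
    intro h
    have := one_le_arcQuot_re τ (Set.Ioo_subset_Icc_self hs)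
    rw [h, Complex.zero_re] at this
    linarith
  rw [weightC, one_add_arc, one_sub_arc_sq, cpow_ofReal_mul h1 hq]
  push_cast
  rw [Complex.ofReal_cpow h1.le]
  push_cast
  ring

theorem hasDerivAt_arc (τ s : ℝ) : HasDerivAt (arc τ) (1 - 2 * Complex.I * τ * s) s := by
  have h0 : HasDerivAt (fun s : ℝ => (s : ℂ)) 1 s := Complex.ofRealCLM.hasDerivAt
  have := h0.add (((h0.pow 2).const_sub 1).const_mul (Complex.I * τ))
  refine this.congr_deriv ?_
  norm_num
  ring

theorem norm_weightC_arc_le {τ s : ℝ} (hτ : |τ| ≤ 1) (hs : s ∈ Set.Ioo (-1 : ℝ) 1) (k : ℝ) :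
    ‖weightC k (arc τ s)‖ ≤ 6 * 4 ^ |k - 1| * (1 - s ^ 2) ^ (k - 1) := by
  have hs' := Set.Ioo_subset_Icc_self hs
  have h1 : 0 < 1 - s ^ 2 := by nlinarith [hs.1, hs.2]
  rw [weightC_arc hs, norm_mul, norm_mul, Complex.norm_real, Real.norm_of_nonneg
    (mul_nonneg (by linarith [hs.1]) (by positivity))]
  have h3 := norm_arcQuot_cpow_le hτ hs' k
  have h4 := (norm_one_sub_arc_le hτ hs').1
  calc _ ≤ (2 * (1 - s ^ 2) ^ (k - 1)) * (3 * 4 ^ |k - 1|) := by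
        gcongr; linarith [hs.2]
    _ = _ := by ring

theorem differentiableOn_weightC (k : ℝ) :
    DifferentiableOn ℂ (weightC k) {t : ℂ | t.re ∈ Set.Ioo (-1 : ℝ) 1} := by
  intro t ht
  refine DifferentiableAt.differentiableWithinAt ?_
  have hs : 1 - t ^ 2 ∈ Complex.slitPlane := by
    left
    have : (1 - t ^ 2).re = 1 - t.re ^ 2 + t.im ^ 2 := by simp [sq]; ring
    rw [this]
    nlinarith [ht.1, ht.2, sq_nonneg t.im]
  unfold weightC
  refine DifferentiableAt.mul (by fun_prop) (DifferentiableAt.cpow_const (by fun_prop) hs)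

theorem integral_weight_deform {f : ℂ → ℂ} (hf : DifferentiableOn ℂ f {X | X.im < 0}) {k : ℝ}
    (hk : 0 < k) {a τ : ℝ} (hτ : |τ| ≤ 1) (haτ : 0 ≤ a * τ) {B : ℂ} (hB : B.im < 0) :
    ∫ t in Set.Icc (-1 : ℝ) 1, f (B - a * t) * ((1 + t) * (1 - t ^ 2) ^ (k - 1) : ℝ) =
      ∫ s in Set.Icc (-1 : ℝ) 1,
        f (B - a * arc τ s) * arcFactor τ k s * ((1 + s) * (1 - s ^ 2) ^ (k - 1) : ℝ) := by
  set U : Set ℂ := {t : ℂ | t.re ∈ Set.Ioo (-1 : ℝ) 1} ∩ {t : ℂ | (B - a * t).im < 0} with hU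
  have hUo : IsOpen U := (isOpen_Ioo.preimage Complex.continuous_re).inter
    (isOpen_lt (by fun_prop) continuous_const)
  have hUc : Convex ℝ U := by
    refine Convex.inter ((convex_Ioo _ _).is_linear_preimage Complex.reLm.isLinear) ?_
    have : {t : ℂ | (B - a * t).im < 0} = {t : ℂ | B.im < a * t.im} := by
      ext t; simp
    rw [this]
    exact convex_halfSpace_gt (f := fun t : ℂ => a * t.im)
      ((a • Complex.imLm).isLinear) _
  have hfb : DifferentiableOn ℂ (fun t => f (B - a * t)) U :=
    hf.comp (by fun_prop) fun t ht => ht.2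
  obtain ⟨H, hH⟩ := hUc.exists_forall_hasDerivWithinAt (𝕜 := ℂ)
    (f := fun t => weightC k t * f (B - a * t))
    (((differentiableOn_weightC k).mono Set.inter_subset_left).mul hfb)
  have him : ∀ v s : ℝ, 0 ≤ v → s ∈ Set.Icc (-1 : ℝ) 1 → (B - a * arc (v * τ) s).im < 0 := by
    intro v s hv hs
    have h1 : 0 ≤ 1 - s ^ 2 := by nlinarith [hs.1, hs.2]
    have : (B - a * arc (v * τ) s).im = B.im - v * (a * τ) * (1 - s ^ 2) := by
      simp [arc_im]; ring
    rw [this]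
    nlinarith [mul_nonneg (mul_nonneg hv haτ) h1]
  have hmem : ∀ v s : ℝ, 0 ≤ v → s ∈ Set.Ioo (-1 : ℝ) 1 → arc (v * τ) s ∈ U := fun v s hv hs =>
    ⟨by simpa only [Set.mem_ofPred_eq, arc_re] using hs, him v s hv (Set.Ioo_subset_Icc_self hs)⟩
  have hH' : ∀ t ∈ U, HasDerivAt H (weightC k t * f (B - a * t)) t := fun t ht =>
    (hH t ht).hasDerivAt (hUo.mem_nhds ht)
  have hvτ : ∀ v ∈ Set.Icc (0 : ℝ) 1, |v * τ| ≤ 1 := by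
    intro v hv
    rw [abs_mul, abs_of_nonneg hv.1]
    exact mul_le_one₀ hv.2 (abs_nonneg _) hτ
  -- a uniform bound for `f` on the deformation region
  obtain ⟨M, hM⟩ : ∃ M, ∀ p ∈ Set.Icc (0 : ℝ) 1 ×ˢ Set.Icc (-1 : ℝ) 1,
      ‖f (B - a * arc (p.1 * τ) p.2)‖ ≤ M := by
    refine (isCompact_Icc.prod isCompact_Icc).exists_bound_of_continuousOn ?_
    refine hf.continuousOn.comp (by unfold arc; fun_prop) fun p hp => him _ _ hp.1.1 hp.2
  have hM0 : 0 ≤ M := (norm_nonneg _).trans (hM (0, 0) (by simp))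
  set C := 6 * 4 ^ |k - 1| * M with hC
  have hdiff : ∀ s ∈ Set.Ioo (-1 : ℝ) 1, ‖H (arc τ s) - H (arc 0 s)‖ ≤ C * (1 - s ^ 2) ^ k := by
    intro s hs
    have h1 : 0 < 1 - s ^ 2 := by nlinarith [hs.1, hs.2]
    have hd : ∀ v ∈ Set.Icc (0 : ℝ) 1, HasDerivWithinAt (fun v : ℝ => H (arc (v * τ) s))
        (weightC k (arc (v * τ) s) * f (B - a * arc (v * τ) s) *
          (Complex.I * τ * (1 - s ^ 2))) (Set.Icc 0 1) v := by
      intro v hv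
      have h0 : HasDerivAt (fun v : ℝ => (v : ℂ)) 1 v := Complex.ofRealCLM.hasDerivAt
      have hγ : HasDerivAt (fun v : ℝ => arc (v * τ) s) (Complex.I * τ * (1 - s ^ 2)) v := by
        have := (h0.mul_const (Complex.I * τ * (1 - s ^ 2))).const_add (s : ℂ)
        rw [one_mul] at this
        refine this.congr_of_eventuallyEq (Filter.Eventually.of_forall fun w => ?_)
        simp only [arc]
        push_cast
        ring
      exact ((hH' _ (hmem v s hv.1 hs)).comp v hγ).hasDerivWithinAt
    have := norm_image_sub_le_of_norm_deriv_le_segment_01' hd (C := C * (1 - s ^ 2) ^ k)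
      fun v hv => ?_
    · simpa using this
    · have hv' := Set.Ico_subset_Icc_self hv
      rw [norm_mul, norm_mul, norm_mul, norm_mul, Complex.norm_I, Complex.norm_real,
        show (1 - s ^ 2 : ℂ) = ((1 - s ^ 2 : ℝ) : ℂ) by push_cast; rfl, Complex.norm_real,
        Real.norm_of_nonneg h1.le, Real.norm_eq_abs]
      have b1 := norm_weightC_arc_le (hvτ v hv') hs k
      have b2 := hM (v, s) ⟨hv', Set.Ioo_subset_Icc_self hs⟩
      calc _ ≤ (6 * 4 ^ |k - 1| * (1 - s ^ 2) ^ (k - 1)) * M * (1 * 1 * (1 - s ^ 2)) := by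
            gcongr
        _ = C * ((1 - s ^ 2) ^ (k - 1) * (1 - s ^ 2)) := by rw [hC]; ring
        _ = C * (1 - s ^ 2) ^ k := by
            rw [← Real.rpow_add_one h1.ne']; congr 2; ring
  set K : ℝ → ℂ := fun s => H (arc τ s) - H (arc 0 s) with hK
  have hKd : ∀ s ∈ Set.Ioo (-1 : ℝ) 1, HasDerivAt K
      (f (B - a * arc τ s) * arcFactor τ k s * ((1 + s) * (1 - s ^ 2) ^ (k - 1) : ℝ) -
        f (B - a * s) * ((1 + s) * (1 - s ^ 2) ^ (k - 1) : ℝ)) s := by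
    intro s hs
    have m1 := hmem 1 s zero_le_one hs
    have m0 := hmem 0 s le_rfl hs
    rw [one_mul] at m1
    rw [zero_mul] at m0
    have := ((hH' _ m1).comp s (hasDerivAt_arc τ s)).sub ((hH' _ m0).comp s (hasDerivAt_arc 0 s))
    refine this.congr_deriv ?_
    rw [weightC_arc hs, weightC_arc hs, arcFactor]
    simp [arcQuot, arc]
    ring
  have hlim : ∀ l : Filter ℝ, l ≤ nhdsWithin (-1) (Set.Ioo (-1 : ℝ) 1) ∨ l ≤ nhdsWithin 1 (Set.Ioo (-1 : ℝ) 1) →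
      Filter.Tendsto K l (nhds 0) := by
    intro l hl
    have hmemI : ∀ᶠ s in l, s ∈ Set.Ioo (-1 : ℝ) 1 := by
      rcases hl with hl | hl <;> exact hl self_mem_nhdsWithin
    have hcont : Continuous fun s : ℝ => C * (1 - s ^ 2) ^ k :=
      continuous_const.mul (Continuous.rpow_const (by fun_prop) fun _ => Or.inr hk.le)
    have h0 : Filter.Tendsto (fun s : ℝ => C * (1 - s ^ 2) ^ k) l (nhds 0) := by
      rcases hl with hl | hl
      · have := (hcont.tendsto (-1)).mono_left (hl.trans nhdsWithin_le_nhds)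
        simpa [Real.zero_rpow hk.ne'] using this
      · have := (hcont.tendsto 1).mono_left (hl.trans nhdsWithin_le_nhds)
        simpa [Real.zero_rpow hk.ne'] using this
    exact squeeze_zero_norm' (hmemI.mono hdiff) h0
  have hw : IntegrableOn (fun t : ℝ => (((1 + t) * (1 - t ^ 2) ^ (k - 1) : ℝ) : ℂ))
      (Set.Icc (-1) 1) := (integrableOn_weight hk).ofReal
  have i1 : IntegrableOn (fun s : ℝ => f (B - a * arc τ s) * arcFactor τ k s *
      ((1 + s) * (1 - s ^ 2) ^ (k - 1) : ℝ)) (Set.Icc (-1) 1) := by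
    refine hw.continuousOn_mul (ContinuousOn.mul ?_ (continuousOn_arcFactor τ k)) isCompact_Icc
    refine hf.continuousOn.comp (by unfold arc; fun_prop) fun s hs => ?_
    simpa using him 1 s zero_le_one hs
  have i0 : IntegrableOn (fun s : ℝ => f (B - a * s) *
      ((1 + s) * (1 - s ^ 2) ^ (k - 1) : ℝ)) (Set.Icc (-1) 1) := by
    refine hw.continuousOn_mul ?_ isCompact_Icc
    refine hf.continuousOn.comp (by fun_prop) fun s hs => ?_
    simpa using hB
  have key := intervalIntegral.integral_eq_sub_of_hasDerivAt_of_tendsto (a := -1) (b := 1)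
    (by norm_num) hKd
    (by
      rw [intervalIntegrable_iff_integrableOn_Icc_of_le (by norm_num)]
      exact i1.sub i0)
    (hlim _ (Or.inl (by rw [nhdsWithin_Ioo_eq_nhdsGT (by norm_num)])))
    (hlim _ (Or.inr (by rw [nhdsWithin_Ioo_eq_nhdsLT (by norm_num)])))
  rw [intervalIntegral.integral_of_le (by norm_num), ← integral_Icc_eq_integral_Ioc,
    integral_sub i1 i0, sub_zero] at key
  exact (sub_eq_zero.mp key).symm

/-! ### Deforming the contour in several variables -/

theorem integral_cube_succ {m : ℕ} (F : (Fin (m + 1) → ℝ) → ℂ) :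
    ∫ t in cube (m + 1), F t =
      ∫ p : ℝ × (Fin m → ℝ), F (Fin.cons p.1 p.2)
        ∂((volume : Measure ℝ).restrict (Set.Icc (-1) 1)).prod (volume.restrict (cube m)) := by
  rw [volume_restrict_cube, volume_restrict_cube]
  have h := (measurePreserving_piFinSuccAbove
    (fun _ : Fin (m + 1) => (volume : Measure ℝ).restrict (Set.Icc (-1) 1)) 0).symm
  rw [← h.integral_comp' (g := F)]
  simp only [MeasurableEquiv.piFinSuccAbove_symm_apply, Fin.insertNthEquiv, Equiv.coe_fn_mk]
  simp

theorem wprod_cons {m : ℕ} (κ : Fin (m + 1) → ℝ) (t₀ : ℝ) (t : Fin m → ℝ) :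
    wprod κ (Fin.cons t₀ t) =
      ((1 + t₀) * (1 - t₀ ^ 2) ^ (κ 0 - 1)) * wprod (fun i => κ i.succ) t := by
  rw [wprod, wprod, Fin.prod_univ_succ]
  simp

theorem integrable_prod_weight {m : ℕ} {k : ℝ} (hk : 0 < k) {κ : Fin m → ℝ} (hκ : ∀ i, 0 < κ i)
    {g : ℝ × (Fin m → ℝ) → ℂ} (hg : ContinuousOn g (Set.Icc (-1) 1 ×ˢ cube m)) :
    Integrable (fun p : ℝ × (Fin m → ℝ) => g p *
      ((((1 + p.1) * (1 - p.1 ^ 2) ^ (k - 1) : ℝ) : ℂ) * (wprod κ p.2 : ℂ)))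
      (((volume : Measure ℝ).restrict (Set.Icc (-1) 1)).prod (volume.restrict (cube m))) := by
  have h0 : Integrable (fun t => (wprod κ t : ℂ)) (volume.restrict (cube m)) :=
    (integrableOn_wprod hκ).ofReal
  have h1 : Integrable (fun t : ℝ => (((1 + t) * (1 - t ^ 2) ^ (k - 1) : ℝ) : ℂ))
      (volume.restrict (Set.Icc (-1) 1)) := (integrableOn_weight hk).ofReal
  have h2 := h1.mul_prod h0
  rw [Measure.prod_restrict] at h2 ⊢
  exact (show IntegrableOn _ _ _ from h2).continuousOn_mul hg
    (isCompact_Icc.prod (isCompact_cube m))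

theorem arc_mul_im_nonneg {a τ : ℝ} (h : 0 ≤ a * τ) {s : ℝ} (hs : s ∈ Set.Icc (-1 : ℝ) 1) :
    0 ≤ ((a : ℂ) * arc τ s).im := by
  have h1 : 0 ≤ 1 - s ^ 2 := by nlinarith [hs.1, hs.2]
  have : ((a : ℂ) * arc τ s).im = a * τ * (1 - s ^ 2) := by simp [arc_im]; ring
  rw [this]
  exact mul_nonneg h h1

theorem integral_cube_deform {f : ℂ → ℂ} (hf : DifferentiableOn ℂ f {X | X.im < 0}) {m : ℕ}
    {κ a τ : Fin m → ℝ} (hκ : ∀ i, 0 < κ i) (hτ : ∀ i, |τ i| ≤ 1) (haτ : ∀ i, 0 ≤ a i * τ i) {B : ℂ}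
    (hB : B.im < 0) :
    ∫ t in cube m, f (B - ∑ i, (a i : ℂ) * t i) * (wprod κ t : ℂ) =
      ∫ s in cube m, f (B - ∑ i, (a i : ℂ) * arc (τ i) (s i)) *
        (∏ i, arcFactor (τ i) (κ i) (s i)) * (wprod κ s : ℂ) := by
  induction m generalizing B with
  | zero => simp
  | succ m ih =>
    have hκ' : ∀ i : Fin m, 0 < κ i.succ := fun i => hκ _
    have him : ∀ s : Fin m → ℝ, s ∈ cube m →
        0 ≤ (∑ i, (a i.succ : ℂ) * arc (τ i.succ) (s i)).im := by
      intro s hs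
      rw [Complex.im_sum]
      exact Finset.sum_nonneg fun i _ => arc_mul_im_nonneg (haτ _) (hs i trivial)
    have hcarc : Continuous fun s : Fin m → ℝ => ∑ i, (a i.succ : ℂ) * arc (τ i.succ) (s i) :=
      continuous_finsetSum _ fun i _ =>
        continuous_const.mul ((continuous_arc _).comp (continuous_apply i))
    have hcfac : ContinuousOn (fun s : Fin m → ℝ => ∏ i, arcFactor (τ i.succ) (κ i.succ) (s i))
        (cube m) :=
      continuousOn_finsetProd _ fun i _ => (continuousOn_arcFactor _ _).comp
        (continuous_apply i).continuousOn fun s hs => hs i trivial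
    have c1 : ContinuousOn (fun p : ℝ × (Fin m → ℝ) =>
        f (B - (a 0 * p.1 + ∑ i, (a i.succ : ℂ) * p.2 i))) (Set.Icc (-1) 1 ×ˢ cube m) := by
      refine hf.continuousOn.comp (by fun_prop) fun p _ => ?_
      simp [← Complex.ofReal_mul, ← Complex.ofReal_sum, ← Complex.ofReal_add, hB]
    have c2 : ContinuousOn (fun p : ℝ × (Fin m → ℝ) =>
        f (B - (a 0 * p.1 + ∑ i, (a i.succ : ℂ) * arc (τ i.succ) (p.2 i))) *
          ∏ i, arcFactor (τ i.succ) (κ i.succ) (p.2 i)) (Set.Icc (-1) 1 ×ˢ cube m) := by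
      refine ContinuousOn.mul (hf.continuousOn.comp (Continuous.continuousOn ?_) fun p hp => ?_)
        (hcfac.comp continuous_snd.continuousOn fun p hp => hp.2)
      · have := hcarc.comp continuous_snd (X := ℝ × (Fin m → ℝ))
        simp only [Function.comp_def] at this
        fun_prop
      · have := him p.2 hp.2
        simp only [Set.mem_ofPred_eq, Complex.sub_im, Complex.add_im, Complex.mul_im,
          Complex.ofReal_im, Complex.ofReal_re, mul_zero, zero_mul, add_zero, zero_add]
        linarith
    have c3 : ContinuousOn (fun p : ℝ × (Fin m → ℝ) =>
        f (B - (a 0 * arc (τ 0) p.1 + ∑ i, (a i.succ : ℂ) * arc (τ i.succ) (p.2 i))) *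
          (arcFactor (τ 0) (κ 0) p.1 * ∏ i, arcFactor (τ i.succ) (κ i.succ) (p.2 i)))
        (Set.Icc (-1) 1 ×ˢ cube m) := by
      refine ContinuousOn.mul (hf.continuousOn.comp (Continuous.continuousOn ?_) fun p hp => ?_)
        (((continuousOn_arcFactor _ _).comp continuous_fst.continuousOn fun p hp => hp.1).mul
          (hcfac.comp continuous_snd.continuousOn fun p hp => hp.2))
      · have := hcarc.comp continuous_snd (X := ℝ × (Fin m → ℝ))
        have h2 := (continuous_arc (τ 0)).comp continuous_fst (X := ℝ × (Fin m → ℝ))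
        simp only [Function.comp_def] at this h2
        fun_prop
      · have h1 := him p.2 hp.2
        have h2 := arc_mul_im_nonneg (haτ 0) hp.1
        simp only [Set.mem_ofPred_eq, Complex.sub_im, Complex.add_im]
        linarith
    have j1 := integrable_prod_weight (hκ 0) hκ' c1
    have j2 := integrable_prod_weight (hκ 0) hκ' c2
    have j3 := integrable_prod_weight (hκ 0) hκ' c3
    rw [integral_cube_succ, integral_cube_succ]
    simp only [wprod_cons, Fin.sum_univ_succ, Fin.prod_univ_succ, Fin.cons_zero, Fin.cons_succ,
      Complex.ofReal_mul (_ * _) (wprod _ _)]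
    rw [integral_prod _ j1, integral_prod_symm _ j3]
    have step1 : ∀ t₀ : ℝ, (∫ t in cube m, f (B - (a 0 * t₀ + ∑ i, (a i.succ : ℂ) * t i)) *
        ((((1 + t₀) * (1 - t₀ ^ 2) ^ (κ 0 - 1) : ℝ) : ℂ) * (wprod (fun i => κ i.succ) t : ℂ))) =
        ∫ s in cube m, f (B - (a 0 * t₀ + ∑ i, (a i.succ : ℂ) * arc (τ i.succ) (s i))) *
          (∏ i, arcFactor (τ i.succ) (κ i.succ) (s i)) *
          ((((1 + t₀) * (1 - t₀ ^ 2) ^ (κ 0 - 1) : ℝ) : ℂ) * (wprod (fun i => κ i.succ) s : ℂ)) := by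
      intro t₀
      have := ih (κ := fun i => κ i.succ) (a := fun i => a i.succ) (τ := fun i => τ i.succ) hκ'
        (fun i => hτ _) (fun i => haτ _) (B := B - a 0 * t₀)
        (by simp [← Complex.ofReal_mul, hB])
      have := congrArg (fun w => (((1 + t₀) * (1 - t₀ ^ 2) ^ (κ 0 - 1) : ℝ) : ℂ) * w) this
      simp only [← integral_const_mul] at this
      refine (integral_congr_ae (ae_of_all _ fun t => ?_)).trans
        (this.trans (integral_congr_ae (ae_of_all _ fun t => ?_)))
      · simp only [sub_sub]; ring
      · simp only [sub_sub]; ring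
    simp only [step1]
    rw [integral_integral_swap j2]
    refine setIntegral_congr_fun (measurableSet_cube m) fun s hs => ?_
    have := integral_weight_deform hf (hκ 0) (hτ 0) (haτ 0)
      (B := B - ∑ i, (a i.succ : ℂ) * arc (τ i.succ) (s i))
      (by have := him s hs; rw [Complex.sub_im]; linarith)
    have := congrArg (fun w => ((∏ i, arcFactor (τ i.succ) (κ i.succ) (s i)) *
      (wprod (fun i => κ i.succ) s : ℂ)) * w) this
    simp only [← integral_const_mul] at this
    refine (integral_congr_ae (ae_of_all _ fun t => ?_)).trans
      (this.trans (integral_congr_ae (ae_of_all _ fun t => ?_)))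
    · simp only [sub_sub, add_comm]; ring
    · simp only [sub_sub, add_comm]; ring

/-! ### Size of the integrals over the cube -/

/-- `(z + z⁻¹) / 2`. -/
noncomputable def joukowski (z : ℂ) : ℂ := (z + z⁻¹) / 2

theorem joukowski_im_neg {z : ℂ} (hz : 0 < z.im) (hz1 : ‖z‖ < 1) : (joukowski z).im < 0 := by
  have h0 : z ≠ 0 := by rintro rfl; simp at hz
  have h1 : 0 < Complex.normSq z := Complex.normSq_pos.2 h0
  have h2 : Complex.normSq z < 1 := by
    rw [Complex.normSq_eq_norm_sq]; nlinarith [norm_nonneg z]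
  have h3 : (joukowski z).im = z.im * (1 - (Complex.normSq z)⁻¹) / 2 := by
    rw [joukowski]
    have : (2 : ℂ) = ((2 : ℝ) : ℂ) := by norm_num
    rw [this, Complex.div_ofReal_im, Complex.add_im, Complex.inv_im]
    ring
  rw [h3]
  have h4 : 1 < (Complex.normSq z)⁻¹ := (one_lt_inv₀ h1).2 h2
  nlinarith

theorem two_mul_mul_mem_slitPlane {z X : ℂ} (hz : 0 < z.im) (hX : X.im < 0) :
    2 * z * X ∈ Complex.slitPlane := by
  rw [Complex.mem_slitPlane_iff]
  by_contra! h
  have h1 : (2 * z * X).re ≤ 0 := h.1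
  have h2 : (2 * z * X).im = 0 := h.2
  simp only [Complex.mul_re, Complex.mul_im, Complex.re_ofNat, Complex.im_ofNat, zero_mul,
    sub_zero, add_zero] at h1 h2
  have h3 : z.re * X.im + z.im * X.re = 0 := by linarith
  have h4 : z.re * X.re - z.im * X.im ≤ 0 := by linarith
  have h5 : 0 < z.im * (-X.im) := mul_pos hz (by linarith)
  have h6 : z.im * (z.re * X.re) = - (z.re ^ 2 * X.im) := by
    linear_combination z.re * h3
  nlinarith [mul_nonneg hz.le (sub_nonneg.2 h4), mul_nonneg (sq_nonneg z.re) (by linarith : 0 ≤ -X.im),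
    mul_pos hz h5]

theorem norm_sub_sum_arc_ge {m : ℕ} {a τ s ε : Fin m → ℝ} {B : ℂ} (hB : B.im < 0)
    (haτ : ∀ i, a i * τ i = |a i|) (hτ : ∀ i, |τ i| ≤ 1) (hε : ∀ i, |s i - ε i| = 1 - |s i|)
    (hs : s ∈ cube m) :
    ‖B - ∑ i, (ε i : ℂ) * a i‖ + ∑ i, |a i| * (1 - |s i|) ≤
      5 * ‖B - ∑ i, (a i : ℂ) * arc (τ i) (s i)‖ := by
  have hs1 : ∀ i, |s i| ≤ 1 := fun i => abs_le.2 ⟨(hs i trivial).1, (hs i trivial).2⟩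
  have him : ∑ i, |a i| * (1 - |s i|) ≤ ‖B - ∑ i, (a i : ℂ) * arc (τ i) (s i)‖ := by
    refine le_trans ?_ (Complex.abs_im_le_norm _)
    refine le_trans ?_ (neg_le_abs _)
    rw [Complex.sub_im, Complex.im_sum]
    have : ∑ i, |a i| * (1 - |s i|) ≤ ∑ i, ((a i : ℂ) * arc (τ i) (s i)).im := by
      refine Finset.sum_le_sum fun i _ => ?_
      have e : ((a i : ℂ) * arc (τ i) (s i)).im = |a i| * (1 - s i ^ 2) := by
        rw [← haτ]; simp [arc_im]; ring
      rw [e, ← sq_abs (s i)]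
      refine mul_le_mul_of_nonneg_left ?_ (abs_nonneg _)
      nlinarith [hs1 i, abs_nonneg (s i)]
    linarith
  have hdiff : ‖B - ∑ i, (ε i : ℂ) * a i‖ ≤
      ‖B - ∑ i, (a i : ℂ) * arc (τ i) (s i)‖ + ∑ i, 3 * (|a i| * (1 - |s i|)) := by
    have : B - ∑ i, (ε i : ℂ) * a i = (B - ∑ i, (a i : ℂ) * arc (τ i) (s i)) +
        ∑ i, (a i : ℂ) * (arc (τ i) (s i) - ε i) := by
      simp only [mul_sub, Finset.sum_sub_distrib, mul_comm]; ring
    rw [this]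
    refine (norm_add_le _ _).trans (add_le_add le_rfl ((norm_sum_le _ _).trans
      (Finset.sum_le_sum fun i _ => ?_)))
    rw [norm_mul, Complex.norm_real, Real.norm_eq_abs]
    have e : arc (τ i) (s i) - ε i = ((s i - ε i : ℝ) : ℂ) +
        Complex.I * ((τ i * (1 - s i ^ 2) : ℝ) : ℂ) := by rw [arc]; push_cast; ring
    have h1 : ‖arc (τ i) (s i) - ε i‖ ≤ 3 * (1 - |s i|) := by
      rw [e]
      refine (norm_add_le _ _).trans ?_
      rw [norm_mul, Complex.norm_I, one_mul, Complex.norm_real, Complex.norm_real,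
        Real.norm_eq_abs, Real.norm_eq_abs, hε, abs_mul, ← sq_abs (s i),
        abs_of_nonneg (a := 1 - |s i| ^ 2) (by nlinarith [hs1 i, abs_nonneg (s i)])]
      have := mul_le_mul_of_nonneg_right (hτ i)
        (show 0 ≤ 1 - |s i| ^ 2 by nlinarith [hs1 i, abs_nonneg (s i)])
      nlinarith [hs1 i, abs_nonneg (s i)]
    nlinarith [mul_le_mul_of_nonneg_left h1 (abs_nonneg (a i))]
  rw [← Finset.mul_sum] at hdiff
  linarith

/-- The sign encoded by a Boolean. -/
noncomputable def boolSign (b : Bool) : ℝ := if b then 1 else -1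

/-- The distances `‖B - ∑ ± a i‖`. -/
noncomputable def signDist {m : ℕ} (a : Fin m → ℝ) (B : ℂ) (ε : Fin m → Bool) : ℝ :=
  ‖B - ∑ i, (boolSign (ε i) : ℂ) * a i‖

theorem signDist_pos {m : ℕ} (a : Fin m → ℝ) {B : ℂ} (hB : B.im < 0) (ε : Fin m → Bool) :
    0 < signDist a B ε := by
  rw [signDist, norm_pos_iff]
  intro h
  have := congrArg Complex.im h
  simp [← Complex.ofReal_mul, ← Complex.ofReal_sum] at this
  linarith

/-- The one-dimensional integral dominating each factor. -/
noncomputable def weightInt (Y a k : ℝ) : ℝ :=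
  ∫ s in Set.Icc (-1 : ℝ) 1, (Y + |a| * (1 - |s|)) ^ (-(k + 1 / 2)) *
    ((1 + s) * (1 - s ^ 2) ^ (k - 1))

theorem norm_rpow_le_sum {m : ℕ} {κ a τ s : Fin m → ℝ} (hκ : ∀ i, 0 < κ i) {B : ℂ}
    (hB : B.im < 0) (haτ : ∀ i, a i * τ i = |a i|) (hτ : ∀ i, |τ i| ≤ 1) (hs : s ∈ cube m)
    {j : ℝ} (hj : 0 ≤ j) :
    ‖B - ∑ i, (a i : ℂ) * arc (τ i) (s i)‖ ^ (-(∑ i, (κ i + 1 / 2) + j)) ≤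
      5 ^ (∑ i, (κ i + 1 / 2) + j) * ∑ ε : Fin m → Bool, signDist a B ε ^ (-j) *
        ∏ i, (signDist a B ε + |a i| * (1 - |s i|)) ^ (-(κ i + 1 / 2)) := by
  have hs1 : ∀ i, |s i| ≤ 1 := fun i => abs_le.2 ⟨(hs i trivial).1, (hs i trivial).2⟩
  set μ := ∑ i, (κ i + 1 / 2) + j with hμ
  have hμ0 : 0 ≤ μ := add_nonneg (Finset.sum_nonneg fun i _ => by linarith [hκ i]) hj
  let ε : Fin m → Bool := fun i => decide (0 ≤ s i)
  have hε : ∀ i, |s i - boolSign (ε i)| = 1 - |s i| := by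
    intro i
    by_cases h : 0 ≤ s i
    · have := (hs i trivial).2
      simp only [boolSign, ε, h, decide_true, if_true]
      rw [abs_of_nonneg h, abs_of_nonpos (by linarith)]; ring
    · have := (hs i trivial).1
      simp only [boolSign, ε, h, decide_false, Bool.false_eq_true, if_false]
      rw [abs_of_neg (not_le.1 h), abs_of_nonneg (by linarith)]; ring
  have key := norm_sub_sum_arc_ge hB haτ hτ hε hs
  have hY : 0 < signDist a B ε := signDist_pos a hB ε
  have hnn : ∀ i, 0 ≤ |a i| * (1 - |s i|) := fun i =>
    mul_nonneg (abs_nonneg _) (by linarith [hs1 i])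
  set S := ∑ i, |a i| * (1 - |s i|) with hS
  have hS0 : 0 ≤ S := Finset.sum_nonneg fun i _ => hnn i
  change signDist a B ε + S ≤ _ at key
  have h1 : ‖B - ∑ i, (a i : ℂ) * arc (τ i) (s i)‖ ^ (-μ) ≤
      5 ^ μ * (signDist a B ε + S) ^ (-μ) := by
    have : (signDist a B ε + S) / 5 ≤ ‖B - ∑ i, (a i : ℂ) * arc (τ i) (s i)‖ := by linarith
    refine (Real.rpow_le_rpow_of_nonpos (by positivity) this (by linarith)).trans_eq ?_
    rw [Real.div_rpow (by positivity) (by norm_num), Real.rpow_neg (by norm_num : (0:ℝ) ≤ 5),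
      div_inv_eq_mul, mul_comm]
  refine h1.trans (mul_le_mul_of_nonneg_left ?_ (by positivity))
  have h2 : (signDist a B ε + S) ^ (-μ) ≤ signDist a B ε ^ (-j) *
      ∏ i, (signDist a B ε + |a i| * (1 - |s i|)) ^ (-(κ i + 1 / 2)) := by
    have : -μ = -j + ∑ i, -(κ i + 1 / 2) := by rw [hμ, Finset.sum_neg_distrib]; ring
    rw [this, Real.rpow_add (by positivity), Real.rpow_sum_of_pos (by positivity)]
    refine mul_le_mul (Real.rpow_le_rpow_of_nonpos hY (by linarith) (by linarith))
      (Finset.prod_le_prod (fun i _ => by positivity) fun i hi => ?_)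
      (Finset.prod_nonneg fun i _ => by positivity) (by positivity)
    refine Real.rpow_le_rpow_of_nonpos (by have := hnn i; positivity) ?_ (by linarith [hκ i])
    have : |a i| * (1 - |s i|) ≤ S :=
      Finset.single_le_sum (f := fun i => |a i| * (1 - |s i|)) (fun i _ => hnn i) hi
    linarith
  refine h2.trans ?_
  refine Finset.single_le_sum (f := fun ε => signDist a B ε ^ (-j) *
    ∏ i, (signDist a B ε + |a i| * (1 - |s i|)) ^ (-(κ i + 1 / 2))) (fun ε _ => ?_)
    (Finset.mem_univ ε)
  have := signDist_pos a hB ε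
  refine mul_nonneg (by positivity) (Finset.prod_nonneg fun i _ => ?_)
  have := hnn i
  positivity

theorem integrable_weightInt {Y : ℝ} (hY : 0 < Y) (a : ℝ) {k : ℝ} (hk : 0 < k) :
    Integrable (fun s : ℝ => (Y + |a| * (1 - |s|)) ^ (-(k + 1 / 2)) *
      ((1 + s) * (1 - s ^ 2) ^ (k - 1))) (volume.restrict (Set.Icc (-1) 1)) := by
  refine (show IntegrableOn _ _ _ from integrableOn_weight hk).continuousOn_mul ?_ isCompact_Icc
  refine ContinuousOn.rpow_const (by fun_prop) fun s hs => Or.inl ?_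
  have : 0 ≤ |a| * (1 - |s|) := mul_nonneg (abs_nonneg _) (by linarith [abs_le.2 ⟨hs.1, hs.2⟩])
  positivity

theorem norm_cubeInt_le_sum_prod {m : ℕ} {κ : Fin m → ℝ} (hκ : ∀ i, 0 < κ i) {j : ℝ} (hj : 0 ≤ j) :
    ∃ C : ℝ, 0 < C ∧ ∀ (a : Fin m → ℝ) (z : ℂ), 0 < z.im → 1 / 3 ≤ ‖z‖ → ‖z‖ < 1 →
      ‖cubeInt κ a (∑ i, (κ i + 1 / 2) + j) z‖ ≤ C * ∑ ε : Fin m → Bool,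
        signDist a (joukowski z) ε ^ (-j) * ∏ i, weightInt (signDist a (joukowski z) ε) (a i) (κ i) := by
  set μ := ∑ i, (κ i + 1 / 2) + j with hμ
  have hμ0 : 0 ≤ μ := add_nonneg (Finset.sum_nonneg fun i _ => by linarith [hκ i]) hj
  refine ⟨(2 / 3) ^ (-μ) * (∏ i, 9 * 4 ^ |κ i - 1|) * 5 ^ μ, by
    have : 0 < ∏ i, 9 * (4 : ℝ) ^ |κ i - 1| := Finset.prod_pos fun i _ => by positivity
    positivity, fun a z hz hz3 hz1 => ?_⟩
  have h0 : z ≠ 0 := by rintro rfl; simp at hz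
  set B := joukowski z with hBdef
  have hB : B.im < 0 := joukowski_im_neg hz hz1
  let τ : Fin m → ℝ := fun i => SignType.sign (a i)
  have haτ : ∀ i, a i * τ i = |a i| := fun i => by
    rw [mul_comm]; exact sign_mul_self _
  have hτ : ∀ i, |τ i| ≤ 1 := fun i => by
    rcases lt_trichotomy (a i) 0 with h | h | h <;> simp [τ, h]
  have hf : DifferentiableOn ℂ (fun X : ℂ => (2 * z * X) ^ (-(μ : ℂ))) {X | X.im < 0} := by
    intro X hX
    have h1 : DifferentiableAt ℂ (fun X : ℂ => 2 * z * X) X := by fun_prop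
    exact (h1.cpow_const (two_mul_mul_mem_slitPlane hz hX)).differentiableWithinAt
  have e1 : cubeInt κ a μ z = ∫ t in cube m,
      (fun X : ℂ => (2 * z * X) ^ (-(μ : ℂ))) (B - ∑ i, (a i : ℂ) * t i) * (wprod κ t : ℂ) := by
    rw [cubeInt]
    refine integral_congr_ae (ae_of_all _ fun t => ?_)
    simp only
    congr 2
    rw [hBdef, joukowski]
    push_cast
    field_simp
    ring
  rw [e1, integral_cube_deform hf hκ hτ (fun i => by rw [haτ]; exact abs_nonneg _) hB]
  have hYi : ∀ ε, Integrable (fun s : Fin m → ℝ => signDist a B ε ^ (-j) *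
      ∏ i, ((signDist a B ε + |a i| * (1 - |s i|)) ^ (-(κ i + 1 / 2)) *
        ((1 + s i) * (1 - s i ^ 2) ^ (κ i - 1)))) (volume.restrict (cube m)) := by
    intro ε
    rw [volume_restrict_cube]
    exact (Integrable.fintype_prod (f := fun i s => (signDist a B ε + |a i| * (1 - |s|)) ^
      (-(κ i + 1 / 2)) * ((1 + s) * (1 - s ^ 2) ^ (κ i - 1)))
      fun i => integrable_weightInt (signDist_pos a hB ε) (a i) (hκ i)).const_mul _
  have e2 : ∀ ε, ∫ s in cube m, signDist a B ε ^ (-j) *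
      ∏ i, ((signDist a B ε + |a i| * (1 - |s i|)) ^ (-(κ i + 1 / 2)) *
        ((1 + s i) * (1 - s i ^ 2) ^ (κ i - 1))) =
      signDist a B ε ^ (-j) * ∏ i, weightInt (signDist a B ε) (a i) (κ i) := by
    intro ε
    rw [volume_restrict_cube, integral_const_mul]
    congr 1
    exact integral_fintype_prod_eq_prod (fun i s => (signDist a B ε + |a i| * (1 - |s|)) ^
      (-(κ i + 1 / 2)) * ((1 + s) * (1 - s ^ 2) ^ (κ i - 1)))
  simp only [← e2]
  rw [← integral_finsetSum _ fun ε _ => hYi ε, ← integral_const_mul]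
  refine norm_integral_le_of_norm_le ((integrable_finsetSum _ fun ε _ => hYi ε).const_mul _) ?_
  refine (ae_restrict_iff' (measurableSet_cube m)).2 (ae_of_all _ fun s hs => ?_)
  have h1 := norm_rpow_le_sum hκ hB haτ hτ hs hj
  rw [← hμ] at h1
  have hprod : ‖∏ i, arcFactor (τ i) (κ i) (s i)‖ ≤ ∏ i, 9 * 4 ^ |κ i - 1| := by
    rw [norm_prod]
    exact Finset.prod_le_prod (fun i _ => norm_nonneg _) fun i _ =>
      norm_arcFactor_le (hτ i) (hs i trivial) _
  have hw := wprod_nonneg κ hs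
  have e3 : ‖(2 * z * (B - ∑ i, (a i : ℂ) * arc (τ i) (s i))) ^ (-(μ : ℂ))‖ =
      (2 * ‖z‖) ^ (-μ) * ‖B - ∑ i, (a i : ℂ) * arc (τ i) (s i)‖ ^ (-μ) := by
    rw [← Complex.ofReal_neg, Complex.norm_cpow_real, norm_mul, norm_mul,
      Real.mul_rpow (by positivity) (by positivity)]
    simp
  have h2 : (2 * ‖z‖) ^ (-μ) ≤ (2 / 3) ^ (-μ) :=
    Real.rpow_le_rpow_of_nonpos (by norm_num) (by linarith) (by linarith)
  rw [norm_mul, norm_mul, Complex.norm_real, Real.norm_eq_abs, abs_of_nonneg hw, e3]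
  set Q := ∑ ε : Fin m → Bool, signDist a B ε ^ (-j) *
        ∏ i, (signDist a B ε + |a i| * (1 - |s i|)) ^ (-(κ i + 1 / 2)) with hQ
  have e4 : ∑ ε : Fin m → Bool, signDist a B ε ^ (-j) *
      ∏ i, ((signDist a B ε + |a i| * (1 - |s i|)) ^ (-(κ i + 1 / 2)) *
        ((1 + s i) * (1 - s i ^ 2) ^ (κ i - 1))) = Q * wprod κ s := by
    rw [hQ, Finset.sum_mul]
    refine Finset.sum_congr rfl fun ε _ => ?_
    rw [Finset.prod_mul_distrib, wprod, mul_assoc]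
  rw [e4]
  calc (2 * ‖z‖) ^ (-μ) * ‖B - ∑ i, (a i : ℂ) * arc (τ i) (s i)‖ ^ (-μ) *
        ‖∏ i, arcFactor (τ i) (κ i) (s i)‖ * wprod κ s
      ≤ (2 / 3) ^ (-μ) * (5 ^ μ * Q) * (∏ i, 9 * 4 ^ |κ i - 1|) * wprod κ s := by
        have : 0 ≤ 5 ^ μ * Q := le_trans (by positivity) h1
        gcongr
    _ = _ := by ring

/-! ### The one-dimensional integral -/

theorem weight_le {k s : ℝ} (hs : s ∈ Set.Icc (-1 : ℝ) 1) :
    (1 + s) * (1 - s ^ 2) ^ (k - 1) ≤ 2 * 2 ^ |k - 1| * (1 - |s|) ^ (k - 1) := by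
  have h1 : |s| ≤ 1 := abs_le.2 ⟨hs.1, hs.2⟩
  have e : 1 - s ^ 2 = (1 + |s|) * (1 - |s|) := by rw [← sq_abs s]; ring
  rw [e, Real.mul_rpow (by positivity) (by linarith), ← mul_assoc]
  have h2 : (1 + |s|) ^ (k - 1) ≤ 2 ^ |k - 1| :=
    (Real.rpow_le_rpow_of_exponent_le (by linarith [abs_nonneg s]) (le_abs_self _)).trans
      (Real.rpow_le_rpow (by positivity) (by linarith) (abs_nonneg _))
  have h3 : 0 ≤ 1 - |s| := by linarith
  have h4 : 1 + s ≤ 2 := by linarith [hs.2]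
  gcongr

theorem intervalIntegrable_add_mul_rpow {Y a k : ℝ} (hY : 0 < Y) (ha : 0 ≤ a) (hk : 0 < k)
    {b c : ℝ} (hb : 0 ≤ b) (hc : 0 ≤ c) (p : ℝ) :
    IntervalIntegrable (fun σ => (Y + a * σ) ^ p * σ ^ (k - 1)) volume b c := by
  refine (intervalIntegral.intervalIntegrable_rpow' (by linarith)).continuousOn_mul ?_
  refine ContinuousOn.rpow_const (by fun_prop) fun x hx => Or.inl ?_
  have : 0 ≤ x := le_trans (le_min hb hc) hx.1
  positivity

theorem integral_add_mul_rpow_le {Y a k : ℝ} (hY : 0 < Y) (ha : 0 ≤ a) (hk : 0 < k) :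
    ∫ σ in (0 : ℝ)..1, (Y + a * σ) ^ (-(k + 1 / 2)) * σ ^ (k - 1) ≤
      (1 / k + 2) * 2 ^ k * (Y ^ (-(1 / 2) : ℝ) * (Y + a) ^ (-k)) := by
  have hii := fun {b c : ℝ} (hb : 0 ≤ b) (hc : 0 ≤ c) =>
    intervalIntegrable_add_mul_rpow hY ha hk hb hc (-(k + 1 / 2))
  have small : ∀ c, 0 ≤ c → ∫ σ in (0 : ℝ)..c, (Y + a * σ) ^ (-(k + 1 / 2)) * σ ^ (k - 1) ≤
      Y ^ (-(k + 1 / 2)) * (c ^ k / k) := by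
    intro c hc
    have e : ∫ σ in (0 : ℝ)..c, σ ^ (k - 1) = c ^ k / k := by
      rw [integral_rpow (Or.inl (by linarith))]
      simp [hk.ne']
    rw [← e, ← intervalIntegral.integral_const_mul]
    refine intervalIntegral.integral_mono_on hc (hii le_rfl hc)
      ((intervalIntegral.intervalIntegrable_rpow' (by linarith)).const_mul _) fun σ hσ => ?_
    have h0 : 0 ≤ σ := hσ.1
    refine mul_le_mul_of_nonneg_right ?_ (by positivity)
    exact Real.rpow_le_rpow_of_nonpos hY (by nlinarith [mul_nonneg ha h0]) (by linarith)
  have hhalf : ∀ t, 0 < t → Y + a ≤ 2 * t → t ^ (-k) ≤ 2 ^ k * (Y + a) ^ (-k) := by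
    intro t ht h
    have : (Y + a) / 2 ≤ t := by linarith
    refine (Real.rpow_le_rpow_of_nonpos (by positivity) this (by linarith)).trans_eq ?_
    rw [Real.div_rpow (by positivity) (by norm_num), Real.rpow_neg (by norm_num : (0:ℝ) ≤ 2),
      div_inv_eq_mul, mul_comm]
  have hP : 0 < Y ^ (-(1 / 2) : ℝ) := by positivity
  rcases le_or_gt a Y with h | h
  · refine (small 1 zero_le_one).trans ?_
    have e : Y ^ (-(k + 1 / 2)) = Y ^ (-(1 / 2) : ℝ) * Y ^ (-k) := by
      rw [← Real.rpow_add hY]; congr 1; ring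
    rw [e, Real.one_rpow]
    have h1 := hhalf Y hY (by linarith)
    have : 0 < 2 ^ k * (Y + a) ^ (-k) := by positivity
    calc Y ^ (-(1 / 2) : ℝ) * Y ^ (-k) * (1 / k)
        ≤ Y ^ (-(1 / 2) : ℝ) * (2 ^ k * (Y + a) ^ (-k)) * (1 / k + 2) := by
          gcongr
          linarith
      _ = _ := by ring
  · have ha' : 0 < a := hY.trans h
    have hc0 : 0 < Y / a := by positivity
    have hc1 : Y / a < 1 := (div_lt_one ha').2 h
    rw [← intervalIntegral.integral_add_adjacent_intervals (hii le_rfl hc0.le)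
      (hii hc0.le zero_le_one)]
    have h1 := small (Y / a) hc0.le
    have e1 : Y ^ (-(k + 1 / 2)) * ((Y / a) ^ k / k) = 1 / k * (Y ^ (-(1 / 2) : ℝ) * a ^ (-k)) := by
      have : Y ^ (-(k + 1 / 2)) = Y ^ (-(1 / 2) : ℝ) * (Y ^ k)⁻¹ := by
        rw [← Real.rpow_neg hY.le, ← Real.rpow_add hY]; congr 1; ring
      rw [this, Real.div_rpow hY.le ha'.le, Real.rpow_neg ha'.le]
      have : 0 < Y ^ k := by positivity
      field_simp
    have h2 : ∫ σ in (Y / a)..1, (Y + a * σ) ^ (-(k + 1 / 2)) * σ ^ (k - 1) ≤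
        a ^ (-(k + 1 / 2)) * (2 * (Y / a) ^ (-(1 / 2) : ℝ)) := by
      have hn : (0 : ℝ) ∉ Set.uIcc (Y / a) 1 := by
        rw [Set.uIcc_of_le hc1.le]; intro h; linarith [h.1]
      have e : ∫ σ in (Y / a)..1, σ ^ (-(3 / 2) : ℝ) ≤ 2 * (Y / a) ^ (-(1 / 2) : ℝ) := by
        rw [integral_rpow (Or.inr ⟨by norm_num, hn⟩)]
        have : (-(3 / 2) + 1 : ℝ) = -(1 / 2) := by norm_num
        rw [this, Real.one_rpow]
        linarith
      refine le_trans ?_ (mul_le_mul_of_nonneg_left e (by positivity))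
      rw [← intervalIntegral.integral_const_mul]
      refine intervalIntegral.integral_mono_on hc1.le (hii hc0.le zero_le_one)
        ((intervalIntegral.intervalIntegrable_rpow (Or.inr hn)).const_mul _) fun σ hσ => ?_
      have h0 : 0 < σ := hc0.trans_le hσ.1
      have e2 : σ ^ (-(3 / 2) : ℝ) = σ ^ (-(k + 1 / 2)) * σ ^ (k - 1) := by
        rw [← Real.rpow_add h0]; congr 1; ring
      rw [e2, ← mul_assoc, ← Real.mul_rpow ha'.le h0.le]
      refine mul_le_mul_of_nonneg_right ?_ (by positivity)
      exact Real.rpow_le_rpow_of_nonpos (by positivity) (by linarith) (by linarith)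
    have e2 : a ^ (-(k + 1 / 2)) * (2 * (Y / a) ^ (-(1 / 2) : ℝ)) =
        2 * (Y ^ (-(1 / 2) : ℝ) * a ^ (-k)) := by
      have : a ^ (-(k + 1 / 2)) = a ^ (-k) * a ^ (-(1 / 2) : ℝ) := by
        rw [← Real.rpow_add ha']; congr 1; ring
      rw [this, Real.div_rpow hY.le ha'.le]
      have : 0 < a ^ (-(1 / 2) : ℝ) := by positivity
      field_simp
    have h3 := hhalf a ha' (by linarith)
    calc _ ≤ (1 / k + 2) * (Y ^ (-(1 / 2) : ℝ) * a ^ (-k)) := by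
            rw [e1] at h1; rw [e2] at h2; linarith
      _ ≤ (1 / k + 2) * (Y ^ (-(1 / 2) : ℝ) * (2 ^ k * (Y + a) ^ (-k))) := by gcongr
      _ = _ := by ring

theorem weightInt_le {Y : ℝ} (hY : 0 < Y) (a : ℝ) {k : ℝ} (hk : 0 < k) :
    weightInt Y a k ≤ 4 * 2 ^ |k - 1| * ((1 / k + 2) * 2 ^ k) *
      (Y ^ (-(1 / 2) : ℝ) * (Y + |a|) ^ (-k)) := by
  have h_int := integrable_weightInt hY a hk
  have hsub : ∀ b c, -1 ≤ b → b ≤ c → c ≤ 1 → IntervalIntegrable (fun s : ℝ =>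
      (Y + |a| * (1 - |s|)) ^ (-(k + 1 / 2)) * ((1 + s) * (1 - s ^ 2) ^ (k - 1))) volume b c := by
    intro b c hb hbc hc
    rw [intervalIntegrable_iff_integrableOn_Icc_of_le hbc]
    exact IntegrableOn.mono_set h_int (Set.Icc_subset_Icc hb hc)
  have hJ := intervalIntegrable_add_mul_rpow hY (abs_nonneg a) hk le_rfl zero_le_one
    (-(k + 1 / 2)) (b := 0) (c := 1)
  set J := ∫ σ in (0 : ℝ)..1, (Y + |a| * σ) ^ (-(k + 1 / 2)) * σ ^ (k - 1) with hJdef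
  have hpt : ∀ s ∈ Set.Icc (-1 : ℝ) 1,
      (Y + |a| * (1 - |s|)) ^ (-(k + 1 / 2)) * ((1 + s) * (1 - s ^ 2) ^ (k - 1)) ≤
      2 * 2 ^ |k - 1| * ((Y + |a| * (1 - |s|)) ^ (-(k + 1 / 2)) * (1 - |s|) ^ (k - 1)) := by
    intro s hs
    have h1 : 0 ≤ 1 - |s| := by linarith [abs_le.2 ⟨hs.1, hs.2⟩]
    have h2 : 0 ≤ (Y + |a| * (1 - |s|)) ^ (-(k + 1 / 2)) := by positivity
    have := mul_le_mul_of_nonneg_left (weight_le (k := k) hs) h2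
    linarith
  have hpos : ∫ s in (0 : ℝ)..1,
      (Y + |a| * (1 - |s|)) ^ (-(k + 1 / 2)) * ((1 + s) * (1 - s ^ 2) ^ (k - 1)) ≤
      2 * 2 ^ |k - 1| * J := by
    have e := intervalIntegral.integral_comp_sub_left (a := 0) (b := 1)
      (fun σ => (Y + |a| * σ) ^ (-(k + 1 / 2)) * σ ^ (k - 1)) 1
    have i := (hJ.comp_sub_left 1).symm
    simp only [sub_self, sub_zero] at e i
    rw [hJdef, ← e, ← intervalIntegral.integral_const_mul]
    refine intervalIntegral.integral_mono_on zero_le_one (hsub 0 1 (by norm_num) zero_le_one le_rfl)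
      (i.const_mul _) fun s hs => ?_
    have := hpt s ⟨by linarith [hs.1], hs.2⟩
    rwa [abs_of_nonneg hs.1] at this ⊢
  have hneg : ∫ s in (-1 : ℝ)..0,
      (Y + |a| * (1 - |s|)) ^ (-(k + 1 / 2)) * ((1 + s) * (1 - s ^ 2) ^ (k - 1)) ≤
      2 * 2 ^ |k - 1| * J := by
    have e := intervalIntegral.integral_comp_add_left (a := -1) (b := 0)
      (fun σ => (Y + |a| * σ) ^ (-(k + 1 / 2)) * σ ^ (k - 1)) 1
    have i := hJ.comp_add_left 1
    norm_num at e i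
    rw [hJdef]
    norm_num
    rw [← e, ← intervalIntegral.integral_const_mul]
    refine intervalIntegral.integral_mono_on (by norm_num)
      (by simpa using hsub (-1) 0 le_rfl (by norm_num) zero_le_one)
      (i.const_mul _) fun s hs => ?_
    have := hpt s ⟨hs.1, by linarith [hs.2]⟩
    rw [abs_of_nonpos hs.2] at this ⊢
    norm_num at this ⊢
    exact this
  have hJle := integral_add_mul_rpow_le hY (abs_nonneg a) hk
  rw [← hJdef] at hJle
  rw [weightInt, integral_Icc_eq_integral_Ioc, ← intervalIntegral.integral_of_le (by norm_num),
    ← intervalIntegral.integral_add_adjacent_intervals (b := 0)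
      (hsub (-1) 0 le_rfl (by norm_num) zero_le_one) (hsub 0 1 (by norm_num) zero_le_one le_rfl)]
  calc _ ≤ 4 * 2 ^ |k - 1| * J := by linarith
    _ ≤ _ := by
      have := mul_le_mul_of_nonneg_left hJle (show 0 ≤ 4 * (2 : ℝ) ^ |k - 1| by positivity)
      linarith

theorem weightInt_nonneg {Y : ℝ} (hY : 0 < Y) (a k : ℝ) : 0 ≤ weightInt Y a k := by
  refine setIntegral_nonneg measurableSet_Icc fun s hs => ?_
  have h1 : 0 ≤ 1 - |s| := by linarith [abs_le.2 ⟨hs.1, hs.2⟩]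
  have h2 : 0 ≤ 1 - s ^ 2 := by nlinarith [hs.1, hs.2]
  have h3 : 0 ≤ 1 + s := by linarith [hs.1]
  positivity

theorem norm_cubeInt_le {m : ℕ} {κ : Fin m → ℝ} (hκ : ∀ i, 0 < κ i) {j : ℝ} (hj : 0 ≤ j) :
    ∃ C : ℝ, 0 < C ∧ ∀ (a : Fin m → ℝ) (z : ℂ), 0 < z.im → 1 / 3 ≤ ‖z‖ → ‖z‖ < 1 →
      ‖cubeInt κ a (∑ i, (κ i + 1 / 2) + j) z‖ ≤ C * ∑ ε : Fin m → Bool,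
        signDist a (joukowski z) ε ^ (-(m / 2 + j)) *
          ∏ i, (signDist a (joukowski z) ε + |a i|) ^ (-κ i) := by
  obtain ⟨C, hC, h⟩ := norm_cubeInt_le_sum_prod hκ hj
  have hc : ∀ i, 0 < 4 * 2 ^ |κ i - 1| * ((1 / κ i + 2) * 2 ^ κ i) := fun i => by
    have := hκ i; positivity
  refine ⟨C * ∏ i, 4 * 2 ^ |κ i - 1| * ((1 / κ i + 2) * 2 ^ κ i),
    mul_pos hC (Finset.prod_pos fun i _ => hc i), fun a z hz hz3 hz1 => (h a z hz hz3 hz1).trans ?_⟩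
  rw [mul_assoc]
  refine mul_le_mul_of_nonneg_left ?_ hC.le
  rw [Finset.mul_sum]
  refine Finset.sum_le_sum fun ε _ => ?_
  have hY := signDist_pos a (joukowski_im_neg hz hz1) ε
  set Y := signDist a (joukowski z) ε
  have h1 : ∏ i, weightInt Y (a i) (κ i) ≤ ∏ i, (4 * 2 ^ |κ i - 1| * ((1 / κ i + 2) * 2 ^ κ i) *
      (Y ^ (-(1 / 2) : ℝ) * (Y + |a i|) ^ (-κ i))) :=
    Finset.prod_le_prod (fun i _ => weightInt_nonneg hY _ _) fun i _ => weightInt_le hY _ (hκ i)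
  refine (mul_le_mul_of_nonneg_left h1 (by positivity)).trans_eq ?_
  rw [Finset.prod_mul_distrib, Finset.prod_mul_distrib (f := fun _ => Y ^ (-(1 / 2) : ℝ)),
    Finset.prod_const, Finset.card_univ, Fintype.card_fin, ← Real.rpow_natCast, ← Real.rpow_mul hY.le]
  have : -((m : ℝ) / 2 + j) = -j + -(1 / 2) * m := by ring
  rw [this, Real.rpow_add hY]
  ring

/-! ### Elementary inequalities -/

theorem rpow_neg_le_two_mul {w R e β : ℝ} (hR : 0 ≤ R) (hw : 1 + R ≤ 2 * w) (he : 0 ≤ e)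
    (hβ : β ≤ e) : w ^ (-e) ≤ 2 ^ e * (1 + R) ^ (-β) := by
  have h1 : (1 + R) / 2 ≤ w := by linarith
  refine (Real.rpow_le_rpow_of_nonpos (by positivity) h1 (by linarith)).trans ?_
  rw [Real.div_rpow (by positivity) (by norm_num), Real.rpow_neg (by norm_num : (0:ℝ) ≤ 2),
    div_inv_eq_mul, mul_comm]
  exact mul_le_mul_of_nonneg_left
    (Real.rpow_le_rpow_of_exponent_le (by linarith) (by linarith)) (by positivity)

theorem pointwise_bound_near {p q M β s b D R : ℝ} (hp : 0 < p) (hq : 1 ≤ q) (hM : 0 ≤ M)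
    (hβ : β ≤ 2 * q) (hβ' : β ≤ p - 1 + q - M) (hs : 0 ≤ s) (hb : 0 ≤ b) (hR : 0 ≤ R)
    (hRb : R ≤ 2 * b) (hsb : s ≤ b / 2) (hD : b / 2 ≤ D) :
    (1 + s) ^ (-p) * (1 + (1 + s) ^ 2 / ((1 + s + b) * (1 + D))) *
      (1 + R ^ 2 / ((1 + s + b) * (1 + D))) ^ M * ((1 + s + b) * (1 + D)) ^ (-q) ≤
      3 * 9 ^ M * 2 ^ q * 2 ^ (2 * q + p) * ((1 + R) ^ (-β) * (1 + s) ^ (-2 : ℝ)) := by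
  set x := (1 + s + b) * (1 + D) with hx
  have hx1 : (1 + b) ^ 2 / 2 ≤ x := by
    have : (1 + b) * (1 + b / 2) ≤ x := by rw [hx]; gcongr; linarith
    nlinarith
  have hx0 : 0 < x := lt_of_lt_of_le (by positivity) hx1
  have h1 : 1 + (1 + s) ^ 2 / x ≤ 3 := by
    have : (1 + s) ^ 2 / x ≤ 2 := by rw [div_le_iff₀ hx0]; nlinarith
    linarith
  have h2 : 1 + R ^ 2 / x ≤ 9 := by
    have : R ^ 2 / x ≤ 8 := by rw [div_le_iff₀ hx0]; nlinarith
    linarith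
  have h3 : x ^ (-q) ≤ 2 ^ q * (1 + b) ^ (-(2 * q)) := by
    refine (Real.rpow_le_rpow_of_nonpos (by positivity) hx1 (by linarith)).trans_eq ?_
    rw [Real.div_rpow (by positivity) (by norm_num), Real.rpow_neg (by norm_num : (0:ℝ) ≤ 2),
      div_inv_eq_mul, mul_comm, ← Real.rpow_natCast, ← Real.rpow_mul (by positivity)]
    congr 2; push_cast; ring
  have h4 : (1 + s) ^ (-p) * (1 + b) ^ (-(2 * q)) ≤
      2 ^ (2 * q + p) * ((1 + R) ^ (-β) * (1 + s) ^ (-2 : ℝ)) := by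
    have e : (1 + s) ^ (-p) = (1 + s) ^ (2 - p) * (1 + s) ^ (-2 : ℝ) := by
      rw [← Real.rpow_add (by positivity)]; congr 1; ring
    have h5 : (1 + s) ^ (2 - p) * (1 + b) ^ (-(2 * q)) ≤ 2 ^ (2 * q + p) * (1 + R) ^ (-β) := by
      rcases le_total p 2 with h | h
      · have h6 : (1 + s) ^ (2 - p) ≤ (1 + b) ^ (2 - p) :=
          Real.rpow_le_rpow (by positivity) (by linarith) (by linarith)
        have h7 := rpow_neg_le_two_mul (w := 1 + b) (e := 2 * q + p - 2) hR (by linarith)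
          (by linarith) (β := β) (by linarith)
        calc (1 + s) ^ (2 - p) * (1 + b) ^ (-(2 * q))
            ≤ (1 + b) ^ (2 - p) * (1 + b) ^ (-(2 * q)) := by gcongr
          _ = (1 + b) ^ (-(2 * q + p - 2)) := by
              rw [← Real.rpow_add (by positivity)]; congr 1; ring
          _ ≤ _ := h7
          _ ≤ _ := mul_le_mul_of_nonneg_right
              (Real.rpow_le_rpow_of_exponent_le (by norm_num) (by linarith)) (by positivity)
      · have h6 : (1 + s) ^ (2 - p) ≤ 1 :=
          Real.rpow_le_one_of_one_le_of_nonpos (by linarith) (by linarith)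
        have h7 := rpow_neg_le_two_mul (w := 1 + b) (e := 2 * q) hR (by linarith)
          (by linarith) (β := β) hβ
        calc (1 + s) ^ (2 - p) * (1 + b) ^ (-(2 * q))
            ≤ 1 * (1 + b) ^ (-(2 * q)) := by gcongr
          _ ≤ 2 ^ (2 * q) * (1 + R) ^ (-β) := by rw [one_mul]; exact h7
          _ ≤ _ := mul_le_mul_of_nonneg_right
              (Real.rpow_le_rpow_of_exponent_le (by norm_num) (by linarith)) (by positivity)
    rw [e]
    have := mul_le_mul_of_nonneg_right h5 (show 0 ≤ (1 + s) ^ (-2 : ℝ) by positivity)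
    linarith
  calc (1 + s) ^ (-p) * (1 + (1 + s) ^ 2 / x) * (1 + R ^ 2 / x) ^ M * x ^ (-q)
      ≤ (1 + s) ^ (-p) * 3 * 9 ^ M * (2 ^ q * (1 + b) ^ (-(2 * q))) := by gcongr
    _ = 3 * 9 ^ M * 2 ^ q * ((1 + s) ^ (-p) * (1 + b) ^ (-(2 * q))) := by ring
    _ ≤ 3 * 9 ^ M * 2 ^ q * (2 ^ (2 * q + p) * ((1 + R) ^ (-β) * (1 + s) ^ (-2 : ℝ))) := by gcongr
    _ = _ := by ring

theorem pointwise_bound_far {p q M β s b D R : ℝ} (hp : 0 < p) (hq : 1 ≤ q) (hM : 0 ≤ M)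
    (hβ' : β ≤ p - 1 + q - M) (hs : 0 ≤ s) (hb : 0 ≤ b) (hR : 0 ≤ R)
    (hRb : R ≤ 2 * b) (hsb : b / 2 ≤ s) (hD : 0 ≤ D) :
    (1 + s) ^ (-p) * (1 + (1 + s) ^ 2 / ((1 + s + b) * (1 + D))) *
      (1 + R ^ 2 / ((1 + s + b) * (1 + D))) ^ M * ((1 + s + b) * (1 + D)) ^ (-q) ≤
      3 ^ p * 2 * 5 ^ M * 2 ^ (2 * q + p) *
        ((1 + R) ^ (-β) * ((1 + s) ^ (-2 : ℝ) + (1 + D) ^ (-(3 / 2) : ℝ))) := by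
  set w := 1 + s + b with hw
  set v := 1 + D with hv
  have hw1 : 1 ≤ w := by linarith
  have hv1 : 1 ≤ v := by linarith
  have hw0 : 0 < w := by linarith
  have hv0 : 0 < v := by linarith
  have hws : 1 + s ≤ w := by linarith
  have hRw : 1 + R ≤ 2 * w := by linarith
  have h1 : (1 + s) ^ (-p) ≤ 3 ^ p * w ^ (-p) := by
    have : w / 3 ≤ 1 + s := by linarith
    refine (Real.rpow_le_rpow_of_nonpos (by positivity) this (by linarith)).trans_eq ?_
    rw [Real.div_rpow (by positivity) (by norm_num), Real.rpow_neg (by norm_num : (0:ℝ) ≤ 3),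
      div_inv_eq_mul, mul_comm]
  have h2 : (1 + s) ^ 2 / (w * v) ≤ w / v := by
    rw [div_le_div_iff₀ (by positivity) hv0]
    have : (1 + s) ^ 2 ≤ w ^ 2 := by gcongr
    nlinarith
  have hs2 : 0 ≤ (1 + s) ^ (-2 : ℝ) := by positivity
  have hv2 : 0 ≤ v ^ (-(3 / 2) : ℝ) := by positivity
  have hRβ : 0 ≤ (1 + R) ^ (-β) := by positivity
  rw [Real.mul_rpow hw0.le hv0.le]
  rcases le_total v w with h | h
  · have h3 : 1 + (1 + s) ^ 2 / (w * v) ≤ 2 * (w / v) := by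
      have : 1 ≤ w / v := (one_le_div hv0).2 h
      linarith
    have h4 : 1 + R ^ 2 / (w * v) ≤ 5 * (1 + R) := by
      have : R ^ 2 / (w * v) ≤ 2 * R := by
        rw [div_le_iff₀ (by positivity)]
        have : w * 1 ≤ w * v := by gcongr
        nlinarith
      linarith
    have h5 : w ^ (-(p + q - 1)) ≤ 2 ^ (p + q - 1) * (1 + R) ^ (-(β + M)) :=
      rpow_neg_le_two_mul hR hRw (by linarith) (by linarith)
    have e1 : w ^ (-p) * (w / v) * (w ^ (-q) * v ^ (-q)) = w ^ (-(p + q - 1)) * v ^ (-(q + 1)) := by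
      have a1 : w ^ (-(p + q - 1)) = w ^ (-p) * w * w ^ (-q) := by
        nth_rewrite 3 [← Real.rpow_one w]
        rw [← Real.rpow_add hw0, ← Real.rpow_add hw0]; congr 1; ring
      have a2 : v ^ (-(q + 1)) = v ^ (-q) / v := by
        rw [neg_add, Real.rpow_add hv0, Real.rpow_neg_one]; rfl
      rw [a1, a2]; ring
    have h6 : v ^ (-(q + 1)) ≤ v ^ (-(3 / 2) : ℝ) :=
      Real.rpow_le_rpow_of_exponent_le hv1 (by linarith)
    have e2 : (1 + R) ^ (-(β + M)) * (1 + R) ^ M = (1 + R) ^ (-β) := by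
      rw [← Real.rpow_add (by positivity)]; congr 1; ring
    have h7 : (2 : ℝ) ^ (p + q - 1) ≤ 2 ^ (2 * q + p) :=
      Real.rpow_le_rpow_of_exponent_le (by norm_num) (by linarith)
    calc (1 + s) ^ (-p) * (1 + (1 + s) ^ 2 / (w * v)) * (1 + R ^ 2 / (w * v)) ^ M *
          (w ^ (-q) * v ^ (-q))
        ≤ (3 ^ p * w ^ (-p)) * (2 * (w / v)) * (5 * (1 + R)) ^ M * (w ^ (-q) * v ^ (-q)) := by
          gcongr
      _ = 3 ^ p * 2 * 5 ^ M * ((w ^ (-(p + q - 1)) * v ^ (-(q + 1))) * (1 + R) ^ M) := by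
          rw [← e1, Real.mul_rpow (by norm_num) (by positivity)]; ring
      _ ≤ 3 ^ p * 2 * 5 ^ M * (((2 ^ (p + q - 1) * (1 + R) ^ (-(β + M))) * v ^ (-(3 / 2) : ℝ)) *
            (1 + R) ^ M) := by gcongr
      _ = 3 ^ p * 2 * 5 ^ M * 2 ^ (p + q - 1) * ((1 + R) ^ (-β) * v ^ (-(3 / 2) : ℝ)) := by
          rw [← e2]; ring
      _ ≤ _ := by
          gcongr
          linarith
  · have h3 : 1 + (1 + s) ^ 2 / (w * v) ≤ 2 := by
      have : w / v ≤ 1 := (div_le_one hv0).2 h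
      linarith
    have h4 : 1 + R ^ 2 / (w * v) ≤ 5 := by
      have : R ^ 2 / (w * v) ≤ 4 := by
        rw [div_le_iff₀ (by positivity)]
        have : w * w ≤ w * v := by gcongr
        nlinarith
      linarith
    have h5 : v ^ (-q) ≤ w ^ (-q) := Real.rpow_le_rpow_of_nonpos hw0 h (by linarith)
    have h6 : w ^ (-(p + 2 * q - 2)) ≤ 2 ^ (p + 2 * q - 2) * (1 + R) ^ (-β) :=
      rpow_neg_le_two_mul hR hRw (by linarith) (by linarith)
    have e1 : w ^ (-p) * (w ^ (-q) * w ^ (-q)) = w ^ (-(p + 2 * q - 2)) * w ^ (-2 : ℝ) := by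
      rw [← Real.rpow_add hw0, ← Real.rpow_add hw0, ← Real.rpow_add hw0]; congr 1; ring
    have h7 : w ^ (-2 : ℝ) ≤ (1 + s) ^ (-2 : ℝ) :=
      Real.rpow_le_rpow_of_nonpos (by positivity) hws (by norm_num)
    have h8 : (2 : ℝ) ^ (p + 2 * q - 2) ≤ 2 ^ (2 * q + p) :=
      Real.rpow_le_rpow_of_exponent_le (by norm_num) (by linarith)
    calc (1 + s) ^ (-p) * (1 + (1 + s) ^ 2 / (w * v)) * (1 + R ^ 2 / (w * v)) ^ M *
          (w ^ (-q) * v ^ (-q))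
        ≤ (3 ^ p * w ^ (-p)) * 2 * 5 ^ M * (w ^ (-q) * w ^ (-q)) := by gcongr
      _ = 3 ^ p * 2 * 5 ^ M * (w ^ (-(p + 2 * q - 2)) * w ^ (-2 : ℝ)) := by rw [← e1]; ring
      _ ≤ 3 ^ p * 2 * 5 ^ M * ((2 ^ (p + 2 * q - 2) * (1 + R) ^ (-β)) * (1 + s) ^ (-2 : ℝ)) := by
          gcongr
      _ = 3 ^ p * 2 * 5 ^ M * 2 ^ (p + 2 * q - 2) * ((1 + R) ^ (-β) * (1 + s) ^ (-2 : ℝ)) := by ring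
      _ ≤ _ := by
          gcongr
          linarith

theorem exists_pointwise_bound {p q M β : ℝ} (hp : 0 < p) (hq : 1 ≤ q) (hM : 0 ≤ M)
    (hβ : β ≤ 2 * q) (hβ' : β ≤ p - 1 + q - M) :
    ∃ C : ℝ, 0 < C ∧ ∀ s b D R : ℝ, 0 ≤ s → 0 ≤ b → 0 ≤ R → R ≤ 2 * b → |s - b| ≤ D →
      (1 + s) ^ (-p) * (1 + (1 + s) ^ 2 / ((1 + s + b) * (1 + D))) *
        (1 + R ^ 2 / ((1 + s + b) * (1 + D))) ^ M * ((1 + s + b) * (1 + D)) ^ (-q) ≤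
        C * ((1 + R) ^ (-β) * ((1 + s) ^ (-2 : ℝ) + (1 + D) ^ (-(3 / 2) : ℝ))) := by
  refine ⟨3 * 9 ^ M * 2 ^ q * 2 ^ (2 * q + p) + 3 ^ p * 2 * 5 ^ M * 2 ^ (2 * q + p), by positivity,
    fun s b D R hs hb hR hRb hD => ?_⟩
  have hD0 : 0 ≤ D := (abs_nonneg _).trans hD
  rcases le_total s (b / 2) with h | h
  · refine (pointwise_bound_near hp hq hM hβ hβ' hs hb hR hRb h ?_).trans ?_
    · linarith [neg_le_of_abs_le hD]
    · have h1 : (1 + R) ^ (-β) * (1 + s) ^ (-2 : ℝ) ≤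
          (1 + R) ^ (-β) * ((1 + s) ^ (-2 : ℝ) + (1 + D) ^ (-(3 / 2) : ℝ)) := by
        gcongr
        have : 0 ≤ (1 + D) ^ (-(3 / 2) : ℝ) := by positivity
        linarith
      refine mul_le_mul ?_ h1 (by positivity) (by positivity)
      have : 0 ≤ (3 : ℝ) ^ p * 2 * 5 ^ M * 2 ^ (2 * q + p) := by positivity
      linarith
  · refine (pointwise_bound_far hp hq hM hβ' hs hb hR hRb h hD0).trans ?_
    refine mul_le_mul_of_nonneg_right ?_ (by positivity)
    have : 0 ≤ (3 : ℝ) * 9 ^ M * 2 ^ q * 2 ^ (2 * q + p) := by positivity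
    linarith

/-! ### Geometry on the sphere -/

theorem sum_sq_eq_one {m : ℕ} {x : EuclideanSpace ℝ (Fin m)}
    (hx : x ∈ Metric.sphere (0 : EuclideanSpace ℝ (Fin m)) 1) : ∑ i, x i ^ 2 = 1 := by
  have h1 : ‖x‖ = 1 := by simpa using hx
  rw [← EuclideanSpace.real_norm_sq_eq, h1, one_pow]

theorem norm_ebar_sub_sq {m : ℕ} (x y : EuclideanSpace ℝ (Fin m)) :
    ‖ebar x - ebar y‖ ^ 2 = ∑ i, (|x i| - |y i|) ^ 2 := by
  rw [EuclideanSpace.real_norm_sq_eq]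
  rfl

theorem norm_ebar_sub_sq_eq {m : ℕ} {x y : EuclideanSpace ℝ (Fin m)}
    (hx : x ∈ Metric.sphere (0 : EuclideanSpace ℝ (Fin m)) 1)
    (hy : y ∈ Metric.sphere (0 : EuclideanSpace ℝ (Fin m)) 1) :
    ‖ebar x - ebar y‖ ^ 2 = 2 * (1 - ∑ i, |x i * y i|) := by
  have : ∀ i, (|x i| - |y i|) ^ 2 = x i ^ 2 + y i ^ 2 - 2 * |x i * y i| := fun i => by
    rw [abs_mul, ← sq_abs (x i), ← sq_abs (y i)]; ring
  rw [norm_ebar_sub_sq]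
  simp only [this, Finset.sum_sub_distrib, Finset.sum_add_distrib, sum_sq_eq_one hx,
    sum_sq_eq_one hy, ← Finset.mul_sum]
  ring

theorem sum_abs_mul_le_one {m : ℕ} {x y : EuclideanSpace ℝ (Fin m)}
    (hx : x ∈ Metric.sphere (0 : EuclideanSpace ℝ (Fin m)) 1)
    (hy : y ∈ Metric.sphere (0 : EuclideanSpace ℝ (Fin m)) 1) : ∑ i, |x i * y i| ≤ 1 := by
  have := norm_ebar_sub_sq_eq hx hy
  nlinarith [sq_nonneg ‖ebar x - ebar y‖]

theorem sq_le_two_mul_add {m : ℕ} (x y : EuclideanSpace ℝ (Fin m)) (i : Fin m) :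
    |y i| ^ 2 ≤ 2 * |x i * y i| + ‖ebar x - ebar y‖ ^ 2 := by
  have h : (|x i| - |y i|) ^ 2 ≤ ‖ebar x - ebar y‖ ^ 2 := by
    rw [norm_ebar_sub_sq]
    exact Finset.single_le_sum (f := fun i => (|x i| - |y i|) ^ 2) (fun i _ => sq_nonneg _)
      (Finset.mem_univ i)
  rw [abs_mul]
  nlinarith [sq_nonneg (|x i|)]

theorem exists_one_le_mul_sq {m : ℕ} {x : EuclideanSpace ℝ (Fin (m + 1))}
    (hx : x ∈ Metric.sphere (0 : EuclideanSpace ℝ (Fin (m + 1))) 1) :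
    ∃ i, 1 ≤ ((m : ℝ) + 1) * x i ^ 2 := by
  by_contra! h
  have h1 := Finset.sum_lt_sum_of_nonempty (Finset.univ_nonempty (α := Fin (m + 1)))
    fun i _ => h i
  rw [← Finset.mul_sum, sum_sq_eq_one hx] at h1
  simp at h1

theorem hsq_mul_prod_le {d : ℕ} {κ : Fin (d + 1) → ℝ} (hκ : ∀ i, 0 < κ i)
    {x y : EuclideanSpace ℝ (Fin (d + 1))}
    (hx : x ∈ Metric.sphere (0 : EuclideanSpace ℝ (Fin (d + 1))) 1)
    (hy : y ∈ Metric.sphere (0 : EuclideanSpace ℝ (Fin (d + 1))) 1) {Y : ℝ} (hY : 0 < Y) :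
    hsq κ y * ∏ i, (Y + |x i * y i|) ^ (-κ i) ≤
      (2 * ((d : ℝ) + 1)) ^ (∑ i, κ i) * (1 + ‖ebar x - ebar y‖ ^ 2 / Y) ^
        (∑ i, κ i - Finset.univ.inf' Finset.univ_nonempty κ) := by
  obtain ⟨j, hj⟩ := exists_one_le_mul_sq hx
  set r := ‖ebar x - ebar y‖
  have hr : 0 ≤ r ^ 2 / Y := by positivity
  have hpos : ∀ i, 0 < Y + |x i * y i| := fun i => by positivity
  have hd0 : (0 : ℝ) ≤ d := Nat.cast_nonneg d
  have hyj : |y j| ≤ 1 := by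
    have : y j ^ 2 ≤ 1 := by
      rw [← sum_sq_eq_one hy]
      exact Finset.single_le_sum (f := fun i => y i ^ 2) (fun i _ => sq_nonneg _)
        (Finset.mem_univ j)
    exact abs_le_one_iff_mul_self_le_one.2 (by nlinarith)
  have hxj : 1 ≤ ((d : ℝ) + 1) * |x j| := by
    rw [← sq_abs] at hj
    by_contra! h
    nlinarith [abs_nonneg (x j), mul_nonneg hd0 (abs_nonneg (x j))]
  have hfac : ∀ i, |y i| ^ (2 * κ i) * (Y + |x i * y i|) ^ (-κ i) =
      (|y i| ^ 2 / (Y + |x i * y i|)) ^ κ i := by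
    intro i
    rw [Real.div_rpow (by positivity) (hpos i).le, Real.rpow_neg (hpos i).le, Real.rpow_mul
      (abs_nonneg _), Real.rpow_two]
    rfl
  have h1 : ∀ i, |y i| ^ 2 / (Y + |x i * y i|) ≤ 2 * ((d : ℝ) + 1) * (1 + r ^ 2 / Y) := by
    intro i
    rw [div_le_iff₀ (hpos i)]
    have h2 := sq_le_two_mul_add x y i
    have e : r ^ 2 = r ^ 2 / Y * Y := by field_simp
    have h3 : r ^ 2 ≤ r ^ 2 / Y * (Y + |x i * y i|) := by
      nlinarith [mul_nonneg hr (abs_nonneg (x i * y i))]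
    have h4 : 0 ≤ (1 + r ^ 2 / Y) * (Y + |x i * y i|) := by have := hpos i; positivity
    nlinarith [abs_nonneg (x i * y i), mul_nonneg hd0 h4]
  have h2 : |y j| ^ 2 / (Y + |x j * y j|) ≤ 2 * ((d : ℝ) + 1) := by
    rw [div_le_iff₀ (hpos j), abs_mul]
    have : |y j| ^ 2 ≤ ((d : ℝ) + 1) * (|x j| * |y j|) := by
      nlinarith [abs_nonneg (y j), mul_le_mul_of_nonneg_right hxj (abs_nonneg (y j))]
    have h5 : 0 ≤ |x j| * |y j| := by positivity
    nlinarith [mul_nonneg hd0 h5, mul_nonneg hd0 hY.le]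
  rw [hsq, ← Finset.prod_mul_distrib]
  simp only [hfac]
  have hone : 1 ≤ 1 + r ^ 2 / Y := by linarith
  have hb : 0 ≤ |y j| ^ 2 / (Y + |x j * y j|) := by have := hpos j; positivity
  calc ∏ i, (|y i| ^ 2 / (Y + |x i * y i|)) ^ κ i
      = (|y j| ^ 2 / (Y + |x j * y j|)) ^ κ j *
          ∏ i ∈ Finset.univ.erase j, (|y i| ^ 2 / (Y + |x i * y i|)) ^ κ i :=
        (Finset.mul_prod_erase _ _ (Finset.mem_univ j)).symm
    _ ≤ (2 * ((d : ℝ) + 1)) ^ κ j *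
          ∏ i ∈ Finset.univ.erase j, (2 * ((d : ℝ) + 1) * (1 + r ^ 2 / Y)) ^ κ i := by
        refine mul_le_mul (Real.rpow_le_rpow hb h2 (hκ j).le)
          (Finset.prod_le_prod (fun i _ => ?_) fun i _ => ?_)
          (Finset.prod_nonneg fun i _ => ?_) (by positivity)
        · have := hpos i; positivity
        · have := hpos i
          exact Real.rpow_le_rpow (by positivity) (h1 i) (hκ i).le
        · have := hpos i; positivity
    _ = (2 * ((d : ℝ) + 1)) ^ (∑ i, κ i) * (1 + r ^ 2 / Y) ^ (∑ i ∈ Finset.univ.erase j, κ i) := by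
        rw [← Real.rpow_sum_of_pos (by positivity),
          Real.mul_rpow (x := 2 * ((d : ℝ) + 1)) (y := 1 + r ^ 2 / Y) (by positivity) (by positivity),
          ← mul_assoc, ← Real.rpow_add (by positivity), Finset.add_sum_erase _ _ (Finset.mem_univ j)]
    _ ≤ _ := by
        refine mul_le_mul_of_nonneg_left (Real.rpow_le_rpow_of_exponent_le hone ?_) (by positivity)
        have h6 := Finset.add_sum_erase Finset.univ κ (Finset.mem_univ j)
        have h7 := Finset.inf'_le κ (Finset.mem_univ j)
        linarith

theorem abs_sum_boolSign_le {m : ℕ} (a : Fin m → ℝ) (ε : Fin m → Bool) :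
    |∑ i, boolSign (ε i) * a i| ≤ ∑ i, |a i| := by
  refine (Finset.abs_sum_le_sum_abs _ _).trans (Finset.sum_le_sum fun i _ => ?_)
  rw [abs_mul]
  have : |boolSign (ε i)| = 1 := by cases ε i <;> simp [boolSign]
  rw [this, one_mul]

theorem norm_ebar_sub_le_sin {m : ℕ} {x y : EuclideanSpace ℝ (Fin m)}
    (hx : x ∈ Metric.sphere (0 : EuclideanSpace ℝ (Fin m)) 1)
    (hy : y ∈ Metric.sphere (0 : EuclideanSpace ℝ (Fin m)) 1) {u : ℝ}
    (hu : |u| ≤ ∑ i, |x i * y i|) :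
    ‖ebar x - ebar y‖ ≤ 2 * Real.sin (Real.arccos u) := by
  have h1 := sum_abs_mul_le_one hx hy
  have h2 := norm_ebar_sub_sq_eq hx hy
  rw [Real.sin_arccos]
  have h3 : 0 ≤ 1 - u ^ 2 := by rw [← sq_abs]; nlinarith [abs_nonneg u]
  refine abs_le_of_sq_le_sq' ?_ (by positivity) |>.2
  rw [mul_pow, Real.sq_sqrt h3, h2, ← sq_abs u]
  nlinarith [abs_nonneg u]

/-! ### Distances on the circle -/

theorem exp_neg_inv_bounds {n : ℕ} (hn : 1 ≤ n) :
    1 / 3 ≤ Real.exp (-(1 / (n : ℝ))) ∧ Real.exp (-(1 / (n : ℝ))) < 1 ∧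
      1 / (3 * (n : ℝ)) ≤ 1 - Real.exp (-(1 / (n : ℝ))) ∧
      1 - Real.exp (-(1 / (n : ℝ))) ≤ 1 / n := by
  have hn' : (1 : ℝ) ≤ n := by exact_mod_cast hn
  have hn0 : (0 : ℝ) < n := by linarith
  set t := 1 / (n : ℝ) with ht
  have ht0 : 0 < t := by positivity
  have ht1 : t ≤ 1 := (div_le_one hn0).2 hn'
  have he : 1 / 3 ≤ Real.exp (-t) := by
    have h1 : Real.exp t ≤ 3 :=
      (Real.exp_le_exp.2 ht1).trans (by linarith [Real.exp_one_lt_d9])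
    rw [Real.exp_neg, ← one_div]
    exact one_div_le_one_div_of_le (Real.exp_pos _) h1
  refine ⟨he, Real.exp_zero ▸ Real.exp_lt_exp.2 (by linarith), ?_, by linarith [Real.add_one_le_exp (-t)]⟩
  have e1 : 1 / (3 * (n : ℝ)) = t / 3 := by rw [ht]; field_simp
  have h2 : Real.exp (-t) * (1 + t) ≤ 1 := by
    have h3 : Real.exp (-t) * Real.exp t = 1 := by rw [← Real.exp_add]; simp
    nlinarith [Real.add_one_le_exp t, Real.exp_pos (-t)]
  rw [e1]
  nlinarith

theorem circle_point_re_im (ρ φ : ℝ) :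
    (circleMap 0 ρ φ).re = ρ * Real.cos φ ∧ (circleMap 0 ρ φ).im = ρ * Real.sin φ := by
  constructor <;> simp [circleMap, Complex.exp_re, Complex.exp_im]

theorem norm_sub_exp_sq (ρ φ η : ℝ) : ‖circleMap 0 ρ φ - circleMap 0 1 η‖ ^ 2 =
    (1 - ρ) ^ 2 + 4 * ρ * Real.sin ((φ - η) / 2) ^ 2 := by
  have h1 := circle_point_re_im ρ φ
  have h2 := circle_point_re_im 1 η
  rw [← Complex.normSq_eq_norm_sq, Complex.normSq_apply, Complex.sub_re, Complex.sub_im, h1.1, h1.2,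
    h2.1, h2.2]
  have h3 : Real.cos (φ - η) = 1 - 2 * Real.sin ((φ - η) / 2) ^ 2 := by
    have := Real.cos_two_mul ((φ - η) / 2)
    rw [mul_div_cancel₀ _ two_ne_zero] at this
    rw [this, Real.cos_sq']; ring
  rw [Real.cos_sub] at h3
  have := Real.sin_sq_add_cos_sq φ
  have := Real.sin_sq_add_cos_sq η
  linear_combination ρ ^ 2 * Real.sin_sq_add_cos_sq φ + Real.sin_sq_add_cos_sq η - 2 * ρ * h3

theorem abs_div_four_le_norm_sub {ρ φ η : ℝ} (hρ : 1 / 3 ≤ ρ) (h : |φ - η| ≤ π) :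
    |φ - η| / 4 ≤ ‖circleMap 0 ρ φ - circleMap 0 1 η‖ := by
  have h1 : 2 / π * (|φ - η| / 2) ≤ Real.sin (|φ - η| / 2) :=
    Real.mul_le_sin (by positivity) (by linarith)
  have h2 : Real.sin (|φ - η| / 2) ^ 2 = Real.sin ((φ - η) / 2) ^ 2 := by
    rcases abs_cases (φ - η) with ⟨h, -⟩ | ⟨h, -⟩
    · rw [h]
    · rw [h, neg_div, Real.sin_neg, neg_sq]
  refine abs_le_of_sq_le_sq' ?_ (norm_nonneg _) |>.2
  rw [norm_sub_exp_sq, ← h2]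
  have h3 : 0 ≤ |φ - η| / 4 := by positivity
  have h4 : |φ - η| / 4 ≤ Real.sin (|φ - η| / 2) := by
    refine le_trans ?_ h1
    have : 1 / 2 ≤ 2 / π := by
      rw [div_le_div_iff₀ (by norm_num) Real.pi_pos]; linarith [Real.pi_le_four]
    nlinarith
  have h5 : (|φ - η| / 4) ^ 2 ≤ Real.sin (|φ - η| / 2) ^ 2 := by gcongr
  nlinarith [sq_nonneg (1 - ρ), sq_nonneg (Real.sin (|φ - η| / 2))]

theorem joukowski_sub_cos {z : ℂ} (hz : z ≠ 0) (η : ℝ) :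
    joukowski z - (Real.cos η : ℂ) =
      (z - circleMap 0 1 η) * (z - circleMap 0 1 (-η)) / (2 * z) := by
  have h1 : (circleMap 0 1 η : ℂ) = Complex.cos η + Complex.sin η * Complex.I := by
    simp [circleMap, Complex.exp_mul_I]
  have h2 : (circleMap 0 1 (-η) : ℂ) = Complex.cos η - Complex.sin η * Complex.I := by
    simp [circleMap, ← neg_mul, Complex.exp_mul_I, Complex.cos_neg, Complex.sin_neg, sub_eq_add_neg]
  rw [h1, h2, joukowski]
  push_cast
  field_simp
  linear_combination -(Complex.sin_sq_add_cos_sq (η : ℂ)) + Complex.sin (η : ℂ) ^ 2 * Complex.I_sq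

theorem norm_joukowski_sub_cos_ge {n : ℕ} (hn : 1 ≤ n) {φ η : ℝ} (hφ : φ ∈ Set.Ioo 0 π)
    (hη : η ∈ Set.Icc 0 π) :
    (1 + n * Real.sin φ + n * Real.sin η) * (1 + n * |φ - η|) / (96 * (n : ℝ) ^ 2) ≤
      ‖joukowski (circleMap 0 (Real.exp (-(1 / (n : ℝ)))) φ) - (Real.cos η : ℂ)‖ := by
  obtain ⟨h1, h2, h3, -⟩ := exp_neg_inv_bounds hn
  set ρ := Real.exp (-(1 / (n : ℝ)))
  have hn0 : (0 : ℝ) < n := by exact_mod_cast hn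
  have hρ : 0 < ρ := by linarith
  have hsφ := Real.sin_pos_of_mem_Ioo hφ
  have hsη := Real.sin_nonneg_of_mem_Icc hη
  set z := circleMap 0 ρ φ with hz
  have hnz : ‖z‖ = ρ := by rw [hz, norm_circleMap_zero, abs_of_pos hρ]
  have hz0 : z ≠ 0 := by rw [← norm_pos_iff, hnz]; exact hρ
  have hbase : ∀ θ, 1 / (3 * (n : ℝ)) ≤ ‖z - circleMap 0 1 θ‖ := by
    intro θ
    have := norm_sub_norm_le (circleMap 0 1 θ) z
    rw [hnz, norm_circleMap_zero, abs_one, norm_sub_rev] at this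
    linarith
  have hA : (1 + n * |φ - η|) / (8 * n) ≤ ‖z - circleMap 0 1 η‖ := by
    have h4 := hbase η
    have h5 : |φ - η| / 4 ≤ ‖z - circleMap 0 1 η‖ :=
      abs_div_four_le_norm_sub h1 (abs_le.2 ⟨by linarith [hφ.1, hη.2], by linarith [hφ.2, hη.1]⟩)
    have e : (1 + n * |φ - η|) / (8 * n) = 3 / 8 * (1 / (3 * (n : ℝ))) + |φ - η| / 4 / 2 := by
      field_simp; ring
    rw [e]
    linarith [norm_nonneg (z - circleMap 0 1 η)]
  have hB : (1 + n * Real.sin φ + n * Real.sin η) / (6 * n) ≤ ‖z - circleMap 0 1 (-η)‖ := by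
    have h4 := hbase (-η)
    have h5 : ρ * Real.sin φ + Real.sin η ≤ ‖z - circleMap 0 1 (-η)‖ := by
      have := (le_abs_self _).trans (Complex.abs_im_le_norm (z - circleMap 0 1 (-η)))
      rw [Complex.sub_im, (circle_point_re_im _ _).2, (circle_point_re_im _ _).2, Real.sin_neg] at this
      linarith
    have e : (1 + n * Real.sin φ + n * Real.sin η) / (6 * n) =
        1 / 2 * (1 / (3 * (n : ℝ))) + (Real.sin φ + Real.sin η) / 6 := by
      field_simp; ring
    rw [e]
    nlinarith
  rw [joukowski_sub_cos hz0, norm_div, norm_mul, norm_mul, hnz]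
  have h6 : ‖z - circleMap 0 1 η‖ * ‖z - circleMap 0 1 (-η)‖ / 2 ≤
      ‖z - circleMap 0 1 η‖ * ‖z - circleMap 0 1 (-η)‖ / (‖(2 : ℂ)‖ * ρ) := by
    rw [RCLike.norm_ofNat]
    exact div_le_div_of_nonneg_left (by positivity) (by positivity) (by linarith)
  refine le_trans ?_ h6
  have h7 := mul_le_mul hA hB (by positivity) (norm_nonneg _)
  have e : (1 + n * Real.sin φ + n * Real.sin η) * (1 + n * |φ - η|) / (96 * (n : ℝ) ^ 2) =
      (1 + n * |φ - η|) / (8 * n) * ((1 + n * Real.sin φ + n * Real.sin η) / (6 * n)) / 2 := by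
    field_simp; ring
  rw [e]
  linarith

theorem norm_one_sub_sq_le {n : ℕ} (hn : 1 ≤ n) {φ : ℝ} (hφ : φ ∈ Set.Ioo 0 π) :
    ‖1 - circleMap 0 (Real.exp (-(1 / (n : ℝ)))) φ ^ 2‖ ≤ 2 * (1 + n * Real.sin φ) / n := by
  obtain ⟨h1, h2, -, h3⟩ := exp_neg_inv_bounds hn
  set ρ := Real.exp (-(1 / (n : ℝ)))
  have hn0 : (0 : ℝ) < n := by exact_mod_cast hn
  have hsφ := Real.sin_pos_of_mem_Ioo hφ
  have h4 : circleMap 0 ρ φ ^ 2 = circleMap 0 (ρ ^ 2) (2 * φ) := by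
    simp only [circleMap, zero_add, mul_pow, ← Complex.exp_nat_mul]
    push_cast; ring_nf
  have h5 : ‖circleMap 0 (ρ ^ 2) (2 * φ) - circleMap 0 1 0‖ ^ 2 ≤
      (2 * (1 + n * Real.sin φ) / n) ^ 2 := by
    rw [norm_sub_exp_sq]
    have e1 : (2 * φ - 0) / 2 = φ := by ring
    have e2 : 2 * (1 + n * Real.sin φ) / n = 2 * (1 / n) + 2 * Real.sin φ := by field_simp
    rw [e1, e2]
    have a1 : 1 - ρ ^ 2 ≤ 2 * (1 / n) := by nlinarith
    have a2 : 0 ≤ 1 - ρ ^ 2 := by nlinarith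
    have a3 : (1 - ρ ^ 2) ^ 2 ≤ (2 * (1 / n)) ^ 2 := by gcongr
    have a4 : ρ ^ 2 ≤ 1 := by linarith
    have a5 : 0 ≤ 1 / (n : ℝ) * Real.sin φ := by positivity
    nlinarith [mul_le_mul_of_nonneg_right a4 (sq_nonneg (Real.sin φ))]
  rw [h4, norm_sub_rev]
  have e0 : circleMap 0 1 0 = 1 := by simp [circleMap]
  rw [e0] at h5
  exact abs_le_of_sq_le_sq' h5 (by positivity) |>.2

theorem norm_one_sub_ge {n : ℕ} (hn : 1 ≤ n) {φ : ℝ} (hφ : φ ∈ Set.Ioo 0 π) :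
    (1 + n * Real.sin φ) / (6 * n) ≤ ‖1 - circleMap 0 (Real.exp (-(1 / (n : ℝ)))) φ‖ := by
  obtain ⟨h1, h2, h3, -⟩ := exp_neg_inv_bounds hn
  set ρ := Real.exp (-(1 / (n : ℝ)))
  have hn0 : (0 : ℝ) < n := by exact_mod_cast hn
  have hsφ := Real.sin_pos_of_mem_Ioo hφ
  have h4 := norm_sub_norm_le 1 (circleMap 0 ρ φ)
  rw [norm_circleMap_zero, abs_of_pos (by linarith), norm_one] at h4
  have h5 := (neg_le_abs _).trans (Complex.abs_im_le_norm (1 - circleMap 0 ρ φ))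
  rw [Complex.sub_im, (circle_point_re_im _ _).2, Complex.one_im] at h5
  have e : (1 + n * Real.sin φ) / (6 * n) = 1 / 2 * (1 / (3 * (n : ℝ))) + Real.sin φ / 6 := by
    field_simp; ring
  rw [e]
  nlinarith

/-! ### Bounding the contour integrand -/

theorem sign_term_le {q M Y x n s r t : ℝ} (hn : 0 < n) (hx : 0 < x)
    (hY : x / (96 * n ^ 2) ≤ Y) (hq : 0 ≤ q) (hM : 0 ≤ M) (ht : 0 ≤ t)
    (hts : t ≤ 2 * (1 + s) / n) :
    (1 + r ^ 2 / Y) ^ M * (Y ^ (-q) * (1 + t ^ 2 / Y)) ≤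
      96 ^ M * 96 ^ q * 384 * n ^ (2 * q) *
        ((1 + (1 + s) ^ 2 / x) * (1 + (n * r) ^ 2 / x) ^ M * x ^ (-q)) := by
  have hY0 : 0 < Y := lt_of_lt_of_le (by positivity) hY
  have hinv : ∀ u, 0 ≤ u → u / Y ≤ 96 * (n ^ 2 * u / x) := by
    intro u hu
    have e : 96 * (n ^ 2 * u / x) = u / (x / (96 * n ^ 2)) := by field_simp
    rw [e]
    exact div_le_div_of_nonneg_left hu (by positivity) hY
  have h1 : 1 + r ^ 2 / Y ≤ 96 * (1 + (n * r) ^ 2 / x) := by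
    have := hinv (r ^ 2) (sq_nonneg _)
    rw [mul_pow]; linarith
  have h2 : 1 + t ^ 2 / Y ≤ 384 * (1 + (1 + s) ^ 2 / x) := by
    have h3 : t ^ 2 ≤ (2 * (1 + s) / n) ^ 2 := by gcongr
    have h4 := (div_le_div_of_nonneg_right h3 hY0.le).trans (hinv _ (sq_nonneg _))
    have e : 96 * (n ^ 2 * (2 * (1 + s) / n) ^ 2 / x) = 384 * ((1 + s) ^ 2 / x) := by
      field_simp; ring
    linarith
  have h3 : Y ^ (-q) ≤ 96 ^ q * n ^ (2 * q) * x ^ (-q) := by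
    refine (Real.rpow_le_rpow_of_nonpos (by positivity) hY (by linarith)).trans_eq ?_
    rw [Real.div_rpow hx.le (by positivity), Real.rpow_neg (by positivity : 0 ≤ 96 * n ^ 2),
      Real.mul_rpow (by norm_num) (by positivity), Real.rpow_mul hn.le, Real.rpow_two,
      div_inv_eq_mul, mul_comm]
  calc (1 + r ^ 2 / Y) ^ M * (Y ^ (-q) * (1 + t ^ 2 / Y))
      ≤ (96 * (1 + (n * r) ^ 2 / x)) ^ M *
          (96 ^ q * n ^ (2 * q) * x ^ (-q) * (384 * (1 + (1 + s) ^ 2 / x))) := by gcongr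
    _ = _ := by rw [Real.mul_rpow (by norm_num) (by positivity)]; ring

/-- The majorant of the contour integrand. -/
noncomputable def peakSum {m : ℕ} (a : Fin m → ℝ) (n : ℝ) (θ : ℝ) : ℝ :=
  ∑ ε : Fin m → Bool, ((1 + n * |Real.sin θ|) ^ (-2 : ℝ) +
    (1 + n * |θ - Real.arccos (∑ i, boolSign (ε i) * a i)|) ^ (-(3 / 2) : ℝ))

theorem contourBound_mul_hsq_le {d : ℕ} (hd : 1 ≤ d) {κ : Fin (d + 1) → ℝ} (hκ : ∀ i, 0 < κ i)
    {δ : ℝ} (hδ : -1 < δ) : ∃ C : ℝ, 0 < C ∧ ∀ n : ℕ, 1 ≤ n →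
      ∀ x y : EuclideanSpace ℝ (Fin (d + 1)),
      x ∈ Metric.sphere (0 : EuclideanSpace ℝ (Fin (d + 1))) 1 →
      y ∈ Metric.sphere (0 : EuclideanSpace ℝ (Fin (d + 1))) 1 → ∀ φ ∈ Set.Ioo 0 π,
      contourBound δ (lamK d κ) κ (fun i => x i * y i)
        (circleMap 0 (Real.exp (-(1 / (n : ℝ)))) φ) * hsq κ y ≤
      C * (n : ℝ) ^ (δ + d + 2) * (1 + (n : ℝ) * ‖ebar x - ebar y‖) ^
        (-(min ((d : ℝ) + 1) (δ + (d : ℝ) - sigmaK d κ))) *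
        peakSum (fun i => x i * y i) n φ := by
  set q : ℝ := ((d : ℝ) + 1) / 2 with hq
  set M : ℝ := ∑ i, κ i - Finset.univ.inf' Finset.univ_nonempty κ with hM
  set β : ℝ := min ((d : ℝ) + 1) (δ + (d : ℝ) - sigmaK d κ) with hβ
  have hd' : (1 : ℝ) ≤ d := by exact_mod_cast hd
  have hM0 : 0 ≤ M := by
    have h1 := Finset.inf'_le κ (Finset.mem_univ (0 : Fin (d + 1)))
    have h2 := Finset.single_le_sum (f := κ) (fun i _ => (hκ i).le)
      (Finset.mem_univ (0 : Fin (d + 1)))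
    linarith
  obtain ⟨C₀, hC₀, hpt⟩ := exists_pointwise_bound (p := δ + 1) (q := q) (M := M) (β := β)
    (by linarith) (by linarith) hM0 ((min_le_left _ _).trans (by linarith))
    ((min_le_right _ _).trans (by rw [sigmaK]; linarith))
  obtain ⟨C₁, hC₁, hF₁⟩ := norm_cubeInt_le hκ (j := 0) le_rfl
  obtain ⟨C₂, hC₂, hF₂⟩ := norm_cubeInt_le hκ (j := 1) zero_le_one
  have hcard : ∑ i : Fin (d + 1), (κ i + 1 / 2) = lamK d κ + 1 := by
    rw [Finset.sum_add_distrib, lamK, Finset.sum_const, Finset.card_univ, Fintype.card_fin]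
    simp; ring
  set A : ℝ := (2 * ((d : ℝ) + 1)) ^ (∑ i, κ i) with hA
  have hA0 : 0 < A := by positivity
  refine ⟨6 ^ (δ + 1) * ((C₁ + C₂) * (A * (96 ^ M * 96 ^ q * 384))) * C₀, by positivity,
    fun n hn x y hx hy φ hφ => ?_⟩
  have hn0 : (0 : ℝ) < n := by exact_mod_cast hn
  obtain ⟨hρ3, hρ1, -, -⟩ := exp_neg_inv_bounds hn
  have hZ := fun {η : ℝ} => norm_joukowski_sub_cos_ge hn hφ (η := η)
  have hT := norm_one_sub_sq_le hn hφ
  have hO := norm_one_sub_ge hn hφ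
  set ρ := Real.exp (-(1 / (n : ℝ))) with hρ
  set z := circleMap 0 ρ φ with hz
  set a : Fin (d + 1) → ℝ := fun i => x i * y i with ha
  set r := ‖ebar x - ebar y‖ with hr
  have hsφ := Real.sin_pos_of_mem_Ioo hφ
  have hnz : ‖z‖ = ρ := by rw [hz, norm_circleMap_zero, abs_of_pos (by linarith)]
  have hzim : 0 < z.im := by
    rw [hz, (circle_point_re_im _ _).2]; exact mul_pos (by linarith) hsφ
  have hF₁' := hF₁ a z hzim (hnz ▸ hρ3) (hnz ▸ hρ1)
  have hF₂' := hF₂ a z hzim (hnz ▸ hρ3) (hnz ▸ hρ1)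
  rw [hcard, add_zero] at hF₁'
  rw [hcard, add_assoc, one_add_one_eq_two] at hF₂'
  set s := n * Real.sin φ with hs
  have hs0 : 0 ≤ s := by positivity
  set t := ‖1 - z ^ 2‖ with ht
  have ht0 : 0 ≤ t := norm_nonneg _
  have hH : 0 ≤ hsq κ y := Finset.prod_nonneg fun i _ => by positivity
  have hY : ∀ ε, 0 < signDist a (joukowski z) ε :=
    signDist_pos a (joukowski_im_neg hzim (hnz ▸ hρ1))
  set Y := signDist a (joukowski z) with hYdef
  set P : (Fin (d + 1) → Bool) → ℝ := fun ε => ∏ i, (Y ε + |a i|) ^ (-κ i) with hP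
  have hP0 : ∀ ε, 0 ≤ P ε := fun ε => Finset.prod_nonneg fun i _ => by
    have := hY ε; positivity
  have hm : (((d + 1 : ℕ) : ℝ) / 2) = q := by rw [hq]; push_cast; rfl
  rw [hm, add_zero] at hF₁'
  rw [hm] at hF₂'
  have hterm : ∀ ε, P ε * hsq κ y * (Y ε ^ (-q) * (1 + t ^ 2 / Y ε)) * (1 + s) ^ (-(δ + 1)) ≤
      A * (96 ^ M * 96 ^ q * 384) * n ^ (2 * q) * C₀ * ((1 + n * r) ^ (-β) *
        ((1 + s) ^ (-2 : ℝ) +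
          (1 + n * |φ - Real.arccos (∑ i, boolSign (ε i) * a i)|) ^ (-(3 / 2) : ℝ))) := by
    intro ε
    set u := ∑ i, boolSign (ε i) * a i with hu
    set η := Real.arccos u with hη
    have hua := abs_sum_boolSign_le a ε
    rw [← hu] at hua
    have hu1 : |u| ≤ 1 := hua.trans (sum_abs_mul_le_one hx hy)
    have hcos : Real.cos η = u := Real.cos_arccos (abs_le.1 hu1).1 (abs_le.1 hu1).2
    have hηm : η ∈ Set.Icc 0 π := ⟨Real.arccos_nonneg _, Real.arccos_le_pi _⟩
    have hsη := Real.sin_nonneg_of_mem_Icc hηm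
    have hYε : (1 + s + n * Real.sin η) * (1 + n * |φ - η|) / (96 * (n : ℝ) ^ 2) ≤ Y ε := by
      refine (hZ hηm).trans_eq ?_
      rw [hcos, hYdef, signDist, hu]
      push_cast
      rfl
    have h1 := hsq_mul_prod_le hκ hx hy (hY ε)
    rw [mul_comm (hsq κ y)] at h1
    have h2 := sign_term_le (q := q) (M := M) (r := r) hn0 (by positivity) hYε
      (by positivity) hM0 ht0 hT
    have h3 : |s - n * Real.sin η| ≤ n * |φ - η| := by
      rw [hs, ← mul_sub, abs_mul, abs_of_pos hn0]
      exact mul_le_mul_of_nonneg_left (Real.abs_sin_sub_sin_le φ η) hn0.le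
    have h4 := hpt s (n * Real.sin η) (n * |φ - η|) (n * r) hs0 (by positivity) (by positivity)
      (by
        have := mul_le_mul_of_nonneg_left (norm_ebar_sub_le_sin hx hy hua) hn0.le
        rw [← hr, ← hη] at this; linarith) h3
    set X := (1 + s + n * Real.sin η) * (1 + n * |φ - η|) with hX
    have hYp := hY ε
    have hs' : 0 ≤ (1 + s) ^ (-(δ + 1)) := by positivity
    calc P ε * hsq κ y * (Y ε ^ (-q) * (1 + t ^ 2 / Y ε)) * (1 + s) ^ (-(δ + 1))
        ≤ (A * (1 + r ^ 2 / Y ε) ^ M) * (Y ε ^ (-q) * (1 + t ^ 2 / Y ε)) *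
            (1 + s) ^ (-(δ + 1)) :=
          mul_le_mul_of_nonneg_right (mul_le_mul_of_nonneg_right h1 (by positivity)) hs'
      _ = A * ((1 + r ^ 2 / Y ε) ^ M * (Y ε ^ (-q) * (1 + t ^ 2 / Y ε))) *
            (1 + s) ^ (-(δ + 1)) := by ring
      _ ≤ A * (96 ^ M * 96 ^ q * 384 * n ^ (2 * q) *
            ((1 + (1 + s) ^ 2 / X) * (1 + (n * r) ^ 2 / X) ^ M * X ^ (-q))) *
            (1 + s) ^ (-(δ + 1)) := by gcongr
      _ = A * (96 ^ M * 96 ^ q * 384) * n ^ (2 * q) * ((1 + s) ^ (-(δ + 1)) *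
            (1 + (1 + s) ^ 2 / X) * (1 + (n * r) ^ 2 / X) ^ M * X ^ (-q)) := by ring
      _ ≤ A * (96 ^ M * 96 ^ q * 384) * n ^ (2 * q) * (C₀ * ((1 + n * r) ^ (-β) *
            ((1 + s) ^ (-2 : ℝ) + (1 + n * |φ - η|) ^ (-(3 / 2) : ℝ)))) :=
          mul_le_mul_of_nonneg_left h4 (by positivity)
      _ = _ := by ring
  have hpow : ‖1 - z‖ ^ (-δ - 1) ≤ 6 ^ (δ + 1) * n ^ (δ + 1) * (1 + s) ^ (-(δ + 1)) := by
    have e : -δ - 1 = -(δ + 1) := by ring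
    rw [e]
    refine (Real.rpow_le_rpow_of_nonpos (by positivity) hO (by linarith)).trans_eq ?_
    rw [Real.div_rpow (by positivity) (by positivity), Real.rpow_neg (by positivity : 0 ≤ 6 * (n:ℝ)),
      Real.mul_rpow (by norm_num) hn0.le, div_inv_eq_mul, mul_comm]
  have hsum : (‖cubeInt κ a (lamK d κ + 1) z‖ + t ^ 2 * ‖cubeInt κ a (lamK d κ + 2) z‖) ≤
      (C₁ + C₂) * ∑ ε, P ε * (Y ε ^ (-q) * (1 + t ^ 2 / Y ε)) := by
    have e : ∀ ε, P ε * (Y ε ^ (-q) * (1 + t ^ 2 / Y ε)) =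
        Y ε ^ (-q) * P ε + t ^ 2 * (Y ε ^ (-(q + 1)) * P ε) := by
      intro ε
      rw [neg_add, Real.rpow_add (hY ε), Real.rpow_neg_one]
      ring
    simp only [e, Finset.sum_add_distrib, ← Finset.mul_sum]
    have p1 : 0 ≤ ∑ ε, Y ε ^ (-q) * P ε := Finset.sum_nonneg fun ε _ => by
      have := hY ε; have := hP0 ε; positivity
    have p2 : 0 ≤ ∑ ε, Y ε ^ (-(q + 1)) * P ε := Finset.sum_nonneg fun ε _ => by
      have := hY ε; have := hP0 ε; positivity
    have p3 := mul_le_mul_of_nonneg_left hF₂' (sq_nonneg t)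
    nlinarith [mul_nonneg hC₂.le p1, mul_nonneg hC₁.le (mul_nonneg (sq_nonneg t) p2)]
  have hpk : peakSum a n φ = ∑ ε : Fin (d + 1) → Bool, ((1 + s) ^ (-2 : ℝ) +
      (1 + n * |φ - Real.arccos (∑ i, boolSign (ε i) * a i)|) ^ (-(3 / 2) : ℝ)) := by
    rw [peakSum, abs_of_pos hsφ]
  have hexp : (n : ℝ) ^ (δ + d + 2) = n ^ (δ + 1) * n ^ (2 * q) := by
    rw [← Real.rpow_add hn0]; congr 1; rw [hq]; ring
  have hsum0 : 0 ≤ ‖cubeInt κ a (lamK d κ + 1) z‖ + t ^ 2 * ‖cubeInt κ a (lamK d κ + 2) z‖ := by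
    positivity
  rw [contourBound, hpk, hexp]
  calc ‖1 - z‖ ^ (-δ - 1) *
        (‖cubeInt κ a (lamK d κ + 1) z‖ + t ^ 2 * ‖cubeInt κ a (lamK d κ + 2) z‖) * hsq κ y
      ≤ (6 ^ (δ + 1) * n ^ (δ + 1) * (1 + s) ^ (-(δ + 1))) *
          ((C₁ + C₂) * ∑ ε, P ε * (Y ε ^ (-q) * (1 + t ^ 2 / Y ε))) * hsq κ y := by gcongr
    _ = 6 ^ (δ + 1) * n ^ (δ + 1) * (C₁ + C₂) *
          ∑ ε, P ε * hsq κ y * (Y ε ^ (-q) * (1 + t ^ 2 / Y ε)) * (1 + s) ^ (-(δ + 1)) := by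
        simp only [Finset.mul_sum, Finset.sum_mul]
        exact Finset.sum_congr rfl fun ε _ => by ring
    _ ≤ 6 ^ (δ + 1) * n ^ (δ + 1) * (C₁ + C₂) *
          ∑ ε : Fin (d + 1) → Bool, A * (96 ^ M * 96 ^ q * 384) * n ^ (2 * q) * C₀ *
            ((1 + n * r) ^ (-β) * ((1 + s) ^ (-2 : ℝ) +
          (1 + n * |φ - Real.arccos (∑ i, boolSign (ε i) * a i)|) ^ (-(3 / 2) : ℝ))) :=
        mul_le_mul_of_nonneg_left (Finset.sum_le_sum fun ε _ => hterm ε) (by positivity)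
    _ = _ := by
        simp only [Finset.mul_sum]
        exact Finset.sum_congr rfl fun ε _ => by ring

/-! ### Integrating the majorant -/

theorem integrable_one_add_abs_rpow :
    Integrable fun t : ℝ => (1 + |t|) ^ (-(3 / 2) : ℝ) := by
  have := integrable_one_add_norm (E := ℝ) (μ := volume) (r := 3 / 2) (by simp; norm_num)
  simpa [Real.norm_eq_abs] using this

/-- The integral of the standard peak over the line. -/
noncomputable def peakMass : ℝ := ∫ t : ℝ, (1 + |t|) ^ (-(3 / 2) : ℝ)

theorem peakMass_nonneg : 0 ≤ peakMass := integral_nonneg fun t => by positivity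

theorem continuous_one_add_rpow {f : ℝ → ℝ} (hf : Continuous f) (hf0 : ∀ θ, 0 ≤ f θ) (p : ℝ) :
    Continuous fun θ => (1 + f θ) ^ p :=
  Continuous.rpow_const (by fun_prop) fun θ => Or.inl (by have := hf0 θ; positivity)

theorem continuous_peak {N : ℝ} (hN : 0 ≤ N) (c : ℝ) :
    Continuous fun θ : ℝ => (1 + N * |θ - c|) ^ (-(3 / 2) : ℝ) :=
  continuous_one_add_rpow (f := fun θ => N * |θ - c|) (by fun_prop) (fun θ => by positivity) _

theorem continuous_peak_sin {n : ℝ} (hn : 0 ≤ n) :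
    Continuous fun θ : ℝ => (1 + n * |Real.sin θ|) ^ (-2 : ℝ) :=
  continuous_one_add_rpow (f := fun θ => n * |Real.sin θ|) (by fun_prop) (fun θ => by positivity) _

theorem integral_peak_le {N : ℝ} (hN : 0 < N) (c : ℝ) :
    ∫ θ in (0 : ℝ)..2 * π, (1 + N * |θ - c|) ^ (-(3 / 2) : ℝ) ≤ peakMass / N := by
  have h0 : (0 : ℝ) ≤ 2 * π := by positivity
  have e : ∀ θ, (1 + N * |θ - c|) ^ (-(3 / 2) : ℝ) =
      (fun t : ℝ => (1 + |t|) ^ (-(3 / 2) : ℝ)) (N * θ - N * c) := by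
    intro θ
    simp only
    rw [← mul_sub, abs_mul, abs_of_pos hN]
  simp only [e]
  rw [intervalIntegral.integral_comp_mul_sub
    (f := fun t : ℝ => (1 + |t|) ^ (-(3 / 2) : ℝ)) hN.ne' (N * c)]
  rw [smul_eq_mul, div_eq_inv_mul peakMass]
  refine mul_le_mul_of_nonneg_left ?_ (inv_nonneg.2 hN.le)
  have hle : N * 0 - N * c ≤ N * (2 * π) - N * c := by
    have := mul_nonneg hN.le h0
    linarith
  have hnn : ∀ t : ℝ, 0 ≤ (1 + |t|) ^ (-(3 / 2) : ℝ) := fun t => by positivity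
  rw [intervalIntegral.integral_of_le hle]
  exact setIntegral_le_integral integrable_one_add_abs_rpow (ae_of_all _ hnn)

theorem one_add_sin_rpow_le {n : ℝ} (hn : 0 ≤ n) {θ : ℝ} (hθ : θ ∈ Set.Icc 0 (2 * π)) :
    (1 + n * |Real.sin θ|) ^ (-2 : ℝ) ≤ (1 + n / 2 * |θ - 0|) ^ (-(3 / 2) : ℝ) +
      (1 + n / 2 * |θ - π|) ^ (-(3 / 2) : ℝ) + (1 + n / 2 * |θ - 2 * π|) ^ (-(3 / 2) : ℝ) := by
  have key : ∀ {c : ℝ}, |θ - c| ≤ π / 2 → |Real.sin θ| = |Real.sin (θ - c)| →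
      (1 + n * |Real.sin θ|) ^ (-2 : ℝ) ≤ (1 + n / 2 * |θ - c|) ^ (-(3 / 2) : ℝ) := by
    intro c h1 h2
    have h3 : 2 / π * |θ - c| ≤ |Real.sin (θ - c)| := Real.mul_abs_le_abs_sin h1
    have h4 : 1 / 2 ≤ 2 / π := by
      rw [div_le_div_iff₀ (by norm_num) Real.pi_pos]; linarith [Real.pi_le_four]
    have h5 : n / 2 * |θ - c| ≤ n * |Real.sin θ| := by
      rw [h2]
      have : 1 / 2 * |θ - c| ≤ |Real.sin (θ - c)| :=
        (mul_le_mul_of_nonneg_right h4 (abs_nonneg _)).trans h3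
      nlinarith [mul_le_mul_of_nonneg_left this hn]
    have h6 : 0 ≤ n * |Real.sin θ| := by positivity
    exact (Real.rpow_le_rpow_of_exponent_le (by linarith) (by norm_num)).trans
      (Real.rpow_le_rpow_of_nonpos (by positivity) (by linarith) (by norm_num))
  have p0 : 0 ≤ (1 + n / 2 * |θ - 0|) ^ (-(3 / 2) : ℝ) := by positivity
  have p1 : 0 ≤ (1 + n / 2 * |θ - π|) ^ (-(3 / 2) : ℝ) := by positivity
  have p2 : 0 ≤ (1 + n / 2 * |θ - 2 * π|) ^ (-(3 / 2) : ℝ) := by positivity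
  have hπ := Real.pi_pos
  rcases le_total θ (π / 2) with h | h
  · have := key (c := 0) (by rw [sub_zero, abs_of_nonneg hθ.1]; exact h) (by simp)
    linarith
  rcases le_total θ (3 * π / 2) with h' | h'
  · have := key (c := π) (abs_le.2 ⟨by linarith, by linarith⟩) (by rw [Real.sin_sub_pi, abs_neg])
    linarith
  · have := key (c := 2 * π) (abs_le.2 ⟨by linarith, by linarith [hθ.2]⟩)
      (by rw [Real.sin_sub_two_pi])
    linarith

theorem integral_peak_sin_le {n : ℝ} (hn : 0 < n) :
    ∫ θ in (0 : ℝ)..2 * π, (1 + n * |Real.sin θ|) ^ (-2 : ℝ) ≤ 6 * peakMass / n := by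
  have h0 : (0 : ℝ) ≤ 2 * π := by positivity
  have hi : ∀ c, IntervalIntegrable (fun θ : ℝ => (1 + n / 2 * |θ - c|) ^ (-(3 / 2) : ℝ))
      volume 0 (2 * π) := fun c => (continuous_peak (by positivity) c).intervalIntegrable _ _
  refine (intervalIntegral.integral_mono_on h0
    ((continuous_peak_sin hn.le).intervalIntegrable _ _) (((hi 0).add (hi π)).add (hi (2 * π)))
    fun θ hθ => one_add_sin_rpow_le hn.le hθ).trans ?_
  rw [intervalIntegral.integral_add ((hi 0).add (hi π)) (hi _),
    intervalIntegral.integral_add (hi 0) (hi π)]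
  have hp := fun c => integral_peak_le (N := n / 2) (by positivity) c
  have e : 6 * peakMass / n = 3 * (peakMass / (n / 2)) := by field_simp; ring
  rw [e]
  linarith [hp 0, hp π, hp (2 * π)]

theorem continuous_peakSum {m : ℕ} (a : Fin m → ℝ) {n : ℝ} (hn : 0 ≤ n) :
    Continuous (peakSum a n) :=
  continuous_finsetSum _ fun _ _ => (continuous_peak_sin hn).add (continuous_peak hn _)

theorem peakSum_nonneg {m : ℕ} (a : Fin m → ℝ) {n : ℝ} (hn : 0 ≤ n) (θ : ℝ) :
    0 ≤ peakSum a n θ :=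
  Finset.sum_nonneg fun _ _ => by positivity

theorem integral_peakSum_le {m : ℕ} (a : Fin m → ℝ) {n : ℝ} (hn : 0 < n) :
    ∫ θ in (0 : ℝ)..2 * π, peakSum a n θ ≤ 2 ^ m * (7 * peakMass) / n := by
  have h1 := (continuous_peak_sin hn.le).intervalIntegrable (μ := volume) 0 (2 * π)
  have h2 := fun c => (continuous_peak hn.le c).intervalIntegrable (μ := volume) 0 (2 * π)
  unfold peakSum
  rw [intervalIntegral.integral_finsetSum fun ε _ => h1.add (h2 _)]
  have : ∀ ε : Fin m → Bool, ∫ θ in (0 : ℝ)..2 * π, ((1 + n * |Real.sin θ|) ^ (-2 : ℝ) +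
      (1 + n * |θ - Real.arccos (∑ i, boolSign (ε i) * a i)|) ^ (-(3 / 2) : ℝ)) ≤
      7 * peakMass / n := by
    intro ε
    rw [intervalIntegral.integral_add h1 (h2 _)]
    have e : 7 * peakMass / n = 6 * peakMass / n + peakMass / n := by ring
    rw [e]
    exact add_le_add (integral_peak_sin_le hn) (integral_peak_le hn _)
  refine (Finset.sum_le_sum fun ε _ => this ε).trans_eq ?_
  rw [Finset.sum_const, Finset.card_univ]
  simp
  ring

theorem lamK_pos {d : ℕ} (hd : 1 ≤ d) {κ : Fin (d + 1) → ℝ} (hκ : ∀ i, 0 < κ i) :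
    0 < lamK d κ := by
  have h1 : 0 < ∑ i, κ i := Finset.sum_pos (fun i _ => hκ i) Finset.univ_nonempty
  have h2 : (1 : ℝ) ≤ d := by exact_mod_cast hd
  rw [lamK]
  linarith

theorem abs_mul_mul_mul_le_of_le {A W I H c₀ p q n B C E J M : ℝ} (hc₀ : 0 < c₀) (hp : 0 < p)
    (hq : 0 < q) (hn : 0 < n) (hB : 0 < B) (hC : 0 < C) (hE : 0 < E) (hH : 0 < H)
    (hA : |A| ≤ (c₀ * p)⁻¹) (hI : |I| ≤ B / n * (C * (p * q * n * n) * E / H * J))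
    (hJ : J ≤ M / n) :
    |A * W * I| * H ≤ c₀⁻¹ * |W| * B * C * M * q * E := by
  have hI' : |I| ≤ B / n * (C * (p * q * n * n) * E / H * (M / n)) := hI.trans (by gcongr)
  rw [abs_mul, abs_mul]
  calc |A| * |W| * |I| * H
      ≤ (c₀ * p)⁻¹ * |W| * (B / n * (C * (p * q * n * n) * E / H * (M / n))) * H := by gcongr
    _ = c₀⁻¹ * |W| * B * C * M * q * E := by field_simp

/-- inequality (2.4): for `δ > -1`, with
`β(δ) = min{d+1, δ+d-σ_κ}`, there is `c > 0` such that for all `n ≥ 1` and `x, y ∈ S^d`,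
`|K_n^δ(h_κ²;x,y)| h_κ²(y) ≤ c n^d (1 + n‖x̄-ȳ‖)^{-β(δ)}`. -/
theorem cesaro_kernel_weighted_estimate_sphere (d : ℕ) (hd : 1 ≤ d) (κ : Fin (d + 1) → ℝ)
    (hκ : ∀ i, 0 < κ i) (δ : ℝ) (hδ : -1 < δ) :
    ∃ c : ℝ, 0 < c ∧ ∀ n : ℕ, 1 ≤ n → ∀ x y : EuclideanSpace ℝ (Fin (d + 1)),
      x ∈ Metric.sphere (0 : EuclideanSpace ℝ (Fin (d + 1))) 1 →
      y ∈ Metric.sphere (0 : EuclideanSpace ℝ (Fin (d + 1))) 1 →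
      |hK d κ δ n x y| * hsq κ y ≤
        c * (n : ℝ) ^ (d : ℝ) *
          (1 + (n : ℝ) * ‖ebar x - ebar y‖) ^
            (-(min ((d : ℝ) + 1) (δ + (d : ℝ) - sigmaK d κ))) := by
  obtain ⟨C, hC, hbound⟩ := contourBound_mul_hsq_le hd hκ hδ
  obtain ⟨c₀, hc₀, hces⟩ := exists_le_cesA hδ
  have hl := lamK_pos hd hκ
  have hm := peakMass_nonneg
  refine ⟨c₀⁻¹ * |(∫ t in cube (d + 1), wprod κ t)⁻¹| *
    (6 * (2 * |δ| + 2 + 12 * (lamK d κ + 1))) * C * (2 ^ (d + 1) * (7 * peakMass)) + 1,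
    by positivity, fun n hn x y hx hy => ?_⟩
  have hn0 : (0 : ℝ) < n := by exact_mod_cast hn
  have hE : 0 < (1 + (n : ℝ) * ‖ebar x - ebar y‖) ^
      (-(min ((d : ℝ) + 1) (δ + (d : ℝ) - sigmaK d κ))) := by positivity
  have hb := hbound n hn x y hx hy
  generalize (1 + (n : ℝ) * ‖ebar x - ebar y‖) ^
      (-(min ((d : ℝ) + 1) (δ + (d : ℝ) - sigmaK d κ))) = E at hE hb ⊢
  have hH : 0 ≤ hsq κ y := Finset.prod_nonneg fun i _ => by positivity
  rcases hH.eq_or_lt with h | hH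
  · rw [← h, mul_zero]; positivity
  have hI := abs_integral_le_of_contourBound_le δ hl hκ (a := fun i => x i * y i)
    (sum_abs_mul_le_one hx hy) hn
    (g := fun θ => C * (n : ℝ) ^ (δ + d + 2) * E / hsq κ y * peakSum (fun i => x i * y i) n θ)
    (continuous_const.mul (continuous_peakSum _ hn0.le))
    (fun θ => mul_nonneg (by positivity) (peakSum_nonneg _ hn0.le θ))
    (fun θ hθ => by
      rw [div_mul_eq_mul_div, le_div_iff₀ hH]
      exact hb θ hθ)
  have hexp : (n : ℝ) ^ (δ + d + 2) = n ^ δ * n ^ (d : ℝ) * n * n := by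
    rw [Real.rpow_add hn0, Real.rpow_add hn0, Real.rpow_two]; ring
  rw [intervalIntegral.integral_const_mul, hexp] at hI
  have hces_pos : 0 < c₀ * (n : ℝ) ^ δ := by positivity
  have hA : |(cesA δ n)⁻¹| ≤ (c₀ * (n : ℝ) ^ δ)⁻¹ := by
    rw [abs_of_pos (inv_pos.2 (hces_pos.trans_le (hces n hn)))]
    exact inv_anti₀ hces_pos (hces n hn)
  have hfin := abs_mul_mul_mul_le_of_le (W := (∫ t in cube (d + 1), wprod κ t)⁻¹) hc₀
    (by positivity) (by positivity) hn0 (by positivity) hC hE hH hA hI (integral_peakSum_le _ hn0)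
  rw [hK_eq d hκ δ n x y]
  refine hfin.trans ?_
  gcongr
  exact le_add_of_nonneg_right zero_le_one
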